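/- Conjugacy invariance of the Poincaré index: let h be a Brouwer homeomorphism of the plane, let O₁, O₂ be two distinct orbits of h, and let Ψ be an orientation preserving homeomorphism of ℝ². Then Ψ∘h∘Ψ⁻¹ is a Brouwer homeomorphism with distinct orbits Ψ(O₁), Ψ(O₂), and for any admissible straightening Φ for (h, O₁, O₂), any admissible straightening Φ′ for (Ψ∘h∘Ψ⁻¹, Ψ(O₁), Ψ(O₂)), any continuous curves γ, γ′ : [0,1] → ℝ² with γ(0), γ′(0) ∈ ℤ₁ and γ(1), γ′(1) ∈ ℤ₂, any angle function θ for Φ∘h∘Φ⁻¹ along γ and any angle function θ′ for Φ′∘(Ψ∘h∘Ψ⁻¹)∘Φ′⁻¹ along γ′, one has θ(1) − θ(0) = θ′(1) − θ′(0); that is, I(Ψ∘h∘Ψ⁻¹, Ψ(O₁), Ψ(O₂)) = I(h, O₁, O₂). -/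

import Mathlib

open Set

/-- The plane. -/
abbrev Plane : Type := ℝ × ℝ

/-- `f` is (the underlying function of) a homeomorphism of the plane. -/
def IsHomeoFun (f : Plane → Plane) : Prop :=
  ∃ e : Plane ≃ₜ Plane, ∀ x, e x = f x

/-- `g` and `g'` are isotopic relative to `O` : there is a continuous family
`F (t, ·)`, `t ∈ [0,1]`, of homeomorphisms of the plane going from `g` to `g'`
and agreeing with `g` on `O` for all times. -/
def IsotopicRel (g g' : Plane → Plane) (O : Set Plane) : Prop :=
  ∃ F : ℝ × Plane → Plane, Continuous F ∧
    (∀ t ∈ Icc (0:ℝ) 1, IsHomeoFun fun x => F (t, x)) ∧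
    (∀ x, F (0, x) = g x) ∧
    (∀ x, F (1, x) = g' x) ∧
    (∀ t ∈ Icc (0:ℝ) 1, ∀ x ∈ O, F (t, x) = g x)

/-- A homeomorphism of the plane is orientation preserving iff it is isotopic
to the identity. -/
def OrientationPreserving (h : Plane ≃ₜ Plane) : Prop :=
  IsotopicRel id (⇑h) (∅ : Set Plane)

/-- A Brouwer homeomorphism: orientation preserving and fixed point free. -/
def IsBrouwer (h : Plane ≃ₜ Plane) : Prop :=
  OrientationPreserving h ∧ ∀ x, h x ≠ x

/-- The orbit of a point under a homeomorphism. -/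
def horbit (h : Plane ≃ₜ Plane) (x : Plane) : Set Plane :=
  {y | ∃ n : ℤ, y = (h.toEquiv ^ n) x}

/-- `ℤ₁ = ℤ × {1}`. -/
def Z1 : Set Plane := {p | ∃ n : ℤ, p = ((n : ℝ), 1)}

/-- `ℤ₂ = ℤ × {2}`. -/
def Z2 : Set Plane := {p | ∃ n : ℤ, p = ((n : ℝ), 2)}

/-- The shear homeomorphism `(x, y) ↦ (x + f y, y)`. -/
def shear (f : ℝ → ℝ) (hf : Continuous f) : Plane ≃ₜ Plane where
  toFun p := (p.1 + f p.2, p.2)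
  invFun p := (p.1 - f p.2, p.2)
  left_inv p := by simp
  right_inv p := by simp
  continuous_toFun := (continuous_fst.add (hf.comp continuous_snd)).prodMk continuous_snd
  continuous_invFun := (continuous_fst.sub (hf.comp continuous_snd)).prodMk continuous_snd

/-- The translation `T (x, y) = (x + 1, y)`. -/
def T : Plane ≃ₜ Plane := shear (fun _ => 1) continuous_const

/-- The twist `T₁ (x, y) = (x + 2 - y, y)`. -/
def T₁ : Plane ≃ₜ Plane := shear (fun y => 2 - y) (by continuity)

/-- The twist `T₂ (x, y) = (x + y - 1, y)`. -/
def T₂ : Plane ≃ₜ Plane := shear (fun y => y - 1) (by continuity)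

/-- The model Reeb homeomorphism `R₀ = T₁ ∘ T₂⁻¹`, `R₀ (x, y) = (x + 3 - 2y, y)`. -/
def R₀ : Plane ≃ₜ Plane := shear (fun y => 3 - 2 * y) (by continuity)

/-- The Euclidean norm on the plane. -/
noncomputable def planeNorm (p : Plane) : ℝ := Real.sqrt (p.1 ^ 2 + p.2 ^ 2)

/-- An angle function for a fixed point free map `h'` along a curve `γ`. -/
def IsAngleFunction (h' : Plane → Plane) (γ : ℝ → Plane) (θ : ℝ → ℝ) : Prop :=
  ContinuousOn θ (Icc 0 1) ∧
    ∀ t ∈ Icc (0:ℝ) 1,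
      h' (γ t) - γ t =
        planeNorm (h' (γ t) - γ t) • (Real.cos (θ t), Real.sin (θ t))

/-- The conjugate `Φ ∘ h ∘ Φ⁻¹`. -/
def conjH (Φ h : Plane ≃ₜ Plane) : Plane ≃ₜ Plane := Φ.symm.trans (h.trans Φ)

/-- An admissible straightening `Φ` for `(h, O₁, O₂)` : an orientation preserving
homeomorphism sending `O₁, O₂` to `ℤ₁, ℤ₂` such that `Φ ∘ h ∘ Φ⁻¹` is isotopic
relative to `ℤ₁ ∪ ℤ₂` to a homeomorphism translating each line `ℝ × {i}` by `±1`. -/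
def AdmissibleStraightening (h : Plane ≃ₜ Plane) (O₁ O₂ : Set Plane)
    (Φ : Plane ≃ₜ Plane) : Prop :=
  OrientationPreserving Φ ∧ Φ '' O₁ = Z1 ∧ Φ '' O₂ = Z2 ∧
    ∃ ε₁ ε₂ : ℝ, (ε₁ = 1 ∨ ε₁ = -1) ∧ (ε₂ = 1 ∨ ε₂ = -1) ∧
      ∃ g : Plane ≃ₜ Plane,
        (∀ x : ℝ, g (x, 1) = (x + ε₁, 1)) ∧
        (∀ x : ℝ, g (x, 2) = (x + ε₂, 2)) ∧
        IsotopicRel (⇑(conjH Φ h)) (⇑g) (Z1 ∪ Z2)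

/-- A flow on the plane. -/
def IsFlow (φ : ℝ → Plane → Plane) : Prop :=
  Continuous (fun p : ℝ × Plane => φ p.1 p.2) ∧
    (∀ x, φ 0 x = x) ∧ ∀ s t x, φ (s + t) x = φ s (φ t x)

/-- A topological line in the plane: the image of a proper injective continuous
map from `ℝ` to the plane. -/
def IsTopLine (L : Set Plane) : Prop :=
  ∃ f : ℝ → Plane, Continuous f ∧ Function.Injective f ∧ IsProperMap f ∧ range f = L

/-- A continuous logarithm, off the diagonal, of the difference quotient of `f`. -/
def IsPairLog (f : ℂ → ℂ) (L : ℂ × ℂ → ℂ) : Prop :=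
  ContinuousOn L {p | p.1 ≠ p.2} ∧
    ∀ a b, a ≠ b → Complex.exp (L (a, b)) * (b - a) = f b - f a

theorem exists_exp_lift {A : Type*} [TopologicalSpace A] (H : unitInterval × A → ℂ)
    (hH : Continuous H) (h0 : ∀ p, H p ≠ 0) (l : A → ℂ) (hl : Continuous l)
    (hl0 : ∀ a, Complex.exp (l a) = H (0, a)) :
    ∃ K : unitInterval × A → ℂ, Continuous K ∧ (∀ p, Complex.exp (K p) = H p) ∧
      ∀ a, K (0, a) = l a := by
  let H' : C(unitInterval × A, {z : ℂ // z ≠ 0}) := ⟨fun p => ⟨H p, h0 p⟩, by fun_prop⟩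
  let l' : C(A, ℂ) := ⟨l, hl⟩
  have e0 : ∀ a, H' (0, a) = (fun z : ℂ ↦ (⟨_, z.exp_ne_zero⟩ : {z : ℂ // z ≠ 0})) (l' a) :=
    fun a => Subtype.ext (hl0 a).symm
  refine ⟨Complex.isCoveringMap_exp.liftHomotopy H' l' e0, ContinuousMap.continuous _, ?_, ?_⟩
  · intro p
    exact congrArg Subtype.val
      (congrFun (Complex.isCoveringMap_exp.liftHomotopy_lifts H' l' e0) p)
  · exact fun a => Complex.isCoveringMap_exp.liftHomotopy_zero H' l' e0 a

theorem exists_log_of_starConvex {E : Type*} [AddCommGroup E] [Module ℝ E] [TopologicalSpace E]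
    [IsTopologicalAddGroup E] [ContinuousSMul ℝ E] {s : Set E} {x : E} (hs : StarConvex ℝ x s)
    {f : E → ℂ} (hf : ContinuousOn f s) (h0 : ∀ y ∈ s, f y ≠ 0) :
    ∃ l : E → ℂ, ContinuousOn l s ∧ ∀ y ∈ s, Complex.exp (l y) = f y := by
  rcases s.eq_empty_or_nonempty with rfl | hne
  · exact ⟨0, continuousOn_empty _, by simp⟩
  have hx : x ∈ s := hs.mem hne
  let c : unitInterval × s → s := fun p => ⟨x + (p.1 : ℝ) • ((p.2 : E) - x), by
    have := hs.add_smul_sub_mem p.2.2 p.1.2.1 p.1.2.2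
    simpa using this⟩
  have hc : Continuous c := by
    apply Continuous.subtype_mk
    fun_prop
  obtain ⟨K, hK, hK1, -⟩ := exists_exp_lift (fun p => f (c p))
    (hf.domRestrict.comp hc) (fun p => h0 _ (c p).2) (fun _ => Complex.log (f x)) continuous_const
    (fun a => by simp [c, Complex.exp_log (h0 x hx)])
  classical
  refine ⟨fun y => if h : y ∈ s then K (1, ⟨y, h⟩) else 0, ?_, ?_⟩
  · rw [continuousOn_iff_continuous_domRestrict]
    have : s.domRestrict (fun y => if h : y ∈ s then K (1, ⟨y, h⟩) else 0) = fun y : s => K (1, y) := by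
      ext y; exact dif_pos y.2
    rw [this]
    exact hK.comp (by fun_prop)
  · intro y hy
    simp only [hy, dif_pos, hK1]
    simp [c]

theorem exists_int_of_exp_eq {a b : ℂ} (h : Complex.exp a = Complex.exp b) :
    ∃ n : ℤ, a - b = n * (2 * Real.pi * Complex.I) := by
  obtain ⟨n, hn⟩ := Complex.exp_eq_exp_iff_exists_int.1 h
  exact ⟨n, by rw [hn]; ring⟩

theorem exists_int_sub_eq_on {X : Type*} [TopologicalSpace X] {s : Set X} (hs : IsPreconnected s)
    {u v : X → ℂ} (hu : ContinuousOn u s) (hv : ContinuousOn v s)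
    (h : ∀ x ∈ s, Complex.exp (u x) = Complex.exp (v x)) :
    ∃ n : ℤ, ∀ x ∈ s, u x = v x + n * (2 * Real.pi * Complex.I) := by
  rcases s.eq_empty_or_nonempty with rfl | ⟨x₀, hx₀⟩
  · exact ⟨0, by simp⟩
  have hpi : (2 * Real.pi * Complex.I : ℂ) ≠ 0 := Complex.two_pi_I_ne_zero
  have hc : ∀ x ∈ s, (u x - v x) / (2 * Real.pi * Complex.I) =
      (u x₀ - v x₀) / (2 * Real.pi * Complex.I) := by
    intro x hx
    refine hs.constant_of_mapsTo (T := range ((↑) : ℤ → ℂ)) ?_ (f := fun x =>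
      (u x - v x) / (2 * Real.pi * Complex.I)) ?_ ?_ hx hx₀
    · have h1 := (Complex.isClosedEmbedding_intCast).isEmbedding.toHomeomorph
      have h2 : DiscreteTopology (range ((↑) : ℤ → ℂ)) := h1.symm.isEmbedding.discreteTopology
      exact isDiscrete_iff_discreteTopology.2 h2
    · exact (hu.sub hv).div_const _
    · intro y hy
      obtain ⟨n, hn⟩ := exists_int_of_exp_eq (h y hy)
      exact ⟨n, by simp only [hn]; field_simp⟩
  obtain ⟨n, hn⟩ := exists_int_of_exp_eq (h x₀ hx₀)
  refine ⟨n, fun x hx => ?_⟩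
  have := hc x hx
  rw [hn, div_eq_div_iff hpi hpi] at this
  have := mul_right_cancel₀ hpi this
  linear_combination this

theorem isPreconnected_offDiag : IsPreconnected {p : ℂ × ℂ | p.1 ≠ p.2} := by
  have h0 : IsPreconnected ({0}ᶜ : Set ℂ) :=
    (isConnected_compl_singleton_of_one_lt_rank (by rw [Complex.rank_real_complex]; norm_num) 0).isPreconnected
  have := (isPreconnected_univ (α := ℂ)).prod h0
  have h2 := this.image (fun p : ℂ × ℂ => (p.1, p.1 + p.2)) (by fun_prop)
  convert h2
  ext ⟨a, b⟩
  constructor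
  · intro h
    exact ⟨(a, b - a), ⟨trivial, fun h' => h (sub_eq_zero.1 h').symm⟩, by simp⟩
  · rintro ⟨⟨c, d⟩, ⟨-, hd⟩, h⟩
    simp only [Prod.mk.injEq] at h
    obtain ⟨rfl, rfl⟩ := h
    simpa using hd

namespace IsPairLog

variable {f g : ℂ → ℂ} {L M : ℂ × ℂ → ℂ}

theorem injective (h : IsPairLog f L) : Function.Injective f := by
  intro a b hab
  by_contra hne
  have := h.2 a b hne
  rw [hab, sub_self] at this
  exact mul_ne_zero (Complex.exp_ne_zero _) (sub_ne_zero.2 (Ne.symm hne)) this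

theorem exp_eq (h : IsPairLog f L) {a b : ℂ} (hab : a ≠ b) :
    Complex.exp (L (a, b)) = (f b - f a) / (b - a) := by
  rw [← h.2 a b hab, mul_div_cancel_right₀ _ (sub_ne_zero.2 hab.symm)]

theorem unique (h : IsPairLog f L) (h' : IsPairLog f M) :
    ∃ n : ℤ, ∀ a b, a ≠ b → L (a, b) = M (a, b) + n * (2 * Real.pi * Complex.I) := by
  obtain ⟨n, hn⟩ := exists_int_sub_eq_on isPreconnected_offDiag h.1 h'.1 (by
    rintro ⟨a, b⟩ hab
    rw [h.exp_eq hab, h'.exp_eq hab])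
  exact ⟨n, fun a b hab => hn (a, b) hab⟩

theorem add_int (h : IsPairLog f L) (n : ℤ) :
    IsPairLog f (fun p => L p + n * (2 * Real.pi * Complex.I)) :=
  ⟨h.1.add continuousOn_const, fun a b hab => by
    rw [Complex.exp_add, Complex.exp_int_mul_two_pi_mul_I, mul_one, h.2 a b hab]⟩

theorem symm_apply (h : IsPairLog f L) (a b : ℂ) (hab : a ≠ b) : L (a, b) = L (b, a) := by
  have h' : IsPairLog f (fun p => L p.swap) :=
    ⟨h.1.comp continuous_swap.continuousOn fun p hp => Ne.symm hp, fun a b hab => by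
      have := h.2 b a hab.symm
      simp only [Prod.swap_prod_mk]
      linear_combination -this⟩
  obtain ⟨n, hn⟩ := h.unique h'
  have h1 := hn a b hab
  have h2 := hn b a hab.symm
  simp only [Prod.swap_prod_mk] at h1 h2
  linear_combination (h1 - h2) / 2

theorem comp (hf : IsPairLog f L) (hg : IsPairLog g M) (hgc : Continuous g) :
    IsPairLog (f ∘ g) (fun p => L (g p.1, g p.2) + M p) := by
  refine ⟨ContinuousOn.add (hf.1.comp (by fun_prop) fun p hp => hg.injective.ne hp) hg.1, ?_⟩
  intro a b hab
  rw [Complex.exp_add, mul_assoc, hg.2 a b hab, hf.2 _ _ (hg.injective.ne hab)]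
  rfl

theorem symm {f : ℂ ≃ₜ ℂ} (hf : IsPairLog f L) :
    IsPairLog f.symm (fun p => -L (f.symm p.1, f.symm p.2)) := by
  refine ⟨(hf.1.comp (by fun_prop) fun p hp => f.symm.injective.ne hp).neg, ?_⟩
  intro a b hab
  have := hf.2 _ _ (f.symm.injective.ne hab)
  simp only [Homeomorph.apply_symm_apply] at this
  rw [Complex.exp_neg, ← this, inv_mul_cancel_left₀ (Complex.exp_ne_zero _)]

theorem id : IsPairLog id (fun _ => 0) := ⟨continuousOn_const, by simp⟩

end IsPairLog

/-- Maps close to the identity in the Lipschitz sense have a pair logarithm. -/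
theorem exists_isPairLog_of_small {φ : ℂ → ℂ} (hφ : Continuous φ)
    (h : ∀ a b, a ≠ b → ‖φ b - φ a - (b - a)‖ < ‖b - a‖) : ∃ L, IsPairLog φ L := by
  have hq : ∀ a b, a ≠ b → (φ b - φ a) / (b - a) ∈ Complex.slitPlane := by
    intro a b hab
    have hne : b - a ≠ 0 := sub_ne_zero.2 hab.symm
    suffices h1 : ‖(φ b - φ a) / (b - a) - 1‖ < 1 by
      simpa using Complex.mem_slitPlane_of_norm_lt_one h1
    have : (φ b - φ a) / (b - a) - 1 = (φ b - φ a - (b - a)) / (b - a) := by field_simp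
    rw [this, norm_div, div_lt_one (norm_pos_iff.2 hne)]
    exact h a b hab
  refine ⟨fun p => Complex.log ((φ p.2 - φ p.1) / (p.2 - p.1)), ?_, ?_⟩
  · refine ContinuousOn.clog (ContinuousOn.div (by fun_prop) (by fun_prop) ?_) ?_
    · intro p hp; exact sub_ne_zero.2 (Ne.symm hp)
    · intro p hp; exact hq _ _ hp
  · intro a b hab
    have hne : b - a ≠ 0 := sub_ne_zero.2 hab.symm
    simp only
    rw [Complex.exp_log (Complex.slitPlane_ne_zero (hq a b hab)), div_mul_cancel₀ _ hne]

/-- Isotopies relative to a set lift to pair logarithms agreeing on that set. -/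
theorem IsPairLog.of_isotopy {f g : ℂ → ℂ} {L : ℂ × ℂ → ℂ} (hf : IsPairLog f L)
    (F : unitInterval × ℂ → ℂ) (hF : Continuous F) (hinj : ∀ t, Function.Injective fun x => F (t, x))
    (h0 : ∀ x, F (0, x) = f x) (h1 : ∀ x, F (1, x) = g x) (O : Set ℂ)
    (hO : ∀ t, ∀ x ∈ O, F (t, x) = f x) :
    ∃ M, IsPairLog g M ∧ ∀ a ∈ O, ∀ b ∈ O, a ≠ b → M (a, b) = L (a, b) := by
  have hne : ∀ t : unitInterval, ∀ p : {p : ℂ × ℂ // p.1 ≠ p.2}, F (t, p.1.2) - F (t, p.1.1) ≠ 0 := fun t p =>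
    sub_ne_zero.2 ((hinj t).ne p.2.symm)
  obtain ⟨K, hK, hK1, hK0⟩ := exists_exp_lift (A := {p : ℂ × ℂ // p.1 ≠ p.2})
    (fun q : unitInterval × {p : ℂ × ℂ // p.1 ≠ p.2} => (F (q.1, q.2.1.2) - F (q.1, q.2.1.1)) / (F (0, q.2.1.2) - F (0, q.2.1.1)))
    (Continuous.div (by fun_prop) (by fun_prop) (fun q => hne 0 q.2))
    (fun q => div_ne_zero (hne _ _) (hne _ _)) (fun _ => 0) continuous_const
    (fun a => by simp [div_self (hne 0 a)])
  classical
  refine ⟨fun p => L p + if h : p.1 ≠ p.2 then K (1, ⟨p, h⟩) else 0, ⟨?_, ?_⟩, ?_⟩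
  · refine hf.1.add ?_
    rw [continuousOn_iff_continuous_domRestrict]
    have : ({p : ℂ × ℂ | p.1 ≠ p.2}).domRestrict
        (fun p => if h : p.1 ≠ p.2 then K (1, ⟨p, h⟩) else 0) = fun y : {p : ℂ × ℂ // p.1 ≠ p.2} => K (1, y) := by
      ext y
      exact dif_pos y.2
    rw [this]
    exact hK.comp (by fun_prop)
  · intro a b hab
    have h00 := hne 0 ⟨(a, b), hab⟩
    have hd : Complex.exp (L (a, b)) * (b - a) = f b - f a := hf.2 a b hab
    simp only [ne_eq, hab, not_false_eq_true, dif_pos, Complex.exp_add, hK1]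
    simp only [h0, h1] at h00 ⊢
    rw [mul_right_comm, hd, mul_div_cancel₀ _ h00]
  · intro a ha b hb hab
    have hKc : ∀ t : unitInterval, K (t, ⟨(a, b), hab⟩) = 0 := by
      obtain ⟨n, hn⟩ := exists_int_sub_eq_on (isPreconnected_univ (α := unitInterval))
        (u := fun t => K (t, ⟨(a, b), hab⟩)) (v := fun _ => 0) (by fun_prop) (by fun_prop) (by
          intro t _
          have h00 := hne 0 ⟨(a, b), hab⟩
          simp only [h0] at h00
          simp only [hK1, Complex.exp_zero, hO _ a ha, hO _ b hb, div_self h00])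
      intro t
      have h2 := hn t trivial
      have h3 := hn 0 trivial
      rw [hK0] at h3
      rw [h2, ← h3]
    simp [hab, hKc]

theorem exists_log_displacement {f : ℂ → ℂ} (hf : Continuous f) (hfix : ∀ x, f x ≠ x) :
    ∃ Θ : ℂ → ℂ, Continuous Θ ∧ ∀ x, Complex.exp (Θ x) = f x - x := by
  obtain ⟨l, hl, hl'⟩ := exists_log_of_starConvex (starConvex_univ (0 : ℂ)) (f := fun x => f x - x)
    (by fun_prop) (fun y _ => sub_ne_zero.2 (hfix y))
  exact ⟨l, continuousOn_univ.1 hl, fun x => hl' x trivial⟩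

theorem exists_log_displacement_apply_sub {f : ℂ → ℂ} (hf : Continuous f) (hfix : ∀ x, f x ≠ x)
    {L : ℂ × ℂ → ℂ} (hL : IsPairLog f L) {Θ : ℂ → ℂ} (hΘ : Continuous Θ)
    (hΘ' : ∀ x, Complex.exp (Θ x) = f x - x) :
    ∃ n : ℤ, ∀ x, Θ (f x) - Θ x = L (x, f x) + n * (2 * Real.pi * Complex.I) := by
  obtain ⟨n, hn⟩ := exists_int_sub_eq_on (isPreconnected_univ (α := ℂ))
    (u := fun x => Θ (f x) - Θ x) (v := fun x => L (x, f x)) (by fun_prop)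
    (hL.1.comp (by fun_prop) fun x _ => (hfix x).symm) (by
      intro x _
      rw [Complex.exp_sub, hΘ', hΘ', hL.exp_eq (hfix x).symm])
  exact ⟨n, fun x => hn x trivial⟩

/-- `f` has no periodic point of period `n` if all fixed point free homeomorphisms with a pair
logarithm have none. -/
def NoPeriodic (n : ℕ) : Prop :=
  ∀ f : ℂ ≃ₜ ℂ, (∃ L, IsPairLog f L) → (∀ x, f x ≠ x) → ∀ x, f^[n] x ≠ x

theorem noPeriodic_one : NoPeriodic 1 := fun _ _ h x => h x

theorem noPeriodic_two : NoPeriodic 2 := by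
  rintro f ⟨L, hL⟩ hfix x hx
  have hx2 : f (f x) = x := hx
  obtain ⟨Θ, hΘ, hΘ'⟩ := exists_log_displacement f.continuous hfix
  obtain ⟨n, hn⟩ := exists_log_displacement_apply_sub f.continuous hfix hL hΘ hΘ'
  have h1 := hn x
  have h2 := hn (f x)
  rw [hx2, hL.symm_apply _ _ (hfix x)] at h2
  have h3 : Θ (f x) = Θ x := by linear_combination (h1 - h2) / 2
  have h4 := hΘ' (f x)
  rw [h3, hΘ', hx2] at h4
  exact hfix x (by linear_combination h4 / 2)

theorem exists_local_move (c q : ℂ) (r : ℝ) (hq : ‖q - c‖ < r) :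
    ∃ φ : ℂ ≃ₜ ℂ, (∃ L, IsPairLog φ L) ∧ φ c = q ∧ ∀ x, x ∉ Metric.ball c r → φ x = x := by
  have hr : 0 < r := (norm_nonneg _).trans_lt hq
  let ρ : ℂ → ℝ := fun v => max 0 (1 - ‖v - c‖ / r)
  let F : ℂ → ℂ := fun v => v + (ρ v : ℂ) * (q - c)
  have hρ : ∀ a b, |ρ b - ρ a| ≤ ‖b - a‖ / r := by
    intro a b
    have h1 : |ρ b - ρ a| ≤ |(1 - ‖b - c‖ / r) - (1 - ‖a - c‖ / r)| := by
      simp only [ρ, max_comm (0 : ℝ)]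
      exact abs_max_sub_max_le_abs _ _ _
    have h2 : (1 - ‖b - c‖ / r) - (1 - ‖a - c‖ / r) = (‖a - c‖ - ‖b - c‖) / r := by ring
    have h3 := abs_norm_sub_norm_le (a - c) (b - c)
    rw [sub_sub_sub_cancel_right, norm_sub_rev a b] at h3
    rw [h2, abs_div, abs_of_pos hr] at h1
    exact h1.trans (by gcongr)
  have hF : ∀ a b, ‖F b - F a - (b - a)‖ ≤ ‖q - c‖ / r * ‖b - a‖ := by
    intro a b
    have : F b - F a - (b - a) = ((ρ b - ρ a : ℝ) : ℂ) * (q - c) := by simp [F]; ring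
    rw [this, norm_mul, Complex.norm_real, Real.norm_eq_abs]
    calc |ρ b - ρ a| * ‖q - c‖ ≤ ‖b - a‖ / r * ‖q - c‖ := by gcongr; exact hρ a b
      _ = _ := by ring
  have hk : ‖q - c‖ / r < 1 := (div_lt_one hr).2 hq
  have hk0 : 0 ≤ ‖q - c‖ / r := by positivity
  have happ : ApproximatesLinearOn F ((ContinuousLinearEquiv.refl ℝ ℂ : ℂ ≃L[ℝ] ℂ) : ℂ →L[ℝ] ℂ) univ
      ⟨‖q - c‖ / r, hk0⟩ := by
    intro x _ y _
    exact hF y x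
  have hsmall : Subsingleton ℂ ∨ (⟨‖q - c‖ / r, hk0⟩ : NNReal) <
      ‖(((ContinuousLinearEquiv.refl ℝ ℂ).symm : ℂ ≃L[ℝ] ℂ) : ℂ →L[ℝ] ℂ)‖₊⁻¹ := by
    right
    have : ‖(((ContinuousLinearEquiv.refl ℝ ℂ).symm : ℂ ≃L[ℝ] ℂ) : ℂ →L[ℝ] ℂ)‖₊ = 1 := by
      apply NNReal.eq
      exact ContinuousLinearMap.norm_id
    rw [this, inv_one]
    exact hk
  refine ⟨ApproximatesLinearOn.toHomeomorph F happ hsmall, ?_, ?_, ?_⟩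
  · apply exists_isPairLog_of_small (Homeomorph.continuous _)
    intro a b hab
    refine (hF a b).trans_lt ?_
    have : 0 < ‖b - a‖ := norm_pos_iff.2 (sub_ne_zero.2 hab.symm)
    nlinarith
  · change F c = q
    simp [F, ρ]
  · intro x hx
    change F x = x
    have : 1 ≤ ‖x - c‖ / r := by
      rw [one_le_div hr]
      simpa [dist_eq_norm] using hx
    have : ρ x = 0 := max_eq_left (by linarith)
    simp [F, this]

theorem exists_move {U S : Set ℂ} (hU : IsOpen U) (hSU : S ⊆ U) (hS : IsPreconnected S) {p q : ℂ}
    (hp : p ∈ S) (hq : q ∈ S) :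
    ∃ φ : ℂ ≃ₜ ℂ, (∃ L, IsPairLog φ L) ∧ φ p = q ∧ ∀ x, x ∉ U → φ x = x := by
  refine hS.induction₂ (fun p q => ∃ φ : ℂ ≃ₜ ℂ, (∃ L, IsPairLog φ L) ∧ φ p = q ∧
    ∀ x, x ∉ U → φ x = x) ?_ ?_ ?_ hp hq
  · intro x hx
    obtain ⟨r, hr, hball⟩ := Metric.isOpen_iff.1 hU x (hSU hx)
    refine Filter.mem_of_superset (mem_nhdsWithin_of_mem_nhds (Metric.ball_mem_nhds x hr)) ?_
    intro y hy
    obtain ⟨φ, h1, h2, h3⟩ := exists_local_move x y r (by simpa [dist_eq_norm] using hy)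
    exact ⟨φ, h1, h2, fun z hz => h3 z fun h => hz (hball h)⟩
  · rintro x y z - - - ⟨φ, ⟨L, hL⟩, h2, h3⟩ ⟨ψ, ⟨M, hM⟩, h5, h6⟩
    refine ⟨φ.trans ψ, ⟨_, hM.comp hL φ.continuous⟩, by simp [h2, h5], fun w hw => ?_⟩
    simp [h3 w hw, h6 w hw]
  · rintro x y - - ⟨φ, ⟨L, hL⟩, h2, h3⟩
    refine ⟨φ.symm, ⟨_, hL.symm⟩, by simp [← h2], fun w hw => ?_⟩
    rw [φ.symm_apply_eq, h3 w hw]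

theorem map_mem_of_support {φ : ℂ ≃ₜ ℂ} {U : Set ℂ} (h : ∀ x, x ∉ U → φ x = x) {x : ℂ} :
    φ x ∈ U ↔ x ∈ U := by
  constructor
  · intro hx
    by_contra hn
    rw [h x hn] at hx
    exact hn hx
  · intro hx
    by_contra hn
    exact hn (by rwa [φ.injective (h _ hn)])

/-- Composing with a map supported in a free set creates no fixed points. -/
theorem fixedPointFree_trans {f φ : ℂ ≃ₜ ℂ} {U : Set ℂ} (hf : ∀ x, f x ≠ x)
    (h : ∀ x, x ∉ U → φ x = x) (hfree : ∀ x ∈ U, f x ∉ U) : ∀ x, (f.trans φ) x ≠ x := by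
  intro x hx
  simp only [Homeomorph.trans_apply] at hx
  by_cases hfx : f x ∈ U
  · have : x ∈ U := by rw [← hx]; exact (map_mem_of_support h).2 hfx
    exact hfree x this hfx
  · rw [h _ hfx] at hx
    exact hf x hx

theorem exists_free_nhd {f : ℂ ≃ₜ ℂ} {S : Set ℂ} (hS : IsCompact S) (hfree : ∀ x ∈ S, f x ∉ S) :
    ∃ U, IsOpen U ∧ S ⊆ U ∧ ∀ x ∈ U, f x ∉ U := by
  obtain ⟨V, W, hV, hW, hSV, hSW, hd⟩ := SeparatedNhds.of_isCompact_isCompact hS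
    (hS.image f.continuous) (by
      rw [Set.disjoint_left]
      rintro _ hx ⟨y, hy, rfl⟩
      exact hfree y hy hx)
  refine ⟨V ∩ f ⁻¹' W, hV.inter (hW.preimage f.continuous), fun x hx =>
    ⟨hSV hx, hSW (mem_image_of_mem _ hx)⟩, fun x hx hx' => ?_⟩
  exact Set.disjoint_left.1 hd hx'.1 hx.2

/-- A free continuum is not revisited, as long as shorter periods are excluded. -/
theorem iterate_notMem_of_free {f : ℂ ≃ₜ ℂ} (hL : ∃ L, IsPairLog f L) (hfix : ∀ x, f x ≠ x)
    {S : Set ℂ} (hS : IsCompact S) (hSc : IsPreconnected S) (hfree : ∀ x ∈ S, f x ∉ S)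
    {j : ℕ} (hj : 1 ≤ j) (hP : ∀ m, 2 ≤ m → m ≤ j → NoPeriodic m) {x : ℂ} (hx : x ∈ S) :
    f^[j] x ∉ S := by
  induction j using Nat.strong_induction_on with
  | _ j ih =>
  intro hjx
  rcases hj.eq_or_lt with rfl | hj2
  · exact hfree x hx hjx
  obtain ⟨U, hU, hSU, hUf⟩ := exists_free_nhd hS hfree
  let A : Set ℂ := (fun i => f^[i] x) '' Ioo 0 j
  have hA : A.Finite := (Set.finite_Ioo 0 j).image _
  have hSA : ∀ y ∈ S, y ∉ A := by
    rintro y hy ⟨i, ⟨hi0, hij⟩, rfl⟩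
    exact ih i hij hi0 (fun m h2 hm => hP m h2 (hm.trans hij.le)) hy
  obtain ⟨φ, ⟨M, hM⟩, hφ, hsupp⟩ := exists_move (hU.inter hA.isClosed.isOpen_compl)
    (fun y hy => ⟨hSU hy, hSA y hy⟩ : S ⊆ U ∩ Aᶜ) hSc hjx hx
  obtain ⟨L, hL⟩ := hL
  have hit : ∀ i, i < j → (f.trans φ)^[i] x = f^[i] x := by
    intro i
    induction i with
    | zero => simp
    | succ i ihi =>
      intro hi
      rw [Function.iterate_succ_apply', ihi (by omega), Function.iterate_succ_apply']
      refine hsupp _ fun h => h.2 ?_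
      exact ⟨i + 1, ⟨by omega, hi⟩, Function.iterate_succ_apply' _ _ _⟩
  refine hP j hj2 le_rfl (f.trans φ) ⟨_, hM.comp hL f.continuous⟩
    (fixedPointFree_trans hfix hsupp fun y hy h => hUf y hy.1 h.1) x ?_
  obtain ⟨k, rfl⟩ : ∃ k, j = k + 1 := ⟨j - 1, by omega⟩
  rw [Function.iterate_succ_apply', hit k (by omega), Homeomorph.trans_apply,
    ← Function.iterate_succ_apply' f, hφ]

/-- A translation arc for `f` through `x`. -/
structure IsTranslationArc (f : ℂ → ℂ) (x : ℂ) (α : ℝ → ℂ) (c : ℝ) : Prop where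
  continuous : Continuous α
  pos : 0 < c
  lt_one : c < 1
  injOn : InjOn α (Icc 0 1)
  map_zero : f (α 0) = α 1
  apply_eq : α c = x
  free : ∀ s ∈ Icc (0 : ℝ) 1, ∀ t ∈ Icc (0 : ℝ) 1, α s = f (α t) → s = 1 ∧ t = 0

theorem exists_touching_ball (f : ℂ ≃ₜ ℂ) (hfix : ∀ x, f x ≠ x) (x : ℂ) :
    ∃ r > 0, ∃ y, ‖y - x‖ = r ∧ ‖f y - x‖ = r ∧
      ∀ p q, ‖p - x‖ ≤ r → ‖q - x‖ ≤ r → p = f q → ‖p - x‖ = r ∧ ‖q - x‖ = r := by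
  let R : Set ℝ := {r | ∀ p ∈ Metric.ball x r, f p ∉ Metric.ball x r}
  have hbdd : BddAbove R := by
    refine ⟨‖f x - x‖, fun r hr => ?_⟩
    by_contra! h
    refine hr x (Metric.mem_ball_self ((norm_nonneg _).trans_lt h)) ?_
    simpa [dist_eq_norm] using h
  obtain ⟨r₀, hr₀, hr₀R⟩ : ∃ r > 0, r ∈ R := by
    obtain ⟨U, hU, hxU, hUf⟩ := exists_free_nhd (f := f) (isCompact_singleton (x := x))
      (by rintro y rfl; exact hfix y)
    obtain ⟨r, hr, hb⟩ := Metric.isOpen_iff.1 hU x (hxU rfl)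
    exact ⟨r, hr, fun p hp h => hUf p (hb hp) (hb h)⟩
  set r := sSup R with hrdef
  have hr : 0 < r := hr₀.trans_le (le_csSup hbdd hr₀R)
  have hopen : ∀ p ∈ Metric.ball x r, f p ∉ Metric.ball x r := by
    intro p hp hfp
    have h1 : max (dist p x) (dist (f p) x) < sSup R := max_lt hp hfp
    obtain ⟨s, hs, hs'⟩ := exists_lt_of_lt_csSup ⟨_, hr₀R⟩ h1
    exact hs p ((le_max_left _ _).trans_lt hs') ((le_max_right _ _).trans_lt hs')
  have hcl : closure (Metric.ball x r) = Metric.closedBall x r := closure_ball x hr.ne'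
  have hp1 : ∀ q ∈ Metric.closedBall x r, f q ∈ Metric.closedBall x r →
      f q ∉ Metric.ball x r := by
    intro q hq _ hfq
    have : q ∈ closure (Metric.ball x r) := by rwa [hcl]
    obtain ⟨z, hz1, hz2⟩ := mem_closure_iff.1 this (f ⁻¹' Metric.ball x r)
      (Metric.isOpen_ball.preimage f.continuous) hfq
    exact hopen z hz2 hz1
  have hp2 : ∀ q ∈ Metric.closedBall x r, f q ∈ Metric.closedBall x r →
      q ∉ Metric.ball x r := by
    intro q _ hfq hq
    have : f q ∈ closure (Metric.ball x r) := by rwa [hcl]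
    obtain ⟨z, hz1, hz2⟩ := mem_closure_iff.1 this (f '' Metric.ball x r)
      (f.isOpenMap _ Metric.isOpen_ball) (mem_image_of_mem _ hq)
    obtain ⟨w, hw, rfl⟩ := hz1
    exact hopen w hw hz2
  have hsph : ∀ q, ‖q - x‖ ≤ r → ‖f q - x‖ ≤ r → ‖f q - x‖ = r ∧ ‖q - x‖ = r := by
    intro q h1 h2
    have a := hp1 q (by simpa [dist_eq_norm] using h1) (by simpa [dist_eq_norm] using h2)
    have b := hp2 q (by simpa [dist_eq_norm] using h1) (by simpa [dist_eq_norm] using h2)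
    simp only [Metric.mem_ball, dist_eq_norm, not_lt] at a b
    exact ⟨le_antisymm h2 a, le_antisymm h1 b⟩
  obtain ⟨y, hy, hfy⟩ : ∃ y ∈ Metric.closedBall x r, f y ∈ Metric.closedBall x r := by
    by_contra! h
    obtain ⟨U, hU, hxU, hUf⟩ := exists_free_nhd (isCompact_closedBall x r) h
    obtain ⟨δ, hδ, hth⟩ := (isCompact_closedBall x r).exists_thickening_subset_open hU hxU
    have : r + δ ∈ R := by
      have hsub : Metric.ball x (r + δ) ⊆ U := by
        refine Subset.trans ?_ hth
        rw [thickening_closedBall hδ hr.le, add_comm]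
      exact fun p hp h => hUf p (hsub hp) (hsub h)
    have := le_csSup hbdd this
    linarith
  have := hsph y (by simpa [dist_eq_norm] using hy) (by simpa [dist_eq_norm] using hfy)
  refine ⟨r, hr, y, this.2, this.1, ?_⟩
  rintro p q hp hq rfl
  exact hsph q hq hp

theorem exists_translationArc (f : ℂ ≃ₜ ℂ) (hL : ∃ L, IsPairLog f L) (hfix : ∀ x, f x ≠ x)
    (x : ℂ) : ∃ α, IsTranslationArc f x α (1 / 2) := by
  obtain ⟨r, hr, y, hy, hz, hfree⟩ := exists_touching_ball f hfix x
  set z := f y with hzdef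
  have hzy : z ≠ y := hfix y
  let α : ℝ → ℂ := fun s => x + ((max 0 (1 - 2 * s) : ℝ) : ℂ) * (y - x) +
    ((max 0 (2 * s - 1) : ℝ) : ℂ) * (z - x)
  have hlow : ∀ s, s ≤ 1 / 2 → α s - x = ((1 - 2 * s : ℝ) : ℂ) * (y - x) := by
    intro s hs
    simp only [α]
    rw [max_eq_right (by linarith), max_eq_left (by linarith)]
    simp
  have hhigh : ∀ s, 1 / 2 ≤ s → α s - x = ((2 * s - 1 : ℝ) : ℂ) * (z - x) := by
    intro s hs
    simp only [α]
    rw [max_eq_left (by linarith), max_eq_right (by linarith)]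
    simp
  have hnorm : ∀ s, ‖α s - x‖ = |2 * s - 1| * r := by
    intro s
    rcases le_total s (1 / 2) with h | h
    · rw [hlow s h, norm_mul, hy, Complex.norm_real, Real.norm_eq_abs, abs_sub_comm]
    · rw [hhigh s h, norm_mul, hz, Complex.norm_real, Real.norm_eq_abs]
  have h0 : α 0 = y := by have := hlow 0 (by norm_num); simp at this; exact this
  have h1 : α 1 = z := by
    have := hhigh 1 (by norm_num); norm_num at this; exact this
  have hle : ∀ s ∈ Icc (0 : ℝ) 1, ‖α s - x‖ ≤ r := by
    intro s hs
    rw [hnorm]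
    have : |2 * s - 1| ≤ 1 := abs_le.2 ⟨by linarith [hs.1], by linarith [hs.2]⟩
    nlinarith
  have hsph : ∀ s, ‖α s - x‖ = r → s = 0 ∨ s = 1 := by
    intro s h
    rw [hnorm] at h
    have : |2 * s - 1| = 1 := mul_right_cancel₀ hr.ne' (by rw [h, one_mul])
    rcases (abs_eq one_pos.le).1 this with h | h
    · right; linarith
    · left; linarith
  refine ⟨α, ⟨by fun_prop, by norm_num, by norm_num, ?_, by rw [h0, h1], ?_, ?_⟩⟩
  · have key : ∀ s t, s ≤ 1 / 2 → 1 / 2 ≤ t → α s = α t → s = t := by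
      intro s t hs ht h
      have e := hlow s hs
      rw [h, hhigh t ht] at e
      have n1 := hnorm s
      rw [h, hnorm t] at n1
      have n2 := mul_right_cancel₀ hr.ne' n1
      rw [abs_of_nonneg (by linarith), abs_of_nonpos (by linarith)] at n2
      have n3 : 1 - 2 * s = 2 * t - 1 := by linarith
      rw [n3] at e
      by_contra hne
      have : 2 * t - 1 ≠ 0 := fun h => hne (by linarith)
      have := mul_left_cancel₀ (Complex.ofReal_ne_zero.2 this) e
      exact hzy (sub_left_injective this)
    intro s _ t _ h
    rcases le_total s (1 / 2) with hs | hs <;> rcases le_total t (1 / 2) with ht | ht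
    · have n1 := hnorm s
      rw [h, hnorm t] at n1
      have n2 := mul_right_cancel₀ hr.ne' n1
      rw [abs_of_nonpos (by linarith), abs_of_nonpos (by linarith)] at n2
      linarith
    · exact key s t hs ht h
    · exact (key t s ht hs h.symm).symm
    · have n1 := hnorm s
      rw [h, hnorm t] at n1
      have n2 := mul_right_cancel₀ hr.ne' n1
      rw [abs_of_nonneg (by linarith), abs_of_nonneg (by linarith)] at n2
      linarith
  · have := hlow (1 / 2) le_rfl
    norm_num at this
    linear_combination this
  · intro s hs t ht h
    obtain ⟨e1, e2⟩ := hfree _ _ (hle s hs) (hle t ht) h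
    rcases hsph s e1 with rfl | rfl <;> rcases hsph t e2 with rfl | rfl
    · rw [h0] at h; exact absurd h.symm hzy
    · rw [h0, h1] at h
      exact absurd h.symm (noPeriodic_two f hL hfix y)
    · exact ⟨rfl, rfl⟩
    · rw [h1] at h; exact absurd h.symm (hfix z)

namespace IsTranslationArc

variable {f : ℂ ≃ₜ ℂ} {x : ℂ} {α : ℝ → ℂ} {c : ℝ}

theorem free_image (hα : IsTranslationArc f x α c) {a b : ℝ} (ha : 0 ≤ a) (hb : b ≤ 1)
    (hab : 0 < a ∨ b < 1) : ∀ p ∈ α '' Icc a b, f p ∉ α '' Icc a b := by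
  rintro _ ⟨t, ht, rfl⟩ ⟨s, hs, h⟩
  obtain ⟨rfl, rfl⟩ := hα.free s ⟨ha.trans hs.1, hs.2.trans hb⟩ t ⟨ha.trans ht.1, ht.2.trans hb⟩ h
  rcases hab with h' | h'
  · exact h'.not_ge ht.1
  · exact h'.not_ge hs.2

theorem iterate_ne (hα : IsTranslationArc f x α c) (hL : ∃ L, IsPairLog f L)
    (hfix : ∀ x, f x ≠ x) {j : ℕ} (hj : 2 ≤ j) (hP : ∀ m, 2 ≤ m → m ≤ j → NoPeriodic m)
    {s t : ℝ} (hs : s ∈ Icc (0 : ℝ) 1) (ht : t ∈ Icc (0 : ℝ) 1)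
    (hst : ¬(s = 0 ∧ t = 1)) (hst' : ¬(s = 1 ∧ t = 0)) :
    α s ≠ f^[j] (α t) := by
  intro h
  have hlo : 0 ≤ min s t := le_min hs.1 ht.1
  have hhi : max s t ≤ 1 := max_le hs.2 ht.2
  have hor : 0 < min s t ∨ max s t < 1 := by
    by_contra! hcon
    rcases min_le_iff.1 hcon.1 with h1 | h1 <;> rcases le_max_iff.1 hcon.2 with h2 | h2
    · linarith
    · exact hst ⟨le_antisymm h1 hs.1, le_antisymm ht.2 h2⟩
    · exact hst' ⟨le_antisymm hs.2 h2, le_antisymm h1 ht.1⟩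
    · linarith
  refine iterate_notMem_of_free hL hfix (isCompact_Icc.image hα.continuous)
    (isPreconnected_Icc.image _ hα.continuous.continuousOn) (hα.free_image hlo hhi hor)
    (by omega : 1 ≤ j) hP ⟨t, ⟨min_le_right _ _, le_max_right _ _⟩, rfl⟩ ?_
  exact ⟨s, ⟨min_le_left _ _, le_max_left _ _⟩, h⟩

end IsTranslationArc

theorem noPeriodic_succ {n : ℕ} (hn : 2 ≤ n) (hP : ∀ m, 2 ≤ m → m ≤ n → NoPeriodic m) :
    NoPeriodic (n + 1) := by
  rintro f ⟨L, hL⟩ hfix x hx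
  obtain ⟨α, hα⟩ := exists_translationArc f ⟨L, hL⟩ hfix x
  set S₀ : Set ℂ := α '' Icc (1 / 2) 1 with hS₀
  set A : Set ℂ := α '' Icc 0 (1 / 2) with hA
  set S₁ : Set ℂ := (fun p => f (f p)) '' A with hS₁
  have cS₀ : IsCompact S₀ := isCompact_Icc.image hα.continuous
  have cS₁ : IsCompact S₁ := (isCompact_Icc.image hα.continuous).image (by fun_prop)
  have pS₀ : IsPreconnected S₀ := isPreconnected_Icc.image _ hα.continuous.continuousOn
  have pS₁ : IsPreconnected S₁ :=
    (isPreconnected_Icc.image _ hα.continuous.continuousOn).image _ (by fun_prop)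
  have fS₀ : ∀ p ∈ S₀, f p ∉ S₀ := hα.free_image (by norm_num) le_rfl (Or.inl (by norm_num))
  have fA : ∀ p ∈ A, f p ∉ A := hα.free_image le_rfl (by norm_num) (Or.inr (by norm_num))
  have fS₁ : ∀ p ∈ S₁, f p ∉ S₁ := by
    rintro _ ⟨p, hp, rfl⟩ ⟨q, hq, h⟩
    have : q = f p := f.injective (f.injective h)
    exact fA p hp (this ▸ hq)
  have hxS₀ : x ∈ S₀ := ⟨1 / 2, by norm_num, hα.apply_eq⟩
  have hzS₀ : α 1 ∈ S₀ := ⟨1, by norm_num, rfl⟩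
  have hxS₁ : f (f x) ∈ S₁ := ⟨x, ⟨1 / 2, by norm_num, hα.apply_eq⟩, rfl⟩
  have hzS₁ : f (α 1) ∈ S₁ := ⟨α 0, ⟨0, by norm_num, rfl⟩, by rw [← hα.map_zero]⟩
  have hdisj : Disjoint S₀ S₁ := by
    rw [Set.disjoint_left]
    rintro _ ⟨s, hs, rfl⟩ ⟨_, ⟨t, ht, rfl⟩, h⟩
    by_cases hc : s = 1 ∧ t = 0
    · obtain ⟨rfl, rfl⟩ := hc
      simp only [hα.map_zero] at h
      exact hfix _ h
    · refine hα.iterate_ne ⟨L, hL⟩ hfix le_rfl (fun m h1 h2 => hP m h1 (h2.trans hn))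
        (s := s) (t := t) ⟨by linarith [hs.1], hs.2⟩ ⟨ht.1, by linarith [ht.2]⟩ ?_ hc h.symm
      rintro ⟨rfl, rfl⟩
      linarith [hs.1]
  have hk₀ : ∀ k, 3 ≤ k → k ≤ n → f^[k] x ∉ S₀ := fun k h1 h2 =>
    iterate_notMem_of_free ⟨L, hL⟩ hfix cS₀ pS₀ fS₀ (by omega)
      (fun m a b => hP m a (b.trans h2)) hxS₀
  have hk₁ : ∀ k, 3 ≤ k → k ≤ n → f^[k] x ∉ S₁ := by
    intro k h1 h2
    have := iterate_notMem_of_free ⟨L, hL⟩ hfix cS₁ pS₁ fS₁ (j := k - 2) (by omega)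
      (fun m a b => hP m a (by omega)) hxS₁
    rwa [show f (f x) = f^[2] x from rfl, ← Function.iterate_add_apply,
      Nat.sub_add_cancel (by omega)] at this
  obtain ⟨V₀, V₁, hV₀, hV₁, hSV₀, hSV₁, hV⟩ := SeparatedNhds.of_isCompact_isCompact cS₀ cS₁ hdisj
  obtain ⟨W₀, hW₀, hSW₀, hWf₀⟩ := exists_free_nhd cS₀ fS₀
  obtain ⟨W₁, hW₁, hSW₁, hWf₁⟩ := exists_free_nhd cS₁ fS₁
  let B : Set ℂ := (fun k => f^[k] x) '' Icc 3 n
  have hB : IsOpen Bᶜ := ((Set.finite_Icc 3 n).image _).isClosed.isOpen_compl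
  have hB₀ : ∀ p ∈ S₀, p ∉ B := by
    rintro p hp ⟨k, hk, rfl⟩; exact hk₀ k hk.1 hk.2 hp
  have hB₁ : ∀ p ∈ S₁, p ∉ B := by
    rintro p hp ⟨k, hk, rfl⟩; exact hk₁ k hk.1 hk.2 hp
  obtain ⟨φ₀, ⟨M₀, hM₀⟩, hφ₀, hs₀⟩ := exists_move (U := V₀ ∩ W₀ ∩ Bᶜ) ((hV₀.inter hW₀).inter hB)
    (fun p hp => ⟨⟨hSV₀ hp, hSW₀ hp⟩, hB₀ p hp⟩) pS₀ hxS₀ hzS₀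
  obtain ⟨φ₁, ⟨M₁, hM₁⟩, hφ₁, hs₁⟩ := exists_move (U := V₁ ∩ W₁ ∩ Bᶜ) ((hV₁.inter hW₁).inter hB)
    (fun p hp => ⟨⟨hSV₁ hp, hSW₁ hp⟩, hB₁ p hp⟩) pS₁ hzS₁ hxS₁
  have hout : ∀ p ∈ V₁, φ₀ p = p := fun p hp => hs₀ p fun h =>
    Set.disjoint_left.1 hV h.1.1 hp
  have hout' : ∀ p ∈ V₀, φ₁ p = p := fun p hp => hs₁ p fun h =>
    Set.disjoint_left.1 hV hp h.1.1
  let g := (f.trans φ₁).trans φ₀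
  have hgfix : ∀ p, g p ≠ p := by
    refine fixedPointFree_trans (fixedPointFree_trans hfix hs₁ fun p hp h => hWf₁ p hp.1.2 h.1.2)
      hs₀ fun p hp h => ?_
    simp only [Homeomorph.trans_apply] at h
    by_cases hm : f p ∈ V₁ ∩ W₁ ∩ Bᶜ
    · exact Set.disjoint_left.1 hV h.1.1 ((map_mem_of_support hs₁).2 hm).1.1
    · rw [hs₁ _ hm] at h
      exact hWf₀ p hp.1.2 h.1.2
  have hgz : g (α 1) = f^[2] x := by
    simp only [g, Homeomorph.trans_apply, hφ₁]
    exact hout _ (hSV₁ hxS₁)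
  have hgB : ∀ p, f p ∈ B → g p = f p := by
    intro p hp
    simp only [g, Homeomorph.trans_apply]
    rw [hs₁ _ fun h => h.2 hp, hs₀ _ fun h => h.2 hp]
  have hgx : ∀ p, f p = x → g p = α 1 := by
    intro p hp
    simp only [g, Homeomorph.trans_apply, hp]
    rw [hout' _ (hSV₀ hxS₀), hφ₀]
  have hit : ∀ k, k + 2 ≤ n → g^[k + 1] (α 1) = f^[k + 2] x := by
    intro k
    induction k with
    | zero => intro _; exact hgz
    | succ k ih =>
      intro hk
      rw [Function.iterate_succ_apply', ih (by omega), hgB, ← Function.iterate_succ_apply' f]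
      rw [← Function.iterate_succ_apply' f]
      exact ⟨k + 3, ⟨by omega, by omega⟩, rfl⟩
  refine hP n hn le_rfl g ⟨_, hM₀.comp (hM₁.comp hL f.continuous) (f.trans φ₁).continuous⟩ hgfix (α 1) ?_
  obtain ⟨k, rfl⟩ : ∃ k, n = k + 2 := ⟨n - 2, by omega⟩
  rw [Function.iterate_succ_apply', hit k le_rfl]
  apply hgx
  rw [← Function.iterate_succ_apply' f, hx]

/-- Brouwer's lemma: a fixed point free homeomorphism has no periodic point. -/
theorem noPeriodic (n : ℕ) (hn : 1 ≤ n) : NoPeriodic n := by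
  induction n using Nat.strong_induction_on with
  | _ n ih =>
  rcases (show n = 1 ∨ n = 2 ∨ 3 ≤ n by omega) with rfl | rfl | h
  · exact noPeriodic_one
  · exact noPeriodic_two
  · obtain ⟨m, rfl⟩ : ∃ m, n = m + 1 := ⟨n - 1, by omega⟩
    exact noPeriodic_succ (by omega) fun k h1 h2 => ih k (by omega) (by omega)

/-- Through every point passes an injective curve on which `f` acts as a unit translation. -/
theorem hom_pow_apply (f : ℂ ≃ₜ ℂ) (n : ℕ) (x : ℂ) : (f ^ n : ℂ ≃ₜ ℂ) x = f^[n] x := by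
  induction n generalizing x with
  | zero => rfl
  | succ n ih => rw [pow_succ, Function.iterate_succ_apply, ← ih]; rfl

theorem exists_streamline (f : ℂ ≃ₜ ℂ) (hL : ∃ L, IsPairLog f L) (hfix : ∀ x, f x ≠ x) (x : ℂ) :
    ∃ β : ℝ → ℂ, Continuous β ∧ Function.Injective β ∧ (∀ t, β (t + 1) = f (β t)) ∧ β 0 = x := by
  obtain ⟨α, hα⟩ := exists_translationArc f hL hfix x
  have hdis : ∀ j, 2 ≤ j → ∀ s ∈ Icc (0 : ℝ) 1, ∀ t ∈ Icc (0 : ℝ) 1, α s ≠ f^[j] (α t) := by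
    intro j hj s hs t ht h
    by_cases h1 : s = 0 ∧ t = 1
    · obtain ⟨rfl, rfl⟩ := h1
      rw [← hα.map_zero, ← Function.iterate_succ_apply] at h
      exact noPeriodic (j + 1) (by omega) f hL hfix _ h.symm
    by_cases h2 : s = 1 ∧ t = 0
    · obtain ⟨rfl, rfl⟩ := h2
      obtain ⟨k, rfl⟩ : ∃ k, j = k + 1 := ⟨j - 1, by omega⟩
      rw [Function.iterate_succ_apply, hα.map_zero] at h
      exact noPeriodic k (by omega) f hL hfix _ h.symm
    exact hα.iterate_ne hL hfix hj (fun m a b => noPeriodic m (by omega)) hs ht h1 h2 h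
  let γ : ℝ → ℂ := fun t => (f ^ ⌊t⌋ : ℂ ≃ₜ ℂ) (α (Int.fract t))
  have hγ : ∀ n : ℤ, ∀ t ∈ Icc (n : ℝ) (n + 1), γ t = (f ^ n : ℂ ≃ₜ ℂ) (α (t - n)) := by
    intro n t ht
    rcases ht.2.lt_or_eq with h | h
    · have : ⌊t⌋ = n := Int.floor_eq_iff.2 ⟨ht.1, h⟩
      simp only [γ, Int.fract, this]
    · have : ⌊t⌋ = n + 1 := by rw [h]; simp
      have h2 : (f ^ (n + 1) : ℂ ≃ₜ ℂ) (α 0) = (f ^ n : ℂ ≃ₜ ℂ) (f (α 0)) := by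
        rw [zpow_add_one]; rfl
      have h3 : γ t = (f ^ (n + 1) : ℂ ≃ₜ ℂ) (α (t - (n + 1))) := by
        simp only [γ, Int.fract, this]
        push_cast
        rfl
      rw [h3, h, sub_self, h2, hα.map_zero, add_sub_cancel_left]
  have hγ1 : ∀ t, γ (t + 1) = f (γ t) := by
    intro t
    simp only [γ, Int.floor_add_one, Int.fract_add_one]
    rw [add_comm, zpow_one_add]
    rfl
  have hγc : Continuous γ := by
    refine LocallyFinite.continuous (f := fun n : ℤ => Icc (n : ℝ) (n + 1)) ?_ ?_ ?_ ?_
    · refine locallyFinite_Icc_of_tendsto tendsto_intCast_atTop_atTop ?_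
      exact Filter.tendsto_atBot_add_const_right _ _ (tendsto_intCast_atBot_iff.2 Filter.tendsto_id)
    · exact iUnion_Icc_intCast ℝ
    · exact fun n => isClosed_Icc
    · intro n
      exact ContinuousOn.congr (Continuous.continuousOn
        ((f ^ n : ℂ ≃ₜ ℂ).continuous.comp (hα.continuous.comp (by fun_prop)))) (hγ n)
  have hinj : Function.Injective γ := by
    have key : ∀ s t, ⌊s⌋ ≤ ⌊t⌋ → γ s = γ t → s = t := by
      intro s t hst h
      obtain ⟨j, hj⟩ : ∃ j : ℕ, ⌊t⌋ = ⌊s⌋ + j := ⟨(⌊t⌋ - ⌊s⌋).toNat, by omega⟩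
      have h2 : α (Int.fract s) = f^[j] (α (Int.fract t)) := by
        apply (f ^ ⌊s⌋ : ℂ ≃ₜ ℂ).injective
        have h3 : γ t = (f ^ ⌊s⌋ : ℂ ≃ₜ ℂ) ((f ^ j : ℂ ≃ₜ ℂ) (α (Int.fract t))) := by
          simp only [γ, hj, zpow_add, zpow_natCast]
          rfl
        rw [← hom_pow_apply, ← h3, ← h]
      have hs := And.intro (Int.fract_nonneg s) (Int.fract_lt_one s).le
      have ht := And.intro (Int.fract_nonneg t) (Int.fract_lt_one t).le
      rcases (show j = 0 ∨ j = 1 ∨ 2 ≤ j by omega) with rfl | rfl | hj2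
      · have h3 := hα.injOn ⟨hs.1, hs.2⟩ ⟨ht.1, ht.2⟩ h2
        rw [← Int.floor_add_fract s, ← Int.floor_add_fract t, h3, hj]
        simp
      · exact absurd (hα.free _ ⟨hs.1, hs.2⟩ _ ⟨ht.1, ht.2⟩ h2).1 (Int.fract_lt_one s).ne
      · exact absurd h2 (hdis j hj2 _ ⟨hs.1, hs.2⟩ _ ⟨ht.1, ht.2⟩)
    intro s t h
    rcases le_total ⌊s⌋ ⌊t⌋ with h' | h'
    · exact key s t h' h
    · exact (key t s h' h.symm).symm
  refine ⟨fun t => γ (t + 1 / 2), by fun_prop, fun s t h => by simpa using hinj h, ?_, ?_⟩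
  · intro t
    rw [← hγ1]; ring_nf
  · have := hγ 0 (1 / 2) (by norm_num)
    simp only [zero_add, this]
    simpa using hα.apply_eq

theorem IsPairLog.tendsto_im_sub {k : ℂ ≃ₜ ℂ} {L : ℂ × ℂ → ℂ} (hL : IsPairLog k L) (a a' : ℂ)
    {ι : Type*} {l : Filter ι} {b : ι → ℂ} (hb : Filter.Tendsto b l (Filter.cocompact ℂ)) :
    Filter.Tendsto (fun i => (L (a', b i)).im - (L (a, b i)).im) l (nhds 0) := by
  let p : ℝ → ℂ := fun s => a + s * (a' - a)
  have hp : Continuous p := by fun_prop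
  have hkb : Filter.Tendsto (fun i => k (b i)) l (Filter.cocompact ℂ) :=
    k.isClosedEmbedding.tendsto_cocompact.comp hb
  have aux : ∀ (q : ℝ → ℂ), Continuous q → ∀ c : ι → ℂ, Filter.Tendsto c l (Filter.cocompact ℂ) →
      ∀ᶠ i in l, c i - q 0 ≠ 0 ∧
        ∀ s ∈ Icc (0 : ℝ) 1, (c i - q s) / (c i - q 0) ∈ Complex.slitPlane := by
    intro q hq c hc
    obtain ⟨C, hC⟩ := ((isCompact_Icc (a := (0 : ℝ)) (b := 1)).image hq).isBounded.exists_norm_le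
    have h1 : Filter.Tendsto (fun i => ‖c i‖) l Filter.atTop :=
      (tendsto_norm_cocompact_atTop (E := ℂ)).comp hc
    filter_upwards [h1.eventually_gt_atTop (3 * C)] with i hi
    have hq0 : ‖q 0‖ ≤ C := hC _ ⟨0, by simp, rfl⟩
    have hC0 : 0 ≤ C := (norm_nonneg _).trans hq0
    have h2 : 2 * C < ‖c i - q 0‖ := by
      have := norm_sub_norm_le (c i) (q 0)
      linarith
    have hne : c i - q 0 ≠ 0 := by
      rw [← norm_pos_iff]; linarith
    refine ⟨hne, fun s hs => ?_⟩
    have hqs : ‖q s‖ ≤ C := hC _ ⟨s, hs, rfl⟩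
    suffices h3 : ‖(c i - q s) / (c i - q 0) - 1‖ < 1 by
      simpa using Complex.mem_slitPlane_of_norm_lt_one h3
    rw [div_sub_one hne, norm_div, div_lt_one (by linarith)]
    calc ‖c i - q s - (c i - q 0)‖ = ‖q 0 - q s‖ := by congr 1; ring
      _ ≤ ‖q 0‖ + ‖q s‖ := norm_sub_le _ _
      _ < _ := by linarith
  have key : ∀ᶠ i in l, L (a', b i) - L (a, b i) =
      Complex.log ((k (b i) - k a') / (k (b i) - k a)) - Complex.log ((b i - a') / (b i - a)) := by
    filter_upwards [aux p hp b hb, aux (fun s => k (p s)) (by fun_prop) _ hkb] with i h1 h2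
    have hpb : ∀ s ∈ Icc (0 : ℝ) 1, p s ≠ b i := fun s hs h => by
      have := h1.2 s hs
      rw [h] at this
      simp [Complex.slitPlane] at this
    obtain ⟨n, hn⟩ := exists_int_sub_eq_on (isPreconnected_Icc (a := (0 : ℝ)) (b := 1))
      (u := fun s => L (p s, b i) - L (p 0, b i))
      (v := fun s => Complex.log ((k (b i) - k (p s)) / (k (b i) - k (p 0))) -
        Complex.log ((b i - p s) / (b i - p 0)))
      ((hL.1.comp (f := fun s => (p s, b i)) (by fun_prop) fun s hs => hpb s hs).sub continuousOn_const)
      (((by fun_prop : Continuous fun s => (k (b i) - k (p s)) / (k (b i) - k (p 0))).continuousOn.clog h2.2).sub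
        ((by fun_prop : Continuous fun s => (b i - p s) / (b i - p 0)).continuousOn.clog h1.2))
      (by
        intro s hs
        have e1 : k (b i) - k (p s) ≠ 0 := sub_ne_zero.2 (k.injective.ne (hpb s hs).symm)
        have e2 := sub_ne_zero.2 (hpb s hs).symm
        have e3 := h1.1
        have e4 := h2.1
        have h0 : (0 : ℝ) ∈ Icc (0 : ℝ) 1 := by simp
        rw [Complex.exp_sub, Complex.exp_sub, hL.exp_eq (hpb s hs), hL.exp_eq (hpb 0 h0),
          Complex.exp_log (div_ne_zero e1 e4), Complex.exp_log (div_ne_zero e2 e3)]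
        field_simp)
    have h3 := hn 0 (by simp)
    have h4 := hn 1 (by simp)
    rw [sub_self, div_self h1.1, div_self h2.1, sub_self, zero_add] at h3
    simp only [← h3, add_zero] at h4
    simpa [p] using h4
  have aux2 : ∀ c c' : ℂ, ∀ d : ι → ℂ, Filter.Tendsto d l (Filter.cocompact ℂ) →
      Filter.Tendsto (fun i => Complex.log ((d i - c') / (d i - c))) l (nhds 0) := by
    intro c c' d hd
    have h1 : Filter.Tendsto (fun i => d i - c) l (Filter.cocompact ℂ) :=
      (Homeomorph.subRight c).isClosedEmbedding.tendsto_cocompact.comp hd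
    have h2 : Filter.Tendsto (fun i => 1 + (c - c') * (d i - c)⁻¹) l (nhds (1 + (c - c') * 0)) := by
      refine tendsto_const_nhds.add (tendsto_const_nhds.mul ?_)
      exact (Filter.tendsto_inv₀_cobounded (α := ℂ)).comp (by rwa [Metric.cobounded_eq_cocompact])
    rw [mul_zero, add_zero] at h2
    have h3 : Filter.Tendsto (fun i => (d i - c') / (d i - c)) l (nhds 1) := by
      refine h2.congr' ?_
      have := h1.eventually (isCompact_singleton (x := (0 : ℂ))).compl_mem_cocompact
      filter_upwards [this] with i hi
      have hi' : d i - c ≠ 0 := hi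
      field_simp
      ring
    have := h3.clog (by simp)
    simpa using this
  have h5 := (aux2 (k a) (k a') _ hkb).sub (aux2 a a' _ hb)
  have h6 := (Complex.continuous_im.tendsto _).comp h5
  simp only [sub_self, Complex.zero_im] at h6
  refine h6.congr' ?_
  filter_upwards [key] with i hi
  rw [← Complex.sub_im, hi]
  rfl

/-- Along an orbit on which the pair logarithm vanishes, the angle of the displacement is constant. -/
theorem log_displacement_orbit_eq {f : ℂ ≃ₜ ℂ} {L : ℂ × ℂ → ℂ} (hL : IsPairLog f L)
    (hfix : ∀ x, f x ≠ x) (hf : ∀ n : ℤ, f n = n + 1)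
    (hL0 : ∀ m n : ℤ, m ≠ n → L (m, n) = 0) {Θ : ℂ → ℂ} (hΘ : Continuous Θ)
    (hΘ' : ∀ x, Complex.exp (Θ x) = f x - x) (m n : ℤ) : Θ m = Θ n := by
  obtain ⟨β, hβ, hβi, hβ1, hβ0⟩ := exists_streamline f ⟨L, hL⟩ hfix 0
  have hβn : ∀ n : ℤ, β n = n := by
    have key : ∀ n : ℤ, β (n + 1) = n + 1 ↔ β n = n := by
      intro n
      rw [hβ1, ← hf, f.injective.eq_iff]
    intro n
    induction n with
    | zero => simpa using hβ0
    | succ n ih => have := (key n).2 ih; push_cast at this ⊢; exact this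
    | pred n ih =>
      refine (key _).1 ?_
      have e1 : ((-(n : ℤ) - 1 : ℤ) : ℝ) + 1 = ((-n : ℤ) : ℝ) := by push_cast; ring
      rw [e1, ih]
      push_cast; ring
  obtain ⟨Λ, hΛ, hΛ'⟩ := exists_log_of_starConvex (E := ℝ × ℝ) (s := {p | p.1 < p.2}) (x := (0, 1))
    (by
      apply Convex.starConvex
      · have : {p : ℝ × ℝ | p.1 < p.2} = (fun p : ℝ × ℝ => p.1 - p.2) ⁻¹' Iio 0 := by ext; simp
        rw [this]
        exact (convex_Iio 0).is_linear_preimage (LinearMap.fst ℝ ℝ ℝ - LinearMap.snd ℝ ℝ ℝ).isLinear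
      · simp)
    (f := fun p => β p.2 - β p.1) (by fun_prop) (fun p hp => sub_ne_zero.2 (hβi.ne (ne_of_gt hp)))
  have hpre : IsPreconnected {p : ℝ × ℝ | p.1 < p.2} := by
    have : {p : ℝ × ℝ | p.1 < p.2} = (fun p : ℝ × ℝ => (p.1, p.1 + p.2)) '' (univ ×ˢ Ioi 0) := by
      ext ⟨a, b⟩
      simp only [mem_ofPred_eq, mem_image, mem_prod, Prod.mk.injEq, Prod.exists]
      exact ⟨fun h => ⟨a, b - a, by simpa using h, rfl, by ring⟩, by
        rintro ⟨a, c, ⟨-, h⟩, rfl, rfl⟩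
        simpa using h⟩
    rw [this]
    exact (isPreconnected_univ.prod isPreconnected_Ioi).image _ (by fun_prop)
  obtain ⟨c, hc⟩ := exists_int_sub_eq_on hpre
    (u := fun p => Λ (p.1 + 1, p.2 + 1) - Λ p) (v := fun p => L (β p.1, β p.2))
    (ContinuousOn.sub (hΛ.comp (f := fun p : ℝ × ℝ => (p.1 + 1, p.2 + 1)) (by fun_prop)
      fun p hp => by simpa using hp) hΛ)
    (hL.1.comp (by fun_prop) fun p hp => hβi.ne (ne_of_lt hp))
    (by
      intro p hp
      have h1 : (p.1 + 1, p.2 + 1) ∈ {p : ℝ × ℝ | p.1 < p.2} := by simpa using hp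
      rw [Complex.exp_sub, hΛ' _ h1, hΛ' _ hp, hL.exp_eq (hβi.ne (ne_of_lt hp))]
      simp only [hβ1])
  have hΛn : ∀ i j : ℤ, i < j → Λ (i + 1, j + 1) = Λ (i, j) + c * (2 * Real.pi * Complex.I) := by
    intro i j hij
    have := hc (i, j) (by simpa using hij)
    simp only [hβn, hL0 i j hij.ne, zero_add] at this
    linear_combination this
  obtain ⟨C, hC⟩ := ((isCompact_Icc (a := (0 : ℝ)) (b := 1)).image hβ).isBounded.exists_norm_le
  have hβC : ∀ j : ℤ, C < j → ∀ s ∈ Icc (0 : ℝ) 1, |(β s).re| < j := fun j hj s hs =>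
    ((Complex.abs_re_le_norm _).trans (hC _ ⟨s, hs, rfl⟩)).trans_lt hj
  have h0I : (0 : ℝ) ∈ Icc (0 : ℝ) 1 := by simp
  have h1I : (1 : ℝ) ∈ Icc (0 : ℝ) 1 := by simp
  have hβone : β 1 = 1 := by simpa using hβn 1
  have hlim : ∀ j : ℤ, C < j → 1 < j → (Λ (0, j)).im = (Λ (1, j)).im := by
    intro j hj hj1
    have hj1' : (1 : ℝ) < j := by exact_mod_cast hj1
    have hlt : ∀ s ∈ Icc (0 : ℝ) 1, s < j := fun s hs => hs.2.trans_lt hj1'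
    obtain ⟨n, hn⟩ := exists_int_sub_eq_on (isPreconnected_Icc (a := (0 : ℝ)) (b := 1))
      (u := fun s => Λ (s, j)) (v := fun s => Complex.log (j - β s))
      (hΛ.comp (by fun_prop) hlt)
      ((by fun_prop : Continuous fun s => (j : ℂ) - β s).continuousOn.clog fun s hs => Or.inl (by
        have := (abs_lt.1 (hβC j hj s hs)).2
        simpa using this))
      (by
        intro s hs
        rw [hΛ' _ (hlt s hs), Complex.exp_log (by rw [← hβn]; exact sub_ne_zero.2 (hβi.ne (hlt s hs).ne')), hβn])
    have h2 : (Complex.log ((j : ℂ) - 1)).im = 0 := by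
      rw [Complex.log_im, show (j : ℂ) - 1 = ((j - 1 : ℝ) : ℂ) by push_cast; rfl]
      exact Complex.arg_ofReal_of_nonneg (by linarith)
    have h3 : (Complex.log (j : ℂ)).im = 0 := by
      rw [Complex.log_im, show (j : ℂ) = ((j : ℝ) : ℂ) by push_cast; rfl]
      exact Complex.arg_ofReal_of_nonneg (by linarith)
    rw [hn 0 h0I, hn 1 h1I, hβ0, hβone, Complex.add_im, Complex.add_im, h2, sub_zero, h3]
  have hlim' : ∀ j : ℤ, C < j → 1 < j → (Λ ((-j : ℤ), 0)).im = (Λ ((-j : ℤ), 1)).im := by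
    intro j hj hj1
    have hj1' : (1 : ℝ) < j := by exact_mod_cast hj1
    have hlt : ∀ s ∈ Icc (0 : ℝ) 1, ((-j : ℤ) : ℝ) < s := fun s hs => by
      push_cast; linarith [hs.1]
    obtain ⟨n, hn⟩ := exists_int_sub_eq_on (isPreconnected_Icc (a := (0 : ℝ)) (b := 1))
      (u := fun s => Λ ((-j : ℤ), s)) (v := fun s => Complex.log (β s + j))
      (hΛ.comp (by fun_prop) hlt)
      ((by fun_prop : Continuous fun s => β s + (j : ℂ)).continuousOn.clog fun s hs => Or.inl (by
        have := (abs_lt.1 (hβC j hj s hs)).1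
        simp only [Complex.add_re, Complex.intCast_re]
        linarith))
      (by
        intro s hs
        have e : β s + j = β s - β (-j : ℤ) := by rw [hβn]; push_cast; ring
        rw [e, hΛ' _ (hlt s hs), Complex.exp_log (sub_ne_zero.2 (hβi.ne (hlt s hs).ne'))])
    have h2 : (Complex.log (1 + (j : ℂ))).im = 0 := by
      rw [Complex.log_im, show 1 + (j : ℂ) = ((1 + j : ℝ) : ℂ) by push_cast; rfl]
      exact Complex.arg_ofReal_of_nonneg (by linarith)
    have h3 : (Complex.log (j : ℂ)).im = 0 := by
      rw [Complex.log_im, show (j : ℂ) = ((j : ℝ) : ℂ) by push_cast; rfl]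
      exact Complex.arg_ofReal_of_nonneg (by linarith)
    rw [hn 0 h0I, hn 1 h1I, hβ0, hβone, Complex.add_im, Complex.add_im, zero_add, h2, h3]
  have hΛm : ∀ (m : ℕ) (i j : ℤ), i < j →
      Λ ((i + m : ℤ), (j + m : ℤ)) = Λ (i, j) + m * (c * (2 * Real.pi * Complex.I)) := by
    intro m i j hij
    induction m with
    | zero => simp
    | succ m ih =>
      have := hΛn (i + m) (j + m) (by omega)
      push_cast at this ih ⊢
      rw [← add_assoc, ← add_assoc, this, ih]
      ring
  have hc0 : c = 0 := by
    obtain ⟨m, hm⟩ := exists_nat_gt (max C 1)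
    have hmC : C < m := (le_max_left _ _).trans_lt hm
    have hm1 : (1 : ℝ) < m := (le_max_right _ _).trans_lt hm
    have hm1' : 1 < m := by exact_mod_cast hm1
    have e1 := hlim (m + 1) (by push_cast; linarith) (by omega)
    have e2 := hlim' m (by push_cast; linarith) (by omega)
    have e3 := hΛn 0 m (by omega)
    have e4 := congrArg Complex.im (hΛm m (-m) 0 (by omega))
    have e5 := congrArg Complex.im (hΛm m (-m) 1 (by omega))
    push_cast at e1 e2 e3 e4 e5
    simp only [neg_add_cancel, zero_add, Complex.add_im] at e3 e4 e5
    have e6 := congrArg Complex.im e3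
    rw [add_comm (1 : ℝ)] at e5
    simp only [Complex.add_im] at e6
    have e7 : ((c : ℂ) * (2 * Real.pi * Complex.I)).im = c * (2 * Real.pi) := by simp
    rw [e7] at e6
    have e8 : (c : ℝ) * (2 * Real.pi) = 0 := by linarith
    have := Real.pi_pos
    have e9 : (c : ℝ) = 0 := by
      rcases mul_eq_zero.1 e8 with h | h
      · exact h
      · linarith
    exact_mod_cast e9
  obtain ⟨c', hc'⟩ := exists_int_sub_eq_on (isPreconnected_univ (α := ℝ))
    (u := fun t => Θ (β t)) (v := fun t => Λ (t, t + 1)) (by fun_prop)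
    (hΛ.comp (by fun_prop) fun t _ => by simp)
    (by
      intro t _
      rw [hΘ', hΛ' _ (by simp), hβ1])
  have step : ∀ n : ℤ, Θ (n + 1 : ℤ) = Θ n := by
    intro n
    rw [← hβn, ← hβn, hc' _ trivial, hc' _ trivial]
    have := hΛn n (n + 1) (by omega)
    push_cast at this ⊢
    rw [this, hc0]
    simp
  have all : ∀ n : ℤ, Θ n = Θ (0 : ℤ) := by
    intro n
    induction n with
    | zero => rfl
    | succ n ih => rw [step, ih]
    | pred n ih => rw [← ih, ← step]; simp
  rw [all m, all n]

/-- The plane with the closed upper vertical rays from the integers removed. -/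
def lowerSlit : Set ℂ := {z | z.im < 0 ∨ ∀ n : ℤ, z.re ≠ n}

/-- The plane with the closed lower vertical rays from the integers removed. -/
def upperSlit : Set ℂ := {z | 0 < z.im ∨ ∀ n : ℤ, z.re ≠ n}

/-- The complement of the integers in the plane. -/
def intCompl : Set ℂ := {z | ∀ n : ℤ, z ≠ n}

theorem isOpen_re_ne_int : IsOpen {z : ℂ | ∀ n : ℤ, z.re ≠ n} := by
  have : {z : ℂ | ∀ n : ℤ, z.re ≠ n} = Complex.re ⁻¹' (range ((↑) : ℤ → ℝ))ᶜ := by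
    ext z
    simp [eq_comm]
  rw [this]
  exact Int.isClosedEmbedding_coe_real.isClosed_range.isOpen_compl.preimage Complex.continuous_re

theorem isOpen_lowerSlit : IsOpen lowerSlit :=
  (isOpen_lt Complex.continuous_im continuous_const).union isOpen_re_ne_int

theorem isOpen_upperSlit : IsOpen upperSlit :=
  (isOpen_lt continuous_const Complex.continuous_im).union isOpen_re_ne_int

theorem re_ne_int_of_mem {z : ℂ} (h : z ∈ lowerSlit) (h' : z ∈ upperSlit) (n : ℤ) : z.re ≠ n := by
  rcases h with h | h
  · rcases h' with h' | h'
    · exact absurd h h'.not_gt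
    · exact h' n
  · exact h n

theorem mem_lowerSlit_or_mem_upperSlit {z : ℂ} (hz : z ∈ intCompl) :
    z ∈ lowerSlit ∨ z ∈ upperSlit := by
  by_contra! h
  simp only [lowerSlit, upperSlit, mem_ofPred_eq, not_or, not_lt] at h
  obtain ⟨⟨h1, h2⟩, h3, -⟩ := h
  push Not at h2
  obtain ⟨n, hn⟩ := h2
  exact hz n (Complex.ext (by simpa using hn) (by simpa using le_antisymm h3 h1))

theorem lowerSlit_subset : lowerSlit ⊆ intCompl := by
  rintro z (h | h) n rfl
  · simp at h
  · simpa using h n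

theorem upperSlit_subset : upperSlit ⊆ intCompl := by
  rintro z (h | h) n rfl
  · simp at h
  · simpa using h n

theorem eventually_floor_re_eq {z : ℂ} (hz : ∀ n : ℤ, z.re ≠ n) :
    ∀ᶠ z' in nhds z, ⌊z'.re⌋ = ⌊z.re⌋ := by
  have h1 : (⌊z.re⌋ : ℝ) < z.re := lt_of_le_of_ne (Int.floor_le _) (hz _).symm
  filter_upwards [(Complex.continuous_re.tendsto z).eventually (Ioo_mem_nhds h1 (Int.lt_floor_add_one z.re))]
    with z' hz'
  exact Int.floor_eq_iff.2 ⟨hz'.1.le, hz'.2⟩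

/-- A section, over the map `φ` on `W`, of the local system of sets on `ℂ \ ℤ` whose two
trivialisations over the slit planes differ by `a n` on the strip `n < re z < n + 1`. -/
structure IsSec {M Y : Type*} [TopologicalSpace Y] (a : ℤ → Equiv.Perm M) (W : Set Y) (φ : Y → ℂ)
    (u v : Y → M) : Prop where
  left : ∀ w ∈ W, φ w ∈ lowerSlit → ∀ᶠ w' in nhdsWithin w W, u w' = u w
  right : ∀ w ∈ W, φ w ∈ upperSlit → ∀ᶠ w' in nhdsWithin w W, v w' = v w
  compat : ∀ w ∈ W, φ w ∈ lowerSlit → φ w ∈ upperSlit → v w = a ⌊(φ w).re⌋ (u w)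

def Agree {M : Type*} (z : ℂ) (u v u' v' : M) : Prop :=
  (z ∈ lowerSlit → u = u') ∧ (z ∈ upperSlit → v = v')

namespace IsSec

variable {M Y : Type*} [TopologicalSpace Y] {a : ℤ → Equiv.Perm M} {W : Set Y} {φ : Y → ℂ}
  {u v u' v' : Y → M}

theorem mono (h : IsSec a W φ u v) {W' : Set Y} (hW : W' ⊆ W) : IsSec a W' φ u v where
  left _ hw h1 := (h.left _ (hW hw) h1).filter_mono (nhdsWithin_mono _ hW)
  right _ hw h1 := (h.right _ (hW hw) h1).filter_mono (nhdsWithin_mono _ hW)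
  compat w hw := h.compat w (hW hw)

theorem comp (h : IsSec a W φ u v) {Y' : Type*} [TopologicalSpace Y'] {W' : Set Y'} {g : Y' → Y}
    (hg : ContinuousOn g W') (hm : MapsTo g W' W) : IsSec a W' (φ ∘ g) (u ∘ g) (v ∘ g) where
  left w hw h1 := ((hg w hw).tendsto_nhdsWithin hm).eventually (h.left _ (hm hw) h1)
  right w hw h1 := ((hg w hw).tendsto_nhdsWithin hm).eventually (h.right _ (hm hw) h1)
  compat _ hw := h.compat _ (hm hw)

theorem congr_map (h : IsSec a W φ u v) {ψ : Y → ℂ} (hψ : ∀ w ∈ W, ψ w = φ w) : IsSec a W ψ u v where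
  left w hw h1 := h.left w hw (hψ w hw ▸ h1)
  right w hw h1 := h.right w hw (hψ w hw ▸ h1)
  compat w hw := by rw [hψ w hw]; exact h.compat w hw

theorem map (h : IsSec a W φ u v) {M' : Type*} {a' : ℤ → Equiv.Perm M'} (f : M → M')
    (hf : ∀ n x, f (a n x) = a' n (f x)) : IsSec a' W φ (f ∘ u) (f ∘ v) where
  left _ hw h1 := (h.left _ hw h1).mono fun _ h => congrArg f h
  right _ hw h1 := (h.right _ hw h1).mono fun _ h => congrArg f h
  compat w hw h1 h2 := by
    simp only [Function.comp_apply, h.compat w hw h1 h2, hf]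

theorem agree_of_left (h : IsSec a W φ u v) (h' : IsSec a W φ u' v') {w : Y} (hw : w ∈ W)
    (h1 : φ w ∈ lowerSlit) (h2 : u w = u' w) : Agree (φ w) (u w) (v w) (u' w) (v' w) :=
  ⟨fun _ => h2, fun h3 => by rw [h.compat w hw h1 h3, h'.compat w hw h1 h3, h2]⟩

theorem agree_of_right (h : IsSec a W φ u v) (h' : IsSec a W φ u' v') {w : Y} (hw : w ∈ W)
    (h1 : φ w ∈ upperSlit) (h2 : v w = v' w) : Agree (φ w) (u w) (v w) (u' w) (v' w) :=
  ⟨fun h3 => by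
    rw [h.compat w hw h3 h1, h'.compat w hw h3 h1] at h2
    exact (a _).injective h2, fun _ => h2⟩

theorem agree (h : IsSec a W φ u v) (h' : IsSec a W φ u' v') (hW : IsPreconnected W)
    (hφ : ContinuousOn φ W) (hX : MapsTo φ W intCompl) {w₀ : Y} (hw₀ : w₀ ∈ W)
    (h0 : Agree (φ w₀) (u w₀) (v w₀) (u' w₀) (v' w₀)) {w : Y} (hw : w ∈ W) :
    Agree (φ w) (u w) (v w) (u' w) (v' w) := by
  have key : ∀ w ∈ W, ∀ᶠ w' in nhdsWithin w W, (Agree (φ w') (u w') (v w') (u' w') (v' w') ↔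
      Agree (φ w) (u w) (v w) (u' w) (v' w)) := by
    intro w hw
    rcases mem_lowerSlit_or_mem_upperSlit (hX hw) with h1 | h1
    · filter_upwards [h.left w hw h1, h'.left w hw h1, self_mem_nhdsWithin,
        (hφ w hw).eventually (isOpen_lowerSlit.mem_nhds h1)] with w' e1 e2 hw' h2
      constructor
      · intro hA
        exact h.agree_of_left h' hw h1 (by rw [← e1, ← e2]; exact hA.1 h2)
      · intro hA
        exact h.agree_of_left h' hw' h2 (by rw [e1, e2]; exact hA.1 h1)
    · filter_upwards [h.right w hw h1, h'.right w hw h1, self_mem_nhdsWithin,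
        (hφ w hw).eventually (isOpen_upperSlit.mem_nhds h1)] with w' e1 e2 hw' h2
      constructor
      · intro hA
        exact h.agree_of_right h' hw h1 (by rw [← e1, ← e2]; exact hA.2 h2)
      · intro hA
        exact h.agree_of_right h' hw' h2 (by rw [e1, e2]; exact hA.2 h1)
  refine (hW.induction₂' (fun x y => Agree (φ x) (u x) (v x) (u' x) (v' x) →
    Agree (φ y) (u y) (v y) (u' y) (v' y)) ?_ ?_ hw₀ hw) h0
  · intro x hx
    filter_upwards [key x hx] with y hy
    exact ⟨hy.2, hy.1⟩
  · intro x y z _ _ _ h1 h2 h3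
    exact h2 (h1 h3)

end IsSec

/-- The covering space of `ℂ \ ℤ` with the given monodromy. -/
noncomputable def intComplCover {M : Type*} [TopologicalSpace M] [DiscreteTopology M] (a : ℤ → Equiv.Perm M) :
    FiberBundleCore Bool intCompl M where
  baseSet i := {z | z.1 ∈ if i then upperSlit else lowerSlit}
  isOpen_baseSet i := by
    cases i
    · exact isOpen_lowerSlit.preimage continuous_subtype_val
    · exact isOpen_upperSlit.preimage continuous_subtype_val
  indexAt z := by classical exact if z.1 ∈ lowerSlit then false else true
  mem_baseSet_at z := by
    by_cases h : z.1 ∈ lowerSlit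
    · simp [h]
    · simpa [h] using (mem_lowerSlit_or_mem_upperSlit z.2).resolve_left h
  coordChange i j z := (if i then a ⌊z.1.re⌋ else 1).symm.trans (if j then a ⌊z.1.re⌋ else 1)
  coordChange_self i z _ x := by simp
  continuousOn_coordChange i j := by
    intro p hp
    rcases eq_or_ne i j with rfl | hij
    · simp only [Equiv.symm_trans_self, Equiv.refl_apply]
      exact continuous_snd.continuousWithinAt
    have h1 : p.1.1 ∈ lowerSlit ∧ p.1.1 ∈ upperSlit := by
      obtain ⟨⟨h1, h2⟩, -⟩ := hp
      cases i <;> cases j <;> simp_all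
    have h2 := eventually_floor_re_eq (re_ne_int_of_mem h1.1 h1.2)
    have h3 : ∀ᶠ q in nhds p, ⌊q.1.1.re⌋ = ⌊p.1.1.re⌋ ∧ q.2 = p.2 := by
      refine (((continuous_subtype_val.comp continuous_fst).tendsto p).eventually h2).and ?_
      exact (continuous_snd.tendsto p).eventually (p := fun m => m = p.2) (by simp [nhds_discrete])
    refine ContinuousAt.continuousWithinAt ?_
    refine (continuousAt_const (y := (if i then a ⌊p.1.1.re⌋ else 1).symm.trans (if j then a ⌊p.1.1.re⌋ else 1) p.2)).congr ?_
    filter_upwards [h3] with q hq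
    rw [hq.1, hq.2]
  coordChange_comp i j k z _ x := by simp

theorem exists_isSec {M Y : Type*} [TopologicalSpace Y] (a : ℤ → Equiv.Perm M) (W : Set Y)
    [SimplyConnectedSpace W] [LocallyPathConnectedSpace W] {φ : Y → ℂ} (hφ : ContinuousOn φ W)
    (hX : MapsTo φ W intCompl) {w₀ : Y} (hw₀ : w₀ ∈ W) (h0 : φ w₀ ∈ lowerSlit) (m : M) :
    ∃ u v, IsSec a W φ u v ∧ u w₀ = m := by
  let _ : TopologicalSpace M := ⊥
  have : DiscreteTopology M := ⟨rfl⟩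
  let Z := intComplCover a
  have cov : IsCoveringMap Z.proj := FiberBundle.isCoveringMap (F := M) (E := Z.Fiber)
  let φ' : C(W, intCompl) := ⟨fun w => ⟨φ w.1, hX w.2⟩,
    (continuousOn_iff_continuous_domRestrict.1 hφ).subtype_mk _⟩
  have hmem : (φ' ⟨w₀, hw₀⟩, m) ∈ (Z.localTriv false).target := by
    rw [Bundle.Trivialization.mem_target]
    exact h0
  obtain ⟨F, ⟨hF0, hF⟩, -⟩ := cov.existsUnique_continuousMap_lifts φ' ⟨w₀, hw₀⟩
    ((Z.localTriv false).toOpenPartialHomeomorph.symm (φ' ⟨w₀, hw₀⟩, m))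
    (Bundle.Trivialization.proj_symm_apply _ hmem)
  have hF' : ∀ w, (F w).1 = φ' w := fun w => congrFun hF w
  have loc : ∀ i : Bool, ∀ w : W, φ w.1 ∈ (if i then upperSlit else lowerSlit) →
      ∀ᶠ w' in nhds w, (Z.localTriv i (F w')).2 = (Z.localTriv i (F w)).2 := by
    intro i w hw
    have hsrc : F w ∈ (Z.localTriv i).source := by
      rw [Z.mem_localTriv_source, hF']
      exact hw
    have h1 : ContinuousAt (fun w' => (Z.localTriv i (F w')).2) w :=
      continuous_snd.continuousAt.comp (((Z.localTriv i).continuousAt hsrc).comp F.continuous.continuousAt)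
    exact h1.eventually (p := fun x => x = (Z.localTriv i (F w)).2) (by simp [nhds_discrete])
  classical
  let G : Bool → Y → M := fun i y => if h : y ∈ W then (Z.localTriv i (F ⟨y, h⟩)).2 else m
  have hG : ∀ i (w : W), G i w.1 = (Z.localTriv i (F w)).2 := fun i w => by simp [G]
  have locG : ∀ i : Bool, ∀ w ∈ W, φ w ∈ (if i then upperSlit else lowerSlit) →
      ∀ᶠ w' in nhdsWithin w W, G i w' = G i w := by
    intro i w hw h
    rw [nhdsWithin_eq_map_subtype_coe hw, Filter.eventually_map]
    filter_upwards [loc i ⟨w, hw⟩ h] with w' hw'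
    rw [hG, hw', ← hG]
  refine ⟨G false, G true, ⟨fun w hw h => locG false w hw h, fun w hw h => locG true w hw h, ?_⟩, ?_⟩
  · intro w hw h1 h2
    have e := Z.coordChange_comp (Z.indexAt (F ⟨w, hw⟩).1) false true (F ⟨w, hw⟩).1
      ⟨⟨Z.mem_baseSet_at _, by rw [hF']; exact h1⟩, by rw [hF']; exact h2⟩ (F ⟨w, hw⟩).2
    have h3 : ∀ z x, Z.coordChange false true z x = a ⌊z.1.re⌋ x := fun z x => rfl
    have h4 : ((F ⟨w, hw⟩).1 : ℂ) = φ w := by rw [hF']; rfl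
    rw [h3, h4] at e
    rw [hG true ⟨w, hw⟩, hG false ⟨w, hw⟩, Z.localTriv_apply, Z.localTriv_apply]
    exact e.symm
  · rw [hG false ⟨w₀, hw₀⟩, hF0]
    exact congrArg Prod.snd (Bundle.Trivialization.apply_symm_apply _ hmem)

theorem contractibleSpace_lowerSlit : ContractibleSpace lowerSlit := by
  have hH : ∀ z : ℂ, z.im < 0 → z ∈ lowerSlit := fun z h => Or.inl h
  have him : ∀ z : ℂ, (z - ((|z.im| + 1 : ℝ) : ℂ) * Complex.I).im < 0 := fun z => by
    have := le_abs_self z.im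
    simp only [Complex.sub_im, Complex.mul_I_im, Complex.ofReal_re]
    linarith
  let r : C(lowerSlit, lowerSlit) :=
    ⟨fun z => ⟨z.1 - ((|z.1.im| + 1 : ℝ) : ℂ) * Complex.I, hH _ (him z.1)⟩, by fun_prop⟩
  let p : lowerSlit := ⟨-Complex.I, hH _ (by simp)⟩
  have hr : Continuous fun q : unitInterval × lowerSlit => (r q.2).1 :=
    continuous_subtype_val.comp (r.continuous.comp continuous_snd)
  have m1 : ∀ q : unitInterval × lowerSlit,
      q.2.1 - ((q.1.1 * (|q.2.1.im| + 1) : ℝ) : ℂ) * Complex.I ∈ lowerSlit := by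
    intro q
    rcases q.2.2 with h | h
    · refine Or.inl ?_
      have := mul_nonneg q.1.2.1 (by positivity : 0 ≤ |q.2.1.im| + 1)
      simp only [Complex.sub_im, Complex.mul_I_im, Complex.ofReal_re]
      linarith
    · refine Or.inr fun n => ?_
      simpa using h n
  have m2 : ∀ q : unitInterval × lowerSlit,
      ((1 - q.1.1 : ℝ) : ℂ) * (r q.2).1 + (q.1.1 : ℂ) * (-Complex.I) ∈ lowerSlit := by
    intro q
    refine hH _ ?_
    have h1 : (r q.2).1.im < 0 := him q.2.1
    have h2 := q.1.2.1
    have h3 := q.1.2.2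
    simp only [Complex.add_im, Complex.im_ofReal_mul, Complex.neg_im, Complex.I_im]
    rcases h2.eq_or_lt with h | h
    · rw [← h]
      linarith
    · nlinarith
  have H1 : ContinuousMap.Homotopy (ContinuousMap.id lowerSlit) r :=
    { toFun := fun q => ⟨_, m1 q⟩
      continuous_toFun := Continuous.subtype_mk (by fun_prop) _
      map_zero_left := fun z => by simp
      map_one_left := fun z => by simp [r] }
  have H2 : ContinuousMap.Homotopy r (ContinuousMap.const lowerSlit p) :=
    { toFun := fun q => ⟨_, m2 q⟩
      continuous_toFun := Continuous.subtype_mk (by fun_prop) _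
      map_zero_left := fun z => by simp
      map_one_left := fun z => by simp [p] }
  rw [contractible_iff_id_nullhomotopic]
  exact ⟨p, ⟨H1.trans H2⟩⟩

theorem conj_mem_lowerSlit {z : ℂ} : (starRingEnd ℂ) z ∈ lowerSlit ↔ z ∈ upperSlit := by
  simp [lowerSlit, upperSlit]

theorem contractibleSpace_upperSlit : ContractibleSpace upperSlit := by
  have := contractibleSpace_lowerSlit
  let e : upperSlit ≃ₜ lowerSlit :=
    { toFun := fun z => ⟨(starRingEnd ℂ) z.1, conj_mem_lowerSlit.2 z.2⟩
      invFun := fun z => ⟨(starRingEnd ℂ) z.1, conj_mem_lowerSlit.1 (by simp)⟩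
      left_inv := fun z => by simp
      right_inv := fun z => by simp
      continuous_toFun := (Complex.continuous_conj.comp continuous_subtype_val).subtype_mk _
      continuous_invFun := (Complex.continuous_conj.comp continuous_subtype_val).subtype_mk _ }
  exact e.contractibleSpace

/-- The transition permutations `B ^ (m + 1) * A ^ (-(m + 1))`. -/
def transPerm {M : Type*} (A B : Equiv.Perm M) (m : ℤ) : Equiv.Perm M :=
  B ^ (m + 1) * A ^ (-(m + 1))

section transPerm

variable {M : Type*} {A B : Equiv.Perm M} {o : M}

theorem transPerm_sub_one_apply (j : ℤ) : transPerm A B (j - 1) ((A ^ j) o) = (B ^ j) o := by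
  simp [transPerm]

theorem transPerm_apply (h : B (A⁻¹ o) = o) (j : ℤ) :
    transPerm A B j ((A ^ j) o) = (B ^ j) o := by
  have h1 : (A ^ (-(j + 1))) ((A ^ j) o) = A⁻¹ o := by
    rw [← Equiv.Perm.mul_apply, ← zpow_add]
    simp
  rw [transPerm, Equiv.Perm.mul_apply, h1, zpow_add_one, Equiv.Perm.mul_apply, h]

theorem transPerm_succ_apply (m : ℤ) (x : M) :
    transPerm A B (m + 1) (A x) = B (transPerm A B m x) := by
  have h1 : (A ^ (-(m + 1 + 1))) (A x) = (A ^ (-(m + 1))) x := by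
    rw [neg_add, zpow_add, Equiv.Perm.mul_apply]
    simp
  rw [transPerm, Equiv.Perm.mul_apply, h1, add_comm (m + 1) 1, zpow_add, zpow_one,
    Equiv.Perm.mul_apply, transPerm, Equiv.Perm.mul_apply]

theorem zpow_semiconj {M' : Type*} {A' : Equiv.Perm M'} {f : M → M'} (h : ∀ x, f (A x) = A' (f x))
    (n : ℤ) (x : M) : f ((A ^ n) x) = (A' ^ n) (f x) := by
  have h' : ∀ x, f (A⁻¹ x) = A'⁻¹ (f x) := fun x => by
    rw [Equiv.Perm.eq_inv_iff_eq, ← h]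
    simp
  induction n using Int.induction_on generalizing x with
  | zero => simp
  | succ n ih => simp only [zpow_add_one, Equiv.Perm.mul_apply, ih, h]
  | pred n ih => simp only [zpow_sub_one, Equiv.Perm.mul_apply, ih, h']

theorem transPerm_semiconj {M' : Type*} {A' B' : Equiv.Perm M'} {f : M → M'}
    (h : ∀ x, f (A x) = A' (f x)) (h' : ∀ x, f (B x) = B' (f x)) (n : ℤ) (x : M) :
    f (transPerm A B n x) = transPerm A' B' n (f x) := by
  simp only [transPerm, Equiv.Perm.mul_apply, zpow_semiconj h, zpow_semiconj h']

variable {Y : Type*} [TopologicalSpace Y]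

theorem isSec_const (h : B (A⁻¹ o) = o) {W : Set Y} {φ : Y → ℂ} {j : ℤ}
    (hφ : MapsTo φ W (Metric.ball (j : ℂ) 1)) :
    IsSec (transPerm A B) W φ (fun _ => (A ^ j) o) (fun _ => (B ^ j) o) where
  left _ _ _ := Filter.Eventually.of_forall fun _ => rfl
  right _ _ _ := Filter.Eventually.of_forall fun _ => rfl
  compat w hw h1 h2 := by
    have h3 := re_ne_int_of_mem h1 h2 j
    have h4 : |(φ w).re - j| < 1 := by
      have := hφ hw
      rw [Metric.mem_ball, dist_eq_norm] at this
      simpa using (Complex.abs_re_le_norm _).trans_lt this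
    rw [abs_lt] at h4
    rcases lt_or_gt_of_ne h3 with h5 | h5
    · have : ⌊(φ w).re⌋ = j - 1 := by
        rw [Int.floor_eq_iff]
        push_cast
        constructor <;> linarith
      rw [this, transPerm_sub_one_apply]
    · have : ⌊(φ w).re⌋ = j := by
        rw [Int.floor_eq_iff]
        constructor <;> linarith
      rw [this, transPerm_apply h]

/-- The section is equal to the section `(A ^ j o, B ^ j o)` at `z`. -/
abbrev Central (A B : Equiv.Perm M) (o : M) (j : ℤ) (z : ℂ) (u v : M) : Prop :=
  Agree z u v ((A ^ j) o) ((B ^ j) o)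

theorem IsSec.central (h : B (A⁻¹ o) = o) {W : Set Y} {φ : Y → ℂ} {u v : Y → M} {j : ℤ}
    (hs : IsSec (transPerm A B) W φ u v) (hW : IsPreconnected W) (hφ : ContinuousOn φ W)
    (hX : MapsTo φ W intCompl) (hm : MapsTo φ W (Metric.ball (j : ℂ) 1)) {w₀ : Y} (hw₀ : w₀ ∈ W)
    (h0 : Central A B o j (φ w₀) (u w₀) (v w₀)) {w : Y} (hw : w ∈ W) :
    Central A B o j (φ w) (u w) (v w) :=
  hs.agree (isSec_const h hm) hW hφ hX hw₀ h0 hw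

end transPerm

theorem isPreconnected_lowerSlit_inter_ball (j : ℤ) {ε : ℝ} (h0 : 0 < ε) (h1 : ε ≤ 1) :
    IsPreconnected (lowerSlit ∩ Metric.ball (j : ℂ) ε) := by
  have hc : ((j : ℂ) - (ε / 2 : ℝ) * Complex.I) ∈ lowerSlit ∩ Metric.ball (j : ℂ) ε := by
    refine ⟨Or.inl ?_, ?_⟩
    · simp [h0]
    · rw [Metric.mem_ball, dist_eq_norm, sub_sub_cancel_left]
      simp [abs_of_pos h0, h0]
  refine (StarConvex.isPathConnected (a := (j : ℂ) - (ε / 2 : ℝ) * Complex.I) ?_ hc).isConnected.isPreconnected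
  intro z hz a b ha hb hab
  refine ⟨?_, (convex_ball (j : ℂ) ε) hc.2 hz.2 ha hb hab⟩
  have hb' : a = 1 - b := by linarith
  have hre : (a • ((j : ℂ) - (ε / 2 : ℝ) * Complex.I) + b • z).re = j + b * (z.re - j) := by
    simp [hb']
    ring
  have him : (a • ((j : ℂ) - (ε / 2 : ℝ) * Complex.I) + b • z).im = - a * (ε / 2) + b * z.im := by
    simp
  have h4 : |z.re - j| < 1 := by
    have := hz.2
    rw [Metric.mem_ball, dist_eq_norm] at this
    have h5 := (Complex.abs_re_le_norm _).trans_lt this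
    simp at h5
    linarith
  rcases hz.1 with h | h
  · left
    rw [him]
    rcases ha.eq_or_lt with h6 | h6
    · have : b = 1 := by linarith
      rw [← h6, this]
      linarith
    · nlinarith
  · rcases hb.eq_or_lt with h6 | h6
    · left
      have : a = 1 := by linarith
      rw [him, ← h6, this]
      linarith
    · right
      intro n hn
      rw [hre] at hn
      have h7 : b * (z.re - j) = ((n - j : ℤ) : ℝ) := by push_cast; linarith
      have h8 : |b * (z.re - j)| < 1 := by
        rw [abs_mul, abs_of_pos h6]
        nlinarith [abs_nonneg (z.re - j)]
      rw [h7, ← Int.cast_abs] at h8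
      have h9 : n - j = 0 := by
        rw [← Int.abs_lt_one_iff]
        exact_mod_cast h8
      rw [h9, Int.cast_zero, mul_eq_zero] at h7
      rcases h7 with h7 | h7
      · linarith
      · exact h j (by linarith)

theorem isPreconnected_upperSlit_inter_ball (j : ℤ) {ε : ℝ} (h0 : 0 < ε) (h1 : ε ≤ 1) :
    IsPreconnected (upperSlit ∩ Metric.ball (j : ℂ) ε) := by
  convert (isPreconnected_lowerSlit_inter_ball j h0 h1).image (starRingEnd ℂ)
    Complex.continuous_conj.continuousOn using 1
  ext z
  constructor
  · rintro ⟨h, h'⟩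
    refine ⟨(starRingEnd ℂ) z, ⟨conj_mem_lowerSlit.2 h, ?_⟩, by simp⟩
    rw [Metric.mem_ball, ← Complex.isometry_conj.dist_eq]
    simpa using h'
  · rintro ⟨w, ⟨h, h'⟩, rfl⟩
    refine ⟨conj_mem_lowerSlit.1 (by simpa using h), ?_⟩
    rw [Metric.mem_ball, ← Complex.isometry_conj.dist_eq]
    simpa using h'

/-- The open strip `j < re z < j + 1`. -/
def strip (j : ℤ) : Set ℂ := {z | (j : ℝ) < z.re ∧ z.re < j + 1}

theorem convex_strip (j : ℤ) : Convex ℝ (strip j) :=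
  (convex_halfSpace_re_gt _).inter (convex_halfSpace_re_lt _)

theorem isOpen_strip (j : ℤ) : IsOpen (strip j) :=
  (isOpen_lt continuous_const Complex.continuous_re).inter
    (isOpen_lt Complex.continuous_re continuous_const)

theorem re_ne_int_of_mem_strip {j : ℤ} {z : ℂ} (hz : z ∈ strip j) (n : ℤ) : z.re ≠ n := by
  intro h
  have h1 := hz.1
  have h2 := hz.2
  rw [h] at h1 h2
  have h3 : j < n := by exact_mod_cast h1
  have h4 : n < j + 1 := by exact_mod_cast h2
  omega

theorem strip_subset_lowerSlit (j : ℤ) : strip j ⊆ lowerSlit :=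
  fun _ hz => Or.inr (re_ne_int_of_mem_strip hz)

theorem strip_subset_upperSlit (j : ℤ) : strip j ⊆ upperSlit :=
  fun _ hz => Or.inr (re_ne_int_of_mem_strip hz)

theorem mem_strip_of_mem {z : ℂ} (h : z ∈ lowerSlit) (h' : z ∈ upperSlit) : z ∈ strip ⌊z.re⌋ :=
  ⟨lt_of_le_of_ne (Int.floor_le _) (re_ne_int_of_mem h h' _).symm, Int.lt_floor_add_one _⟩

theorem exists_mem_inter_lowerSlit (k : ℂ ≃ₜ ℂ) {O : Set ℂ} (hO : IsOpen O) (hne : O.Nonempty) :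
    ∃ z ∈ O, k z ∈ lowerSlit := by
  have hd : Dense lowerSlit := by
    refine Dense.mono (s₁ := Complex.re ⁻¹' (range ((↑) : ℤ → ℝ))ᶜ) ?_ ?_
    · intro z hz
      refine Or.inr fun n hn => hz ⟨n, hn.symm⟩
    · exact ((countable_range _).dense_compl ℝ).preimage Complex.isOpenMap_re
  obtain ⟨w, hw, hw'⟩ := hd.inter_open_nonempty (k '' O) (k.isOpenMap O hO) (hne.image k)
  obtain ⟨z, hz, rfl⟩ := hw
  exact ⟨z, hz, hw'⟩

theorem mem_closure_strip {j : ℤ} {z : ℂ} (h0 : (j : ℝ) ≤ z.re) (h1 : z.re ≤ j + 1) :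
    z ∈ closure (strip j) := by
  have : strip j = Complex.re ⁻¹' Ioo (j : ℝ) (j + 1) := rfl
  rw [this, ← Complex.isOpenMap_re.preimage_closure_eq_closure_preimage Complex.continuous_re,
    closure_Ioo (by simp)]
  exact ⟨h0, h1⟩

instance nhdsWithin_strip_neBot (j : ℤ) : (nhdsWithin (j : ℂ) (strip j)).NeBot :=
  mem_closure_iff_nhdsWithin_neBot.1 (mem_closure_strip (by simp) (by simp))

instance nhdsWithin_strip_neBot' (j : ℤ) : (nhdsWithin ((j + 1 : ℤ) : ℂ) (strip j)).NeBot :=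
  mem_closure_iff_nhdsWithin_neBot.1 (mem_closure_strip (by simp) (by simp))

instance nhdsWithin_lowerSlit_neBot (j : ℤ) : (nhdsWithin (j : ℂ) lowerSlit).NeBot :=
  Filter.NeBot.mono (nhdsWithin_strip_neBot j) (nhdsWithin_mono _ (strip_subset_lowerSlit j))

theorem Filter.Frequently.central_of_homotopy {M : Type*} {A B : Equiv.Perm M} {o : M}
    (h : B (A⁻¹ o) = o) {G : unitInterval × ℂ → ℂ} (hG : Continuous G)
    (hGm : ∀ t, ∀ z ∈ intCompl, G (t, z) ∈ intCompl) {j m : ℤ} (hGn : ∀ t, G (t, (j : ℂ)) = m)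
    {u v : unitInterval × ℂ → M} {W : Set ℂ} (hW : W ⊆ intCompl)
    (hWc : ∀ ε : ℝ, 0 < ε → ε ≤ 1 → IsPreconnected (W ∩ Metric.ball (j : ℂ) ε))
    (hs : IsSec (transPerm A B) (univ ×ˢ W) G u v) {t₀ : unitInterval}
    (h0 : ∃ᶠ z in nhdsWithin (j : ℂ) W, Central A B o m (G (t₀, z)) (u (t₀, z)) (v (t₀, z)))
    (t : unitInterval) :
    ∀ᶠ z in nhdsWithin (j : ℂ) W, Central A B o m (G (t, z)) (u (t, z)) (v (t, z)) := by
  obtain ⟨O, V, hO, hV, hO1, hV1, hOV⟩ := generalized_tube_lemma (isCompact_univ (X := unitInterval))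
    (isCompact_singleton (x := (j : ℂ)))
    (n := G ⁻¹' Metric.ball (m : ℂ) 1) (Metric.isOpen_ball.preimage hG)
    (by
      rintro ⟨t, z⟩ ⟨-, hz⟩
      have hz' : z = j := hz
      rw [hz']
      rw [mem_preimage, hGn]
      exact Metric.mem_ball_self one_pos)
  obtain ⟨ε, hε, hεV⟩ := Metric.isOpen_iff.1 hV j (hV1 rfl)
  have hε' : 0 < min ε 1 := lt_min hε one_pos
  have hball : ∀ᶠ z in nhdsWithin (j : ℂ) W, z ∈ W ∩ Metric.ball (j : ℂ) (min ε 1) :=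
    Filter.inter_mem self_mem_nhdsWithin (mem_nhdsWithin_of_mem_nhds (Metric.ball_mem_nhds _ hε'))
  obtain ⟨z₀, hz₀, hz₀'⟩ := (h0.and_eventually hball).exists
  filter_upwards [hball] with z hz
  have hsub : univ ×ˢ (W ∩ Metric.ball (j : ℂ) (min ε 1)) ⊆ (univ : Set unitInterval) ×ˢ W :=
    Set.prod_mono Subset.rfl inter_subset_left
  have hm : MapsTo G (univ ×ˢ (W ∩ Metric.ball (j : ℂ) (min ε 1))) (Metric.ball (m : ℂ) 1) := by
    rintro ⟨t, z⟩ hz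
    exact hOV ⟨hO1 trivial, hεV (Metric.ball_subset_ball (min_le_left _ _) hz.2.2)⟩
  exact (hs.mono hsub).central h (isPreconnected_univ.prod (hWc _ hε' (min_le_right _ _)))
    hG.continuousOn (fun p hp => hGm p.1 p.2 (hW hp.2.1)) hm (w₀ := (t₀, z₀)) ⟨trivial, hz₀'⟩ hz₀
    (w := (t, z)) ⟨trivial, hz⟩

theorem Filter.Frequently.central {M : Type*} {A B : Equiv.Perm M} {o : M}
    (h : B (A⁻¹ o) = o) {k : ℂ → ℂ} (hkc : Continuous k) (hkm : ∀ z ∈ intCompl, k z ∈ intCompl)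
    {j m : ℤ} (hkn : k j = m) {u v : ℂ → M} {W : Set ℂ} (hW : W ⊆ intCompl)
    (hWc : ∀ ε : ℝ, 0 < ε → ε ≤ 1 → IsPreconnected (W ∩ Metric.ball (j : ℂ) ε))
    (hs : IsSec (transPerm A B) W k u v)
    (h0 : ∃ᶠ z in nhdsWithin (j : ℂ) W, Central A B o m (k z) (u z) (v z)) :
    ∀ᶠ z in nhdsWithin (j : ℂ) W, Central A B o m (k z) (u z) (v z) :=
  Filter.Frequently.central_of_homotopy (G := k ∘ Prod.snd) (u := u ∘ Prod.snd) (v := v ∘ Prod.snd)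
    (t₀ := 0) h (hkc.comp continuous_snd) (fun _ => hkm) (fun _ => hkn) hW hWc
    (hs.comp continuous_snd.continuousOn fun _ hp => hp.2) h0 0

section

variable {M : Type*} {A B : Equiv.Perm M} {o : M}

theorem add_one_mem_lowerSlit {z : ℂ} : z + 1 ∈ lowerSlit ↔ z ∈ lowerSlit := by
  simp only [lowerSlit, mem_ofPred_eq, Complex.add_im, Complex.one_im, add_zero, Complex.add_re,
    Complex.one_re]
  refine or_congr_right ⟨fun h n hn => h (n + 1) (by simp [hn]), fun h n hn => h (n - 1) ?_⟩
  push_cast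
  linarith

theorem add_one_mem_upperSlit {z : ℂ} : z + 1 ∈ upperSlit ↔ z ∈ upperSlit := by
  rw [← conj_mem_lowerSlit, map_add, map_one, add_one_mem_lowerSlit, conj_mem_lowerSlit]

theorem IsSec.add_one {Y : Type*} [TopologicalSpace Y] {W : Set Y} {φ : Y → ℂ} {u v : Y → M}
    (hs : IsSec (transPerm A B) W φ u v) :
    IsSec (transPerm A B) W (fun w => φ w + 1) (A ∘ u) (B ∘ v) where
  left w hw h := (hs.left w hw (add_one_mem_lowerSlit.1 h)).mono fun _ h => congrArg A h
  right w hw h := (hs.right w hw (add_one_mem_upperSlit.1 h)).mono fun _ h => congrArg B h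
  compat w hw h1 h2 := by
    simp only [Function.comp_apply, Complex.add_re, Complex.one_re, Int.floor_add_one,
      transPerm_succ_apply, hs.compat w hw (add_one_mem_lowerSlit.1 h1) (add_one_mem_upperSlit.1 h2)]

theorem central_add_one_iff {j : ℤ} {z : ℂ} {u v : M} :
    Central A B o (j + 1) (z + 1) (A u) (B v) ↔ Central A B o j z u v := by
  simp only [Central, Agree, add_one_mem_lowerSlit, add_one_mem_upperSlit, add_comm j 1, zpow_add,
    zpow_one, Equiv.Perm.mul_apply, EmbeddingLike.apply_eq_iff_eq]

theorem tendsto_add_one_nhdsWithin (j : ℤ) : Filter.Tendsto (· + (1 : ℂ))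
    (nhdsWithin (j : ℂ) lowerSlit) (nhdsWithin ((j + 1 : ℤ) : ℂ) lowerSlit) := by
  refine tendsto_nhdsWithin_iff.2 ⟨?_, ?_⟩
  · push_cast
    exact ((continuous_add_const (1 : ℂ)).tendsto _).mono_left nhdsWithin_le_nhds
  · filter_upwards [self_mem_nhdsWithin] with z hz
    exact add_one_mem_lowerSlit.2 hz

end

theorem Agree.symm {M : Type*} {z : ℂ} {u v u' v' : M} (h : Agree z u v u' v') :
    Agree z u' v' u v :=
  ⟨fun hz => (h.1 hz).symm, fun hz => (h.2 hz).symm⟩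

theorem Agree.trans {M : Type*} {z : ℂ} {u v u' v' u'' v'' : M} (h : Agree z u v u' v')
    (h' : Agree z u' v' u'' v'') : Agree z u v u'' v'' :=
  ⟨fun hz => (h.1 hz).trans (h'.1 hz), fun hz => (h.2 hz).trans (h'.2 hz)⟩

theorem isPreconnected_lowerSlit : IsPreconnected lowerSlit := by
  have := contractibleSpace_lowerSlit
  exact isPreconnected_iff_preconnectedSpace.2 inferInstance

theorem map_mem_intCompl {k : ℂ → ℂ} (hi : Function.Injective k) (hk : ∀ n : ℤ, k n = n) {z : ℂ}
    (hz : z ∈ intCompl) : k z ∈ intCompl :=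
  fun n h => hz n (hi (h.trans (hk n).symm))

/-- The data of an isotopy, relative to the integers, from `k ∘ (· + 1)` to `k + 1`. -/
structure IsShiftIsotopy (k : ℂ → ℂ) (G : unitInterval × ℂ → ℂ) : Prop where
  continuous : Continuous G
  mapsTo : ∀ t, ∀ z ∈ intCompl, G (t, z) ∈ intCompl
  apply_int : ∀ t (n : ℤ), G (t, n) = n + 1
  zero : ∀ z, G (0, z) = k (z + 1)
  one : ∀ z, G (1, z) = k z + 1

theorem eventually_central {M : Type*} {A B : Equiv.Perm M} {o : M} (h : B (A⁻¹ o) = o) {k : ℂ ≃ₜ ℂ}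
    (hk : ∀ n : ℤ, k n = n) {G : unitInterval × ℂ → ℂ} (hG : IsShiftIsotopy k G) {u v : ℂ → M}
    (hs : IsSec (transPerm A B) lowerSlit k u v)
    (h0 : ∀ᶠ z in nhdsWithin ((0 : ℤ) : ℂ) lowerSlit, Central A B o 0 (k z) (u z) (v z))
    (h1 : ∀ᶠ z in nhdsWithin ((1 : ℤ) : ℂ) lowerSlit, Central A B o 1 (k z) (u z) (v z)) (j : ℤ) :
    ∀ᶠ z in nhdsWithin (j : ℂ) lowerSlit, Central A B o j (k z) (u z) (v z) := by
  have hkm : ∀ z ∈ intCompl, k z ∈ intCompl := fun z => map_mem_intCompl k.injective hk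
  have := contractibleSpace_lowerSlit
  have : LocallyPathConnectedSpace lowerSlit := isOpen_lowerSlit.locallyPathConnectedSpace
  have : ContractibleSpace unitInterval := (convex_Icc (0 : ℝ) 1).contractibleSpace ⟨0, by simp⟩
  have : LocallyPathConnectedSpace unitInterval := (convex_Icc (0 : ℝ) 1).locallyPathConnectedSpace
  let e := Homeomorph.Set.prod (univ : Set unitInterval) lowerSlit
  let e' := (Homeomorph.Set.univ unitInterval).prodCongr (Homeomorph.refl lowerSlit)
  have : SimplyConnectedSpace ((univ : Set unitInterval) ×ˢ lowerSlit : Set (unitInterval × ℂ)) := by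
    have := (e.trans e').contractibleSpace
    infer_instance
  have : LocallyPathConnectedSpace ((univ : Set unitInterval) ×ˢ lowerSlit : Set (unitInterval × ℂ)) :=
    (e.trans e').isOpenEmbedding.locallyPathConnectedSpace
  obtain ⟨z₀, hz₀, hkz₀⟩ := exists_mem_inter_lowerSlit ((Homeomorph.addRight (1 : ℂ)).trans k)
    isOpen_lowerSlit ⟨-Complex.I, Or.inl (by simp)⟩
  obtain ⟨p, q, hS, hp⟩ := exists_isSec (transPerm A B) ((univ : Set unitInterval) ×ˢ lowerSlit)
    hG.continuous.continuousOn (fun w hw => hG.mapsTo w.1 w.2 (lowerSlit_subset hw.2))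
    (w₀ := (0, z₀)) ⟨trivial, hz₀⟩ (by rw [hG.zero]; exact hkz₀) (u (z₀ + 1))
  have hSt : ∀ t, IsSec (transPerm A B) lowerSlit (fun z => G (t, z)) (fun z => p (t, z))
      (fun z => q (t, z)) := fun t =>
    hS.comp (g := fun z => (t, z)) (by fun_prop) fun z hz => ⟨trivial, hz⟩
  have hGt : ∀ t, Continuous fun z => G (t, z) := fun t => hG.continuous.comp (by fun_prop)
  have hs1 : IsSec (transPerm A B) lowerSlit (fun z => G (0, z)) (fun z => u (z + 1))
      (fun z => v (z + 1)) :=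
    (hs.comp (g := (· + 1)) (by fun_prop) fun z hz => add_one_mem_lowerSlit.2 hz).congr_map
      fun z _ => hG.zero z
  have ag0 : ∀ z ∈ lowerSlit, Agree (G (0, z)) (p (0, z)) (q (0, z)) (u (z + 1)) (v (z + 1)) :=
    fun z hz => (hSt 0).agree hs1 isPreconnected_lowerSlit (hGt 0).continuousOn
      (fun z hz => hG.mapsTo 0 z (lowerSlit_subset hz)) hz₀
      ((hSt 0).agree_of_left hs1 hz₀ (by rw [hG.zero]; exact hkz₀) hp) hz
  have F0 : ∀ j : ℤ, (∀ᶠ z in nhdsWithin ((j + 1 : ℤ) : ℂ) lowerSlit,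
      Central A B o (j + 1) (k z) (u z) (v z)) → ∀ᶠ z in nhdsWithin (j : ℂ) lowerSlit,
      Central A B o (j + 1) (G (0, z)) (p (0, z)) (q (0, z)) := by
    intro j hj
    filter_upwards [(tendsto_add_one_nhdsWithin j).eventually hj, self_mem_nhdsWithin] with z hz hz'
    refine (ag0 z hz').trans ?_
    rw [hG.zero]
    exact hz
  have F0' : ∀ j : ℤ, (∀ᶠ z in nhdsWithin (j : ℂ) lowerSlit,
      Central A B o (j + 1) (G (0, z)) (p (0, z)) (q (0, z))) →
      ∀ᶠ z in nhdsWithin ((j + 1 : ℤ) : ℂ) lowerSlit,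
      Central A B o (j + 1) (k z) (u z) (v z) := by
    intro j hj
    refine Filter.Frequently.central h k.continuous hkm (hk _) lowerSlit_subset
      (fun ε => isPreconnected_lowerSlit_inter_ball _) hs ?_
    refine (tendsto_add_one_nhdsWithin j).frequently (Filter.Eventually.frequently ?_)
    filter_upwards [hj, self_mem_nhdsWithin] with z hz hz'
    rw [← hG.zero]
    exact (ag0 z hz').symm.trans hz
  have tr : ∀ (j : ℤ) (t₀ t : unitInterval), (∀ᶠ z in nhdsWithin (j : ℂ) lowerSlit,
      Central A B o (j + 1) (G (t₀, z)) (p (t₀, z)) (q (t₀, z))) →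
      ∀ᶠ z in nhdsWithin (j : ℂ) lowerSlit,
      Central A B o (j + 1) (G (t, z)) (p (t, z)) (q (t, z)) := by
    intro j t₀ t hj
    exact Filter.Frequently.central_of_homotopy h hG.continuous hG.mapsTo
      (fun t => by rw [hG.apply_int]; push_cast; rfl) lowerSlit_subset
      (fun ε => isPreconnected_lowerSlit_inter_ball _) hS hj.frequently t
  have hs2 : IsSec (transPerm A B) lowerSlit (fun z => G (1, z)) (A ∘ u) (B ∘ v) :=
    hs.add_one.congr_map fun z _ => hG.one z
  have ag1 : ∀ z ∈ lowerSlit, Agree (G (1, z)) (p (1, z)) (q (1, z)) (A (u z)) (B (v z)) := by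
    intro z hz
    obtain ⟨w, hw1, hw2, hw3⟩ := ((tr 0 0 1 (F0 0 h1)).and (h0.and self_mem_nhdsWithin)).exists
    refine (hSt 1).agree hs2 isPreconnected_lowerSlit (hGt 1).continuousOn
      (fun z hz => hG.mapsTo 1 z (lowerSlit_subset hz)) hw3 (hw1.trans (Agree.symm ?_)) hz
    rw [hG.one]
    exact central_add_one_iff.2 hw2
  have step : ∀ j : ℤ, (∀ᶠ z in nhdsWithin ((j + 1 : ℤ) : ℂ) lowerSlit,
      Central A B o (j + 1) (k z) (u z) (v z)) ↔
      ∀ᶠ z in nhdsWithin (j : ℂ) lowerSlit, Central A B o j (k z) (u z) (v z) := by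
    intro j
    constructor
    · intro hj
      filter_upwards [tr j 0 1 (F0 j hj), self_mem_nhdsWithin] with z hz hz'
      rw [← central_add_one_iff, ← hG.one]
      exact (ag1 z hz').symm.trans hz
    · intro hj
      refine F0' j (tr j 1 0 ?_)
      filter_upwards [hj, self_mem_nhdsWithin] with z hz hz'
      refine (ag1 z hz').trans ?_
      rw [hG.one]
      exact central_add_one_iff.2 hz
  induction j using Int.induction_on with
  | zero => exact h0
  | succ n ih => exact (step n).2 ih
  | pred n ih =>
    have := step (-(n : ℤ) - 1)
    rw [sub_add_cancel] at this
    exact this.1 ih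

theorem apply_eq_self_of_central {M : Type*} {A B : Equiv.Perm M} {o : M} (h : B (A⁻¹ o) = o)
    {k : ℂ ≃ₜ ℂ} (hk : ∀ n : ℤ, k n = n) {u v : ℂ → M}
    (hs : IsSec (transPerm A B) lowerSlit k u v)
    (hC : ∀ j : ℤ, ∀ᶠ z in nhdsWithin (j : ℂ) lowerSlit, Central A B o j (k z) (u z) (v z)) :
    A o = o := by
  have hkm : ∀ z ∈ intCompl, k z ∈ intCompl := fun z => map_mem_intCompl k.injective hk
  have := contractibleSpace_upperSlit
  have : LocallyPathConnectedSpace upperSlit := isOpen_upperSlit.locallyPathConnectedSpace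
  obtain ⟨z₀, hz₀, hkz₀⟩ := exists_mem_inter_lowerSlit k (isOpen_strip 0)
    ⟨(1 / 2 : ℝ), by simp [strip]; norm_num⟩
  obtain ⟨u', v', hs', hu'⟩ := exists_isSec (transPerm A B) upperSlit k.continuous.continuousOn
    (fun w hw => hkm w (upperSlit_subset hw)) (strip_subset_upperSlit 0 hz₀) hkz₀ (u z₀)
  have pt : ∀ j : ℤ, ∀ z₁ ∈ strip j, Agree (k z₁) (u z₁) (v z₁) (u' z₁) (v' z₁) →
      ∀ z ∈ strip j, Agree (k z) (u z) (v z) (u' z) (v' z) := fun j z₁ hz₁ h1 z hz =>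
    (hs.mono (strip_subset_lowerSlit j)).agree (hs'.mono (strip_subset_upperSlit j))
      (convex_strip j).isPreconnected k.continuous.continuousOn
      (fun z hz => hkm z (lowerSlit_subset (strip_subset_lowerSlit j hz))) hz₁ h1 hz
  have near : ∀ i j : ℤ, (nhdsWithin (i : ℂ) (strip j)).NeBot →
      (∀ z ∈ strip j, Agree (k z) (u z) (v z) (u' z) (v' z)) →
      ∀ᶠ z in nhdsWithin (i : ℂ) upperSlit, Central A B o i (k z) (u' z) (v' z) := by
    intro i j hne hj
    refine Filter.Frequently.central h k.continuous hkm (hk _) upperSlit_subset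
      (fun ε => isPreconnected_upperSlit_inter_ball _) hs' ?_
    refine Filter.Frequently.filter_mono (Filter.Eventually.frequently ?_)
      (nhdsWithin_mono _ (strip_subset_upperSlit j))
    filter_upwards [(hC i).filter_mono (nhdsWithin_mono _ (strip_subset_lowerSlit j)),
      self_mem_nhdsWithin] with z h1 h2
    exact (hj z h2).symm.trans h1
  have far : ∀ i j : ℤ, (nhdsWithin (i : ℂ) (strip j)).NeBot →
      (∀ᶠ z in nhdsWithin (i : ℂ) upperSlit, Central A B o i (k z) (u' z) (v' z)) →
      ∀ z ∈ strip j, Agree (k z) (u z) (v z) (u' z) (v' z) := by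
    intro i j hne hj
    obtain ⟨z, h1, h2, h3⟩ := (((hC i).filter_mono (nhdsWithin_mono _ (strip_subset_lowerSlit j))).and
      ((hj.filter_mono (nhdsWithin_mono _ (strip_subset_upperSlit j))).and self_mem_nhdsWithin)).exists
    exact pt j z h3 (h1.trans h2.symm)
  have hD : ∀ j : ℤ, ∀ z ∈ strip j, Agree (k z) (u z) (v z) (u' z) (v' z) := by
    intro j
    induction j using Int.induction_on with
    | zero =>
      exact pt 0 z₀ hz₀ ((hs.mono (strip_subset_lowerSlit 0)).agree_of_left
        (hs'.mono (strip_subset_upperSlit 0)) hz₀ hkz₀ hu'.symm)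
    | succ n ih => exact far _ _ (nhdsWithin_strip_neBot _) (near _ _ (nhdsWithin_strip_neBot' n) ih)
    | pred n ih =>
      refine far (-(n : ℤ)) _ ?_ (near _ _ (nhdsWithin_strip_neBot _) ih)
      have := nhdsWithin_strip_neBot' (-(n : ℤ) - 1)
      rwa [sub_add_cancel] at this
  have hC' : ∀ j : ℤ, ∀ᶠ z in nhdsWithin (j : ℂ) upperSlit, Central A B o j (k z) (u' z) (v' z) :=
    fun j => near j j (nhdsWithin_strip_neBot j) (hD j)
  classical
  let U : ℂ → M := fun z => if z ∈ lowerSlit then u z else u' z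
  have hU : ∀ z ∈ upperSlit, k z ∈ lowerSlit → U z = u' z := by
    intro z hz hkz
    by_cases hz' : z ∈ lowerSlit
    · simp only [U, if_pos hz']
      exact (hD _ z (mem_strip_of_mem hz' hz)).1 hkz
    · simp [U, hz']
  have hU' : ∀ z ∈ lowerSlit, U z = u z := fun z hz => if_pos hz
  have hsymm : ∀ n : ℤ, k.symm n = n := fun n => by rw [k.symm_apply_eq, hk]
  have hloc : ∀ w ∈ lowerSlit, ∀ᶠ w' in nhdsWithin w lowerSlit, U (k.symm w') = U (k.symm w) := by
    intro w hw
    have hw' : k (k.symm w) ∈ lowerSlit := by simpa using hw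
    have hn : ∀ᶠ w' in nhdsWithin w lowerSlit, k (k.symm w') ∈ lowerSlit := by
      filter_upwards [self_mem_nhdsWithin] with w' h
      simpa using h
    rcases mem_lowerSlit_or_mem_upperSlit
      (map_mem_intCompl k.symm.injective hsymm (lowerSlit_subset hw)) with h1 | h1
    · have e := hs.left _ h1 hw'
      rw [isOpen_lowerSlit.nhdsWithin_eq h1] at e
      filter_upwards [(k.symm.continuous.tendsto w).mono_left nhdsWithin_le_nhds |>.eventually
        (e.and (isOpen_lowerSlit.mem_nhds h1))] with w' h2
      rw [hU' _ h2.2, hU' _ h1, h2.1]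
    · have e := hs'.left _ h1 hw'
      rw [isOpen_upperSlit.nhdsWithin_eq h1] at e
      filter_upwards [(k.symm.continuous.tendsto w).mono_left nhdsWithin_le_nhds |>.eventually
        (e.and (isOpen_upperSlit.mem_nhds h1)), hn] with w' h2 h3
      rw [hU _ h2.2 h3, hU _ h1 hw', h2.1]
  have hconst : ∀ w ∈ lowerSlit, ∀ w' ∈ lowerSlit, U (k.symm w) = U (k.symm w') := by
    intro w hw w' hw'
    refine isPreconnected_lowerSlit.induction₂' (fun x y => U (k.symm x) = U (k.symm y)) ?_ ?_ hw hw'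
    · intro x hx
      filter_upwards [hloc x hx] with y hy
      exact ⟨hy.symm, hy⟩
    · intro x y z _ _ _ h1 h2
      exact h1.trans h2
  have hval : ∀ j : ℤ, ∃ w ∈ lowerSlit, U (k.symm w) = (A ^ j) o := by
    intro j
    have ht : Filter.Tendsto k.symm (nhdsWithin (j : ℂ) lowerSlit) (nhds (j : ℂ)) := by
      have := (k.symm.continuous.tendsto (j : ℂ)).mono_left (nhdsWithin_le_nhds (s := lowerSlit))
      rwa [hsymm] at this
    obtain ⟨w, ⟨h1, h2⟩, h3⟩ := ((ht.eventually ((eventually_nhdsWithin_iff.1 (hC j)).and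
      (eventually_nhdsWithin_iff.1 (hC' j)))).and self_mem_nhdsWithin).exists
    have h4 : k (k.symm w) ∈ lowerSlit := by
      rw [k.apply_symm_apply]
      exact h3
    refine ⟨w, h3, ?_⟩
    rcases mem_lowerSlit_or_mem_upperSlit
      (map_mem_intCompl k.symm.injective hsymm (lowerSlit_subset h3)) with h5 | h5
    · rw [hU' _ h5]
      exact (h1 h5).1 h4
    · rw [hU _ h5 h4]
      exact (h2 h5).1 h4
  obtain ⟨w, hw, e⟩ := hval 0
  obtain ⟨w', hw', e'⟩ := hval 1
  rw [hconst w hw w' hw', e'] at e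
  simpa using e

/-- The affine permutation `v ↦ a * v + b`. -/
def affPerm {R : Type*} [CommRing R] (a : Rˣ) (b : R) : Equiv.Perm R where
  toFun v := a * v + b
  invFun v := ↑a⁻¹ * (v - b)
  left_inv v := by simp
  right_inv v := by simp

theorem affPerm_apply {R : Type*} [CommRing R] (a : Rˣ) (b v : R) : affPerm a b v = a * v + b := rfl

theorem affPerm_inv_zero {R : Type*} [CommRing R] (x t : Rˣ) :
    affPerm (x * t) (x : R) ((affPerm t (1 : R))⁻¹ 0) = 0 := by
  have : (affPerm t (1 : R))⁻¹ 0 = -↑t⁻¹ := by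
    rw [Equiv.Perm.inv_eq_iff_eq, affPerm_apply]
    simp
  rw [this, affPerm_apply]
  simp [mul_assoc]

theorem map_affPerm {R S : Type*} [CommRing R] [CommRing S] (f : R →+* S) (a : Rˣ) (b v : R) :
    f (affPerm a b v) = affPerm (Units.map (f : R →* S) a) (f b) (f v) := by
  simp [affPerm_apply]

/-- The transition permutations of the local system of affine lines over `R` with parameters
`x` and `t`. -/
abbrev affTrans {R : Type*} [CommRing R] (x t : Rˣ) : ℤ → Equiv.Perm R :=
  transPerm (affPerm t 1) (affPerm (x * t) x)

theorem map_affTrans {R S : Type*} [CommRing R] [CommRing S] (f : R →+* S) (x t : Rˣ) (n : ℤ)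
    (v : R) : f (affTrans x t n v) =
      affTrans (Units.map (f : R →* S) x) (Units.map (f : R →* S) t) n (f v) := by
  refine transPerm_semiconj (fun v => ?_) (fun v => ?_) n v
  · rw [map_affPerm, map_one]
  · rw [map_affPerm, map_mul]
    rfl

theorem isUnit_sub_one_of_isSec {R : Type*} [CommRing R] {x t : Rˣ} {k : ℂ ≃ₜ ℂ}
    (hk : ∀ n : ℤ, k n = n) {G : unitInterval × ℂ → ℂ} (hG : IsShiftIsotopy k G) {u v : ℂ → R}
    (hs : IsSec (affTrans x t) lowerSlit k u v) {ε : ℝ} (hε : 0 < ε) (hε1 : ε ≤ 1)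
    (hk0 : MapsTo k (Metric.ball 0 ε) (Metric.ball 0 1))
    (hk1 : MapsTo k (Metric.ball 1 ε) (Metric.ball 1 1)) {z₀ z₁ : ℂ} (hz₀ : z₀ ∈ lowerSlit)
    (hz₀' : z₀ ∈ Metric.ball 0 ε) (hkz₀ : k z₀ ∈ lowerSlit) (hz₁ : z₁ ∈ lowerSlit)
    (hz₁' : z₁ ∈ Metric.ball 1 ε) (hkz₁ : k z₁ ∈ lowerSlit) (h0 : u z₀ = 0) :
    IsUnit (u z₁ - 1) := by
  let I := Ideal.span {u z₁ - 1}
  let f : R →+* R ⧸ I := Ideal.Quotient.mk I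
  let x' := Units.map (f : R →* R ⧸ I) x
  let t' := Units.map (f : R →* R ⧸ I) t
  have hs' : IsSec (affTrans x' t') lowerSlit k (f ∘ u) (f ∘ v) := hs.map f (map_affTrans f x t)
  have hkm : ∀ z ∈ lowerSlit, k z ∈ intCompl :=
    fun z hz => map_mem_intCompl k.injective hk (lowerSlit_subset hz)
  have ev : ∀ (j : ℤ) (z : ℂ), MapsTo k (Metric.ball j ε) (Metric.ball j 1) → z ∈ lowerSlit →
      z ∈ Metric.ball (j : ℂ) ε → k z ∈ lowerSlit → f (u z) = (affPerm t' 1 ^ j) 0 →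
      ∀ᶠ z in nhdsWithin (j : ℂ) lowerSlit,
        Central (affPerm t' 1) (affPerm (x' * t') x') 0 j (k z) ((f ∘ u) z) ((f ∘ v) z) := by
    intro j z hj hz hz' hkz e
    have hc : Central (affPerm t' 1) (affPerm (x' * t') x') 0 j (k z) ((f ∘ u) z) ((f ∘ v) z) :=
      (hs'.mono inter_subset_left).agree_of_left
        (isSec_const (affPerm_inv_zero x' t') fun z (hz : z ∈ lowerSlit ∩ Metric.ball j ε) => hj hz.2)
        ⟨hz, hz'⟩ hkz e
    filter_upwards [Filter.inter_mem self_mem_nhdsWithin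
      (mem_nhdsWithin_of_mem_nhds (Metric.ball_mem_nhds (j : ℂ) hε))] with w hw
    exact (hs'.mono inter_subset_left).central (affPerm_inv_zero x' t')
      (isPreconnected_lowerSlit_inter_ball j hε hε1) k.continuous.continuousOn
      (fun z hz => hkm z hz.1) (fun z hz => hj hz.2) ⟨hz, hz'⟩ hc hw
  have hA1 : affPerm t' 1 (0 : R ⧸ I) = 1 := by simp [affPerm_apply]
  have e : (1 : R ⧸ I) = 0 := by
    rw [← hA1]
    refine apply_eq_self_of_central (affPerm_inv_zero x' t') hk hs' ?_
    refine eventually_central (affPerm_inv_zero x' t') hk hG hs' ?_ ?_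
    · exact ev 0 z₀ (by simpa using hk0) hz₀ (by simpa using hz₀') hkz₀ (by simp [h0])
    · refine ev 1 z₁ (by simpa using hk1) hz₁ (by simpa using hz₁') hkz₁ ?_
      rw [zpow_one, hA1, ← map_one f]
      exact Ideal.Quotient.eq.2 (Ideal.mem_span_singleton_self _)
  have h1 : (1 : R) ∈ I := by
    rw [← Ideal.Quotient.eq_zero_iff_mem, map_one]
    exact e
  exact isUnit_of_dvd_one (Ideal.mem_span_singleton.1 h1)

open LaurentPolynomial in
theorem LaurentPolynomial.exists_eq_C_mul_T_of_isUnit {K : Type*} [Field K] {R : K[T;T⁻¹]}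
    (h : IsUnit R) : ∃ (c : K) (l : ℤ), R = C c * T l := by
  obtain ⟨S, hS⟩ := h.exists_right_inv
  obtain ⟨n, f, hf⟩ := LaurentPolynomial.exists_T_pow R
  obtain ⟨m, g, hg⟩ := LaurentPolynomial.exists_T_pow S
  have hfg : f * g = Polynomial.X ^ (n + m) := by
    apply Polynomial.toLaurent_injective
    rw [map_mul, hf, hg, map_pow, Polynomial.toLaurent_X, T_pow]
    rw [show R * T n * (S * T m) = R * S * (T n * T m) by ring, hS, ← T_add]
    simp
  obtain ⟨i, -, hi⟩ := (dvd_prime_pow Polynomial.prime_X _).1 ⟨g, hfg.symm⟩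
  obtain ⟨w, hw⟩ := hi.symm
  obtain ⟨c, -, hc⟩ := Polynomial.isUnit_iff.1 w.isUnit
  refine ⟨c, i - n, ?_⟩
  have h1 : R = Polynomial.toLaurent f * T (-n) := by
    rw [hf, mul_assoc, ← T_add]
    simp
  rw [h1, ← hw, ← hc, map_mul, map_pow, Polynomial.toLaurent_X, Polynomial.toLaurent_C, T_pow,
    sub_eq_add_neg, T_add]
  simp only [mul_one]
  ring

theorem zpow_apply_eq {M : Type*} {A : Equiv.Perm M} {p : ℤ → M} (h : ∀ j, A (p j) = p (j + 1))
    (j : ℤ) : (A ^ j) (p 0) = p j := by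
  induction j using Int.induction_on with
  | zero => simp
  | succ n ih => rw [add_comm, zpow_add, zpow_one, Equiv.Perm.mul_apply, ih, h, add_comm]
  | pred n ih =>
    rw [sub_eq_neg_add, zpow_add, zpow_neg_one, Equiv.Perm.mul_apply, ih, Equiv.Perm.inv_eq_iff_eq, h]
    congr 1
    ring

theorem affPerm_zpow_apply {R : Type*} [CommRing R] (a : Rˣ) (b v : R) (m : ℤ) :
    (affPerm a b ^ m) v = ↑(a ^ m) * v + (affPerm a b ^ m) 0 := by
  have hinv : ∀ v, (affPerm a b)⁻¹ v = ↑a⁻¹ * (v - b) := fun v => rfl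
  induction m using Int.induction_on generalizing v with
  | zero => simp
  | succ n ih =>
    rw [zpow_add_one, Equiv.Perm.mul_apply, ih, Equiv.Perm.mul_apply, ih (affPerm a b 0),
      affPerm_apply, affPerm_apply, zpow_add_one, Units.val_mul]
    ring
  | pred n ih =>
    rw [zpow_sub_one, Equiv.Perm.mul_apply, ih, Equiv.Perm.mul_apply, ih ((affPerm a b)⁻¹ 0),
      hinv, hinv, zpow_sub_one, Units.val_mul]
    ring

theorem affTrans_apply_eq {R : Type*} [CommRing R] (x t : Rˣ) (m : ℤ) (v : R) :
    affTrans x t m v =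
      affTrans x t (m - 1) ((affPerm t 1 ^ m) 0 + x * (v - (affPerm t 1 ^ m) 0)) := by
  have h0 : ∀ (e : Equiv.Perm R) (w : R), e⁻¹ (e w) = w := fun e w => e.symm_apply_apply w
  have h1 : affTrans x t m = affTrans x t (m - 1) * (affPerm t (1 : R) ^ m) *
      (affPerm (x * t) (x : R) * (affPerm t 1)⁻¹) * (affPerm t 1 ^ m)⁻¹ := by
    simp only [affTrans, transPerm, sub_add_cancel]
    group
  have h2 : ∀ w, (affPerm (x * t) (x : R) * (affPerm t 1)⁻¹) w = x * w := by
    intro w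
    obtain ⟨w, rfl⟩ := (affPerm t (1 : R)).surjective w
    rw [Equiv.Perm.mul_apply, h0, affPerm_apply, affPerm_apply, Units.val_mul]
    ring
  obtain ⟨w, rfl⟩ := (affPerm t (1 : R) ^ m).surjective v
  rw [h1]
  simp only [Equiv.Perm.mul_apply, h0]
  congr 1
  have h3 := h2 w
  rw [Equiv.Perm.mul_apply] at h3
  rw [h3, affPerm_zpow_apply, affPerm_zpow_apply t 1 w]
  ring

/-- The infinitesimal unit `1 + ε`. -/
noncomputable def dualUnit : (DualNumber ℂ)ˣ where
  val := 1 + DualNumber.eps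
  inv := 1 - DualNumber.eps
  val_inv := by ring_nf; simp [pow_two]
  inv_val := by ring_nf; simp [pow_two]

/-- The constant unit of the dual numbers. -/
noncomputable def dualConst (t : ℂˣ) : (DualNumber ℂ)ˣ :=
  Units.map (algebraMap ℂ (DualNumber ℂ) : ℂ →* DualNumber ℂ) t

theorem affPerm_zpow_zero {t : ℂˣ} (ht : (t : ℂ) ≠ 1) (j : ℤ) :
    (affPerm t (1 : ℂ) ^ j) 0 = ((t : ℂ) ^ j - 1) / (t - 1) := by
  have ht' : (t : ℂ) - 1 ≠ 0 := sub_ne_zero.2 ht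
  have := zpow_apply_eq (A := affPerm t (1 : ℂ)) (p := fun j => ((t : ℂ) ^ j - 1) / (t - 1)) ?_ j
  · simpa using this
  · intro j
    rw [affPerm_apply, zpow_add_one₀ t.ne_zero]
    field_simp
    ring

theorem dual_zpow_zero {t : ℂˣ} (ht : (t : ℂ) ≠ 1) (j : ℤ) :
    (affPerm (dualConst t) (1 : DualNumber ℂ) ^ j) 0 =
      TrivSqZeroExt.inl (((t : ℂ) ^ j - 1) / (t - 1)) := by
  rw [← affPerm_zpow_zero ht]
  have := zpow_semiconj (A := affPerm t (1 : ℂ)) (A' := affPerm (dualConst t) (1 : DualNumber ℂ))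
    (f := algebraMap ℂ (DualNumber ℂ)) (fun v => by rw [map_affPerm, map_one]; rfl) j 0
  rw [map_zero (algebraMap ℂ (DualNumber ℂ))] at this
  exact this.symm

theorem dual_affTrans_inr {t : ℂˣ} (ht : (t : ℂ) ≠ 1) {P : ℤ → ℂ} (hP0 : P (-1) = 0)
    (hP : ∀ m, P m = P (m - 1) + ((t : ℂ) ^ m - 1) / (t - 1)) (m : ℤ) (y : ℂ) :
    affTrans dualUnit (dualConst t) m (TrivSqZeroExt.inr y) = TrivSqZeroExt.inr (y - P m) := by
  have key : ∀ m y, affTrans dualUnit (dualConst t) m (TrivSqZeroExt.inr y) =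
      affTrans dualUnit (dualConst t) (m - 1)
        (TrivSqZeroExt.inr (y - ((t : ℂ) ^ m - 1) / (t - 1))) := by
    intro m y
    rw [affTrans_apply_eq, dual_zpow_zero ht]
    congr 1
    ext <;> simp [dualUnit]
    ring
  have base : ∀ y : ℂ, affTrans dualUnit (dualConst t) (-1) (TrivSqZeroExt.inr y) =
      TrivSqZeroExt.inr (y - P (-1)) := by
    intro y
    simp [affTrans, transPerm, hP0]
  suffices h : ∀ n : ℤ, ∀ y : ℂ, affTrans dualUnit (dualConst t) (n - 1) (TrivSqZeroExt.inr y) =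
      TrivSqZeroExt.inr (y - P (n - 1)) by
    have := h (m + 1) y
    rwa [add_sub_cancel_right] at this
  intro n
  induction n using Int.induction_on with
  | zero => simpa using base
  | succ n ih =>
    intro y
    rw [add_sub_cancel_right, key, ih, hP n]
    congr 1
    ring
  | pred n ih =>
    intro y
    have h1 := key (-(n : ℤ) - 1) (y + ((t : ℂ) ^ (-(n : ℤ) - 1) - 1) / (t - 1))
    rw [add_sub_cancel_right, ih] at h1
    rw [← h1, hP (-(n : ℤ) - 1)]
    congr 1
    ring

theorem exists_primitive {t : ℂˣ} (ht : (t : ℂ) ≠ 1) : ∃ P : ℤ → ℂ, P (-1) = 0 ∧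
    ∀ m, P m = P (m - 1) + ((t : ℂ) ^ m - 1) / (t - 1) := by
  have ht' : (t : ℂ) - 1 ≠ 0 := sub_ne_zero.2 ht
  refine ⟨fun m => (((t : ℂ) ^ (m + 1) - 1) / (t - 1) - (m + 1)) / (t - 1), by simp, fun m => ?_⟩
  simp only [sub_add_cancel, zpow_add_one₀ t.ne_zero]
  push_cast
  field_simp
  ring

theorem sum_ite_lt_eq {p P : ℤ → ℂ} (hP : ∀ m, P m = P (m - 1) + p m) {N m : ℤ} (h1 : -N - 1 ≤ m)
    (h2 : m ≤ N) : ∑ j ∈ Finset.Icc (-N) N, (if m < j then p j else 0) = P N - P m := by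
  have h3 : ∀ n, m ≤ n → ∑ j ∈ Finset.Ioc m n, p j = P n - P m := by
    intro n hn
    induction n, hn using Int.leInduction with
    | base => simp
    | succ n hn ih =>
      have : Finset.Ioc m (n + 1) = insert (n + 1) (Finset.Ioc m n) := by
        ext i
        simp only [Finset.mem_Ioc, Finset.mem_insert]
        omega
      rw [this, Finset.sum_insert (by simp), ih, hP (n + 1), add_sub_cancel_right]
      ring
  rw [← h3 N h2, ← Finset.sum_filter]
  congr 1
  ext i
  simp only [Finset.mem_filter, Finset.mem_Icc, Finset.mem_Ioc]
  omega

/-- The branch of the logarithm cut along the upper imaginary half-axis. -/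
noncomputable def logLower (w : ℂ) : ℂ := Complex.log (Complex.I * w) - Real.pi / 2 * Complex.I

/-- The branch of the logarithm cut along the lower imaginary half-axis. -/
noncomputable def logUpper (w : ℂ) : ℂ := Complex.log (-(Complex.I * w)) + Real.pi / 2 * Complex.I

theorem exp_pi_div_two_mul_I : Complex.exp (Real.pi / 2 * Complex.I) = Complex.I := by
  rw [Complex.exp_mul_I]
  simp

theorem exp_logLower {w : ℂ} (hw : w ≠ 0) : Complex.exp (logLower w) = w := by
  rw [logLower, Complex.exp_sub, Complex.exp_log (by simp [hw]), exp_pi_div_two_mul_I]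
  field_simp

theorem exp_logUpper {w : ℂ} (hw : w ≠ 0) : Complex.exp (logUpper w) = w := by
  rw [logUpper, Complex.exp_add, Complex.exp_log (by simp [hw]), exp_pi_div_two_mul_I]
  linear_combination -w * Complex.I_mul_I

theorem continuousAt_logLower {w : ℂ} (hw : w.im < 0 ∨ w.re ≠ 0) : ContinuousAt logLower w := by
  refine ContinuousAt.sub (ContinuousAt.clog (by fun_prop) ?_) continuousAt_const
  rw [Complex.mem_slitPlane_iff]
  simpa using hw

theorem continuousAt_logUpper {w : ℂ} (hw : 0 < w.im ∨ w.re ≠ 0) : ContinuousAt logUpper w := by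
  refine ContinuousAt.add (ContinuousAt.clog (by fun_prop) ?_) continuousAt_const
  rw [Complex.mem_slitPlane_iff]
  simpa using hw

theorem logUpper_of_re_pos {w : ℂ} (hw : 0 < w.re) : logUpper w = logLower w := by
  have h1 : Complex.log (-(Complex.I * w)) = Complex.log (Complex.I * w) - Real.pi * Complex.I := by
    rw [Complex.log, Complex.log, norm_neg, Complex.arg_neg_eq_arg_sub_pi_of_im_pos (by simpa)]
    push_cast
    ring
  rw [logUpper, logLower, h1]
  ring

theorem logUpper_of_re_neg {w : ℂ} (hw : w.re < 0) :
    logUpper w = logLower w + 2 * Real.pi * Complex.I := by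
  have h1 : Complex.log (-(Complex.I * w)) = Complex.log (Complex.I * w) + Real.pi * Complex.I := by
    rw [Complex.log, Complex.log, norm_neg, Complex.arg_neg_eq_arg_add_pi_of_im_neg (by simpa)]
    push_cast
    ring
  rw [logUpper, logLower, h1]
  ring

theorem Filter.Tendsto.eventually_eq_of_exp_eq {Y : Type*} {l : Filter Y} {f : Y → ℂ} {a : ℂ}
    (hf : Filter.Tendsto f l (nhds a)) (h : ∀ᶠ y in l, Complex.exp (f y) = Complex.exp a) :
    ∀ᶠ y in l, f y = a := by
  filter_upwards [h, hf.eventually (Metric.ball_mem_nhds a one_pos)] with y h1 h2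
  obtain ⟨n, hn⟩ := Complex.exp_eq_exp_iff_exists_int.1 h1
  rw [dist_eq_norm, hn, add_sub_cancel_left] at h2
  have h3 : ‖(n : ℂ) * (2 * Real.pi * Complex.I)‖ = |(n : ℝ)| * (2 * Real.pi) := by
    simp [abs_of_pos Real.pi_pos]
  rw [h3] at h2
  have h4 : n = 0 := by
    by_contra h
    have h5 : (1 : ℝ) ≤ |(n : ℝ)| := by exact_mod_cast Int.one_le_abs h
    nlinarith [Real.pi_gt_three]
  rw [hn, h4]
  simp

theorem exp_sub_div_eq {a b z : ℂ} (h1 : Complex.exp a = z) (h2 : Complex.exp b = z) :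
    Complex.exp (a - b) = 1 := by
  rw [Complex.exp_sub, h1, h2, div_self]
  rw [← h1]
  exact Complex.exp_ne_zero a

theorem isSec_dual {Y : Type*} [TopologicalSpace Y] {φ : Y → ℂ} (hφ : Continuous φ)
    (hX : ∀ w, φ w ∈ intCompl) {l : ℤ → Y → ℂ} (hl : ∀ j, Continuous (l j))
    (he : ∀ j w, Complex.exp (l j w) = φ w - j) {N : ℤ} (hN : ∀ w, |(φ w).re| < N) {t : ℂˣ}
    (ht : (t : ℂ) ≠ 1) {p P : ℤ → ℂ} (hp : ∀ m, p m = ((t : ℂ) ^ m - 1) / (t - 1))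
    (hP0 : P (-1) = 0) (hP : ∀ m, P m = P (m - 1) + p m) (y : ℂ) :
    IsSec (affTrans dualUnit (dualConst t)) univ φ
      (fun w => TrivSqZeroExt.inr
        (y - ∑ j ∈ Finset.Icc (-N) N, p j * ((l j w - logLower (φ w - j)) / (2 * Real.pi * Complex.I))))
      (fun w => TrivSqZeroExt.inr
        (y - ∑ j ∈ Finset.Icc (-N) N, p j * ((l j w - logUpper (φ w - j)) / (2 * Real.pi * Complex.I))
          - P N)) := by
  have hne : ∀ (j : ℤ) w, φ w - j ≠ 0 := fun j w => sub_ne_zero.2 (hX w j)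
  refine ⟨fun w _ h => ?_, fun w _ h => ?_, fun w _ h1 h2 => ?_⟩
  · have : ∀ᶠ w' in nhds w, ∀ j ∈ Finset.Icc (-N) N,
        l j w' - logLower (φ w' - j) = l j w - logLower (φ w - j) := by
      rw [Filter.eventually_all_finset]
      intro j _
      refine Filter.Tendsto.eventually_eq_of_exp_eq (f := fun w' => l j w' - logLower (φ w' - j)) ?_
        (Filter.Eventually.of_forall fun w' => ?_)
      · refine ((hl j).tendsto w).sub ((ContinuousAt.comp (f := fun w => φ w - j)
          (continuousAt_logLower ?_) (by fun_prop)).tendsto)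
        rcases h with h | h
        · left
          simpa using h
        · right
          simpa [sub_eq_zero] using h j
      · rw [exp_sub_div_eq (he j w') (exp_logLower (hne j w')),
          exp_sub_div_eq (he j w) (exp_logLower (hne j w))]
    rw [nhdsWithin_univ]
    filter_upwards [this] with w' hw'
    congr 2
    exact Finset.sum_congr rfl fun j hj => by rw [hw' j hj]
  · have : ∀ᶠ w' in nhds w, ∀ j ∈ Finset.Icc (-N) N,
        l j w' - logUpper (φ w' - j) = l j w - logUpper (φ w - j) := by
      rw [Filter.eventually_all_finset]
      intro j _
      refine Filter.Tendsto.eventually_eq_of_exp_eq (f := fun w' => l j w' - logUpper (φ w' - j)) ?_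
        (Filter.Eventually.of_forall fun w' => ?_)
      · refine ((hl j).tendsto w).sub ((ContinuousAt.comp (f := fun w => φ w - j)
          (continuousAt_logUpper ?_) (by fun_prop)).tendsto)
        rcases h with h | h
        · left
          simpa using h
        · right
          simpa [sub_eq_zero] using h j
      · rw [exp_sub_div_eq (he j w') (exp_logUpper (hne j w')),
          exp_sub_div_eq (he j w) (exp_logUpper (hne j w))]
    rw [nhdsWithin_univ]
    filter_upwards [this] with w' hw'
    congr 3
    exact Finset.sum_congr rfl fun j hj => by rw [hw' j hj]
  · rw [dual_affTrans_inr ht hP0 (fun m => by rw [hP, hp])]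
    congr 1
    have hre := re_ne_int_of_mem h1 h2
    have hN' := abs_lt.1 (hN w)
    have hm1 : -N - 1 ≤ ⌊(φ w).re⌋ := by
      have : -N ≤ ⌊(φ w).re⌋ := Int.le_floor.2 (by push_cast; exact hN'.1.le)
      omega
    have hm2 : ⌊(φ w).re⌋ ≤ N := (Int.floor_lt.2 hN'.2).le
    have h3 := sum_ite_lt_eq hP hm1 hm2
    have h4 : ∑ j ∈ Finset.Icc (-N) N, p j * ((l j w - logUpper (φ w - j)) / (2 * Real.pi * Complex.I)) =
        ∑ j ∈ Finset.Icc (-N) N, p j * ((l j w - logLower (φ w - j)) / (2 * Real.pi * Complex.I)) -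
          (P N - P ⌊(φ w).re⌋) := by
      rw [← h3, ← Finset.sum_sub_distrib]
      refine Finset.sum_congr rfl fun j _ => ?_
      have hpi := Complex.two_pi_I_ne_zero
      rcases lt_or_gt_of_ne (hre j) with h5 | h5
      · rw [if_pos (Int.floor_lt.2 h5), logUpper_of_re_neg (by simpa using h5)]
        field_simp
        ring
      · rw [if_neg (by rw [not_lt]; exact Int.le_floor.2 h5.le),
          logUpper_of_re_pos (by simpa using h5), sub_zero]
    rw [h4]
    ring

theorem eq_zero_of_transcendental {t : ℂˣ} (ht : Transcendental ℤ (t : ℂ)) {Q : LaurentPolynomial ℤ}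
    (hQ : LaurentPolynomial.eval₂ (Int.castRingHom ℂ) t Q = 0) : Q = 0 := by
  obtain ⟨n, f, hf⟩ := LaurentPolynomial.exists_T_pow Q
  have h1 : Polynomial.aeval (t : ℂ) f = 0 := by
    have := congrArg (LaurentPolynomial.eval₂ (Int.castRingHom ℂ) t) hf
    rw [LaurentPolynomial.eval₂_toLaurent, map_mul, hQ, zero_mul] at this
    exact this
  have h2 : f = 0 := by
    by_contra h
    exact ht ⟨f, h, h1⟩
  have h3 : Q = Polynomial.toLaurent f * LaurentPolynomial.T (-n) := by
    rw [hf, mul_assoc, ← LaurentPolynomial.T_add]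
    simp
  rw [h3, h2, map_zero, zero_mul]

open LaurentPolynomial in
theorem eq_zero_of_sum_eq_int {t : ℂˣ} (ht : Transcendental ℤ (t : ℂ)) {s : Finset ℤ} {a : ℤ → ℤ}
    {l : ℤ} (h : ∑ j ∈ s, (((t : ℂ) ^ j - 1) / (t - 1)) * a j = l) {j : ℤ} (hj : j ∈ s)
    (h0 : j ≠ 0) (h1 : j ≠ 1) : a j = 0 := by
  have ht1 : (t : ℂ) - 1 ≠ 0 := by
    intro h
    rw [sub_eq_zero] at h
    rw [h] at ht
    exact ht isAlgebraic_one
  have hQ : (∑ j ∈ s, C (a j) * (LaurentPolynomial.T j - 1) -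
      C l * (LaurentPolynomial.T 1 - 1) : LaurentPolynomial ℤ) = 0 := by
    refine eq_zero_of_transcendental ht ?_
    simp only [map_sub, map_sum, map_mul, eval₂_C, eval₂_T, map_one]
    simp only [eq_intCast, Units.val_zpow_eq_zpow_val, zpow_one]
    rw [← h, Finset.sum_mul, sub_eq_zero]
    refine Finset.sum_congr rfl fun j _ => ?_
    field_simp
  have h2 := congrArg (fun Q : LaurentPolynomial ℤ => Q.coeff j) hQ
  simp only [mul_sub, mul_one, Finset.sum_sub_distrib] at h2
  have h3 : ∀ (c m : ℤ), (C c * LaurentPolynomial.T m : LaurentPolynomial ℤ).coeff j =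
      if m = j then c else 0 := by
    intro c m
    rw [← single_eq_C_mul_T, AddMonoidAlgebra.coeff_single, Finsupp.single_apply]
  have h4 : ∀ (c : ℤ), (C c : LaurentPolynomial ℤ).coeff j = 0 := fun c => by simp [-eq_intCast, h0]
  simp [-eq_intCast, h3, h4, hj, h1.symm] at h2
  exact h2

theorem exists_transcendental_unit : ∃ t : ℂˣ, Transcendental ℤ (t : ℂ) := by
  have h1 : Transcendental ℤ ((liouvilleNumber 2 : ℝ) : ℂ) := by
    have := transcendental_liouvilleNumber (m := 2) le_rfl
    have := (transcendental_algebraMap_iff (R := ℤ) (A := ℂ) (algebraMap ℝ ℂ).injective).2 this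
    simpa using this
  refine ⟨Units.mk0 _ ?_, h1⟩
  intro h
  have h2 : ((liouvilleNumber 2 : ℝ) : ℂ) = 0 := h
  rw [h2] at h1
  exact h1 isAlgebraic_zero

theorem ne_zero_of_abs_sub_lt {i j : ℤ} (hij : i ≠ j) {w : ℂ} (hw : w ∈ Metric.ball (i : ℂ) 1) :
    (w - j).re ≠ 0 := by
  have h1 : |w.re - i| < 1 := by
    rw [Metric.mem_ball, dist_eq_norm] at hw
    simpa using (Complex.abs_re_le_norm _).trans_lt hw
  intro h2
  have h3 : w.re = j := by simpa [sub_eq_zero] using h2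
  rw [h3] at h1
  have h4 : |j - i| < 1 := by exact_mod_cast h1
  rw [abs_lt] at h4
  omega

theorem IsPairLog.logLower_add_sub_eq {k : ℂ ≃ₜ ℂ} {L : ℂ × ℂ → ℂ} (hL : IsPairLog k L)
    (hk : ∀ n : ℤ, k n = n) {i j : ℤ} (hij : i ≠ j) {ε : ℝ} (hε : 0 < ε) (hε1 : ε ≤ 1)
    (hki : MapsTo k (Metric.ball (i : ℂ) ε) (Metric.ball (i : ℂ) 1)) {z : ℂ}
    (hz : z ∈ Metric.ball (i : ℂ) ε) :
    L (j, z) + logLower (z - j) - logLower (k z - j) = L (j, i) := by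
  have hne : ∀ w ∈ Metric.ball (i : ℂ) ε, (w - j).re ≠ 0 := fun w hw =>
    ne_zero_of_abs_sub_lt hij (Metric.ball_subset_ball hε1 hw)
  have hnk : ∀ w ∈ Metric.ball (i : ℂ) ε, (k w - j).re ≠ 0 := fun w hw =>
    ne_zero_of_abs_sub_lt hij (hki hw)
  have hre : ∀ w : ℂ, w.re ≠ 0 → w ≠ 0 := by
    rintro w hw rfl
    exact hw rfl
  have hc : ContinuousOn (fun z => L (j, z) + logLower (z - j) - logLower (k z - j))
      (Metric.ball (i : ℂ) ε) := by
    refine (ContinuousOn.add ?_ ?_).sub ?_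
    · refine hL.1.comp (by fun_prop) fun w hw => ?_
      exact (sub_ne_zero.1 (hre _ (hne w hw))).symm
    · exact fun w hw => ((continuousAt_logLower (Or.inr (hne w hw))).comp
        (f := fun w => w - (j : ℂ)) (by fun_prop)).continuousWithinAt
    · exact fun w hw => ((continuousAt_logLower (Or.inr (hnk w hw))).comp
        (f := fun w => k w - (j : ℂ)) (by fun_prop)).continuousWithinAt
  obtain ⟨n, hn⟩ := exists_int_sub_eq_on (convex_ball (i : ℂ) ε).isPreconnected hc
    (v := fun _ => 0) continuousOn_const (by
      intro w hw
      have h1 := hL.2 j w (sub_ne_zero.1 (hre _ (hne w hw))).symm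
      rw [hk] at h1
      rw [Complex.exp_sub, Complex.exp_add, exp_logLower (hre _ (hne w hw)),
        exp_logLower (hre _ (hnk w hw)), h1, div_self (hre _ (hnk w hw)), Complex.exp_zero])
  have h1 := hn z hz
  have h2 := hn i (Metric.mem_ball_self hε)
  simp only [hk] at h1 h2
  rw [h1, ← h2]
  ring

theorem exists_mem_strip_inter_ball (k : ℂ ≃ₜ ℂ) (i : ℤ) (h : (nhdsWithin (i : ℂ) (strip 0)).NeBot)
    {ε : ℝ} (hε : 0 < ε) : ∃ z ∈ strip 0, z ∈ Metric.ball (i : ℂ) ε ∧ k z ∈ lowerSlit := by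
  obtain ⟨z, ⟨h1, h2⟩, h3⟩ := exists_mem_inter_lowerSlit k
    ((isOpen_strip 0).inter (Metric.isOpen_ball (x := (i : ℂ)) (ε := ε))) (by
      obtain ⟨z, h1, h2⟩ := mem_closure_iff.1 (mem_closure_iff_nhdsWithin_neBot.2 h) _
        Metric.isOpen_ball (Metric.mem_ball_self hε)
      exact ⟨z, h2, h1⟩)
  exact ⟨z, h1, h2, h3⟩

theorem exists_mapsTo_ball (k : ℂ ≃ₜ ℂ) (hk : ∀ n : ℤ, k n = n) (i : ℤ) :
    ∃ ε > 0, MapsTo k (Metric.ball (i : ℂ) ε) (Metric.ball (i : ℂ) 1) := by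
  have := k.continuous.continuousAt.preimage_mem_nhds (x := (i : ℂ)) (t := Metric.ball (i : ℂ) 1)
    (by rw [hk]; exact Metric.ball_mem_nhds _ one_pos)
  obtain ⟨ε, hε, h⟩ := Metric.mem_nhds_iff.1 this
  exact ⟨ε, hε, h⟩

open LaurentPolynomial in
theorem IsShiftIsotopy.exists_dual_section {k : ℂ ≃ₜ ℂ} (hk : ∀ n : ℤ, k n = n)
    {G : unitInterval × ℂ → ℂ} (hG : IsShiftIsotopy k G) {ε : ℝ} (hε : 0 < ε) (hε1 : ε ≤ 1)
    (hk0 : MapsTo k (Metric.ball 0 ε) (Metric.ball 0 1))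
    (hk1 : MapsTo k (Metric.ball 1 ε) (Metric.ball 1 1)) {z₀ z₁ : ℂ} (hz₀ : z₀ ∈ lowerSlit)
    (hz₀' : z₀ ∈ Metric.ball 0 ε) (hkz₀ : k z₀ ∈ lowerSlit) (hz₁ : z₁ ∈ lowerSlit)
    (hz₁' : z₁ ∈ Metric.ball 1 ε) (hkz₁ : k z₁ ∈ lowerSlit) (t : ℂˣ) :
    ∃ (u v : ℂ → DualNumber ℂ) (c : ℂ) (l : ℤ),
      IsSec (affTrans dualUnit (dualConst t)) lowerSlit k u v ∧ u z₀ = 0 ∧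
      u z₁ = TrivSqZeroExt.inl (c + 1) + TrivSqZeroExt.inr (c * l) := by
  have := contractibleSpace_lowerSlit
  have : LocallyPathConnectedSpace lowerSlit := isOpen_lowerSlit.locallyPathConnectedSpace
  let X : ℂ[T;T⁻¹]ˣ := ⟨LaurentPolynomial.T 1, LaurentPolynomial.T (-1), by rw [← T_add]; simp,
    by rw [← T_add]; simp⟩
  let t' : ℂ[T;T⁻¹]ˣ := Units.map (C : ℂ →+* ℂ[T;T⁻¹]) t
  obtain ⟨u, v, hs, h0⟩ := exists_isSec (affTrans X t') lowerSlit k.continuous.continuousOn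
    (fun z hz => map_mem_intCompl k.injective hk (lowerSlit_subset hz)) hz₀ hkz₀ 0
  obtain ⟨c, l, hc⟩ := exists_eq_C_mul_T_of_isUnit
    (isUnit_sub_one_of_isSec hk hG hs hε hε1 hk0 hk1 hz₀ hz₀' hkz₀ hz₁ hz₁' hkz₁ h0)
  let π : ℂ[T;T⁻¹] →+* DualNumber ℂ := LaurentPolynomial.eval₂ (algebraMap ℂ (DualNumber ℂ)) dualUnit
  have hX : Units.map (π : ℂ[T;T⁻¹] →* DualNumber ℂ) X = dualUnit := by
    ext1
    have : π (LaurentPolynomial.T 1) = dualUnit := by simp [π]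
    exact this
  have ht : Units.map (π : ℂ[T;T⁻¹] →* DualNumber ℂ) t' = dualConst t := by
    ext1
    have : π (C (t : ℂ)) = dualConst t := by
      simp only [π, eval₂_C]
      rfl
    exact this
  refine ⟨π ∘ u, π ∘ v, c, l, ?_, by simp [h0], ?_⟩
  · have := hs.map π (map_affTrans π X t')
    rwa [hX, ht] at this
  · have h1 : u z₁ = C c * LaurentPolynomial.T l + 1 := by rw [← hc]; ring
    have h2 : ∀ l : ℤ, ((dualUnit ^ l : (DualNumber ℂ)ˣ) : DualNumber ℂ) =
        TrivSqZeroExt.inl 1 + TrivSqZeroExt.inr (l : ℂ) := by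
      intro l
      induction l using Int.induction_on with
      | zero => simp
      | succ n ih =>
        rw [zpow_add_one, Units.val_mul, ih]
        ext <;> simp [dualUnit]
        ring
      | pred n ih =>
        rw [zpow_sub_one, Units.val_mul, ih]
        have : ((dualUnit⁻¹ : (DualNumber ℂ)ˣ) : DualNumber ℂ) = 1 - DualNumber.eps := rfl
        rw [this]
        ext <;> simp
        ring
    simp only [Function.comp_apply, h1, map_add, map_mul, map_one, π, eval₂_C, eval₂_T, h2]
    ext <;> simp [TrivSqZeroExt.algebraMap_eq_inl]

theorem IsPairLog.exists_int_eq {k : ℂ ≃ₜ ℂ} {L : ℂ × ℂ → ℂ} (hL : IsPairLog k L)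
    (hk : ∀ n : ℤ, k n = n) {z : ℂ} (hz : z ∈ intCompl) (j : ℤ) :
    ∃ a : ℤ, (L (j, z) + logLower (z - j) - logLower (k z - j)) / (2 * Real.pi * Complex.I) = a := by
  have hkz := map_mem_intCompl k.injective hk hz
  have h1 := hL.2 j z (hz j).symm
  rw [hk] at h1
  obtain ⟨a, ha⟩ := exists_int_of_exp_eq (a := L (j, z) + logLower (z - j))
    (b := logLower (k z - j)) (by
      rw [Complex.exp_add, exp_logLower (sub_ne_zero.2 (hz j)),
        exp_logLower (sub_ne_zero.2 (hkz j)), h1])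
  refine ⟨a, ?_⟩
  rw [ha, mul_div_cancel_right₀ _ Complex.two_pi_I_ne_zero]

theorem IsPairLog.apply_zero_eq_apply_one {k : ℂ ≃ₜ ℂ} {L : ℂ × ℂ → ℂ} (hL : IsPairLog k L)
    (hk : ∀ n : ℤ, k n = n) {G : unitInterval × ℂ → ℂ} (hG : IsShiftIsotopy k G) {j : ℤ}
    (h0 : j ≠ 0) (h1 : j ≠ 1) : L (0, j) = L (1, j) := by
  obtain ⟨ε₀, hε₀, hk0⟩ := exists_mapsTo_ball k hk 0
  obtain ⟨ε₁, hε₁, hk1⟩ := exists_mapsTo_ball k hk 1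
  obtain ⟨ε, hε, hεε₀, hεε₁, hε1⟩ : ∃ ε > 0, ε ≤ ε₀ ∧ ε ≤ ε₁ ∧ ε ≤ 1 :=
    ⟨min (min ε₀ ε₁) 1, lt_min (lt_min hε₀ hε₁) one_pos,
      (min_le_left _ _).trans (min_le_left _ _), (min_le_left _ _).trans (min_le_right _ _),
      min_le_right _ _⟩
  replace hk0 := hk0.mono_left (Metric.ball_subset_ball hεε₀)
  replace hk1 := hk1.mono_left (Metric.ball_subset_ball hεε₁)
  obtain ⟨z₀, hz₀, hz₀', hkz₀⟩ := exists_mem_strip_inter_ball k 0 (nhdsWithin_strip_neBot 0) hε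
  obtain ⟨z₁, hz₁, hz₁', hkz₁⟩ := exists_mem_strip_inter_ball k 1 (nhdsWithin_strip_neBot' 0) hε
  obtain ⟨t, ht⟩ := exists_transcendental_unit
  have ht1 : (t : ℂ) ≠ 1 := by
    intro h
    rw [h] at ht
    exact ht isAlgebraic_one
  obtain ⟨u, v, c, l, hs, hu0, hu1⟩ := hG.exists_dual_section hk hε hε1 (by simpa using hk0)
    (by simpa using hk1) (strip_subset_lowerSlit 0 hz₀) (by simpa using hz₀') hkz₀
    (strip_subset_lowerSlit 0 hz₁) (by simpa using hz₁') hkz₁ t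
  obtain ⟨P, hP0, hP⟩ := exists_primitive ht1
  let γ : unitInterval → ℂ := fun s => z₀ + (s : ℝ) • (z₁ - z₀)
  have hγc : Continuous γ := by fun_prop
  have hγ : ∀ s, γ s ∈ strip 0 := fun s => (convex_strip 0).add_smul_sub_mem hz₀ hz₁ s.2
  have hγ0 : γ 0 = z₀ := by simp [γ]
  have hγ1 : γ 1 = z₁ := by simp [γ]
  have hcompl : ∀ {z}, z ∈ strip 0 → z ∈ intCompl := fun hz =>
    lowerSlit_subset (strip_subset_lowerSlit 0 hz)
  obtain ⟨N, hN, hjN⟩ : ∃ N : ℤ, (∀ s, |(k (γ s)).re| < N) ∧ |j| ≤ N := by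
    obtain ⟨B, hB⟩ := (isCompact_range (f := fun s => (k (γ s)).re) (by fun_prop)).isBounded.exists_norm_le
    obtain ⟨n, hn⟩ := exists_nat_gt (max B |(j : ℝ)|)
    refine ⟨n, fun s => ?_, ?_⟩
    · exact (hB _ ⟨s, rfl⟩).trans_lt ((le_max_left _ _).trans_lt (by exact_mod_cast hn))
    · have h := ((le_max_right B |(j : ℝ)|).trans_lt (by exact_mod_cast hn)).le
      exact_mod_cast h
  let n : ℤ → ℂ → ℂ := fun i z =>
    (L (i, z) + logLower (z - i) - logLower (k z - i)) / (2 * Real.pi * Complex.I)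
  let p : ℤ → ℂ := fun m => ((t : ℂ) ^ m - 1) / (t - 1)
  have sec := isSec_dual (φ := k ∘ γ) (k.continuous.comp hγc)
    (fun s => map_mem_intCompl k.injective hk (hcompl (hγ s)))
    (l := fun i s => L (i, γ s) + logLower (γ s - i)) (fun i => by
      refine Continuous.add ?_ ?_
      · exact hL.1.comp_continuous (by fun_prop) fun s => (hcompl (hγ s) i).symm
      · refine continuous_iff_continuousAt.2 fun s => (continuousAt_logLower (Or.inr ?_)).comp
          (f := fun s => γ s - (i : ℂ)) (by fun_prop)
        simpa [sub_eq_zero] using re_ne_int_of_mem_strip (hγ s) i)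
    (fun i s => by
      have h := hL.2 i (γ s) (hcompl (hγ s) i).symm
      rw [hk] at h
      rw [Complex.exp_add, exp_logLower (sub_ne_zero.2 (hcompl (hγ s) i)), h]
      rfl) hN ht1 (p := p) (fun _ => rfl) hP0 hP (∑ i ∈ Finset.Icc (-N) N, p i * n i z₀)
  have sec' := hs.comp (W' := univ) hγc.continuousOn (fun s _ => strip_subset_lowerSlit 0 (hγ s))
  have hag := (sec'.agree sec isPreconnected_univ (k.continuous.comp hγc).continuousOn
    (fun s _ => map_mem_intCompl k.injective hk (hcompl (hγ s))) (mem_univ 0)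
    (sec'.agree_of_left sec (mem_univ 0) (by simpa [hγ0] using hkz₀)
      (by simp [hγ0, hu0, n])) (mem_univ 1)).1 (by simpa [hγ1] using hkz₁)
  simp only [Function.comp_apply, hγ1, hu1] at hag
  have hc := congrArg TrivSqZeroExt.fst hag
  have hl := congrArg TrivSqZeroExt.snd hag
  simp only [TrivSqZeroExt.fst_add, TrivSqZeroExt.fst_inl, TrivSqZeroExt.fst_inr, add_zero,
    TrivSqZeroExt.snd_add, TrivSqZeroExt.snd_inl, TrivSqZeroExt.snd_inr, zero_add] at hc hl
  rw [eq_neg_of_add_eq_zero_left hc] at hl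
  choose a₀ ha₀ using hL.exists_int_eq hk (hcompl hz₀)
  choose a₁ ha₁ using hL.exists_int_eq hk (hcompl hz₁)
  have hsum : ∑ i ∈ Finset.Icc (-N) N, (((t : ℂ) ^ i - 1) / (t - 1)) * ((a₁ - a₀ : ℤ → ℤ) i : ℤ) =
      (l : ℤ) := by
    have h2 : ∑ i ∈ Finset.Icc (-N) N, p i * n i z₀ = ∑ i ∈ Finset.Icc (-N) N, p i * (a₀ i) :=
      Finset.sum_congr rfl fun i _ => by rw [← ha₀]
    have h3 : ∑ i ∈ Finset.Icc (-N) N, p i * ((L (i, z₁) + logLower (z₁ - i) - logLower (k z₁ - i)) /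
        (2 * Real.pi * Complex.I)) = ∑ i ∈ Finset.Icc (-N) N, p i * (a₁ i) :=
      Finset.sum_congr rfl fun i _ => by rw [← ha₁]
    rw [h2, h3] at hl
    simp only [Pi.sub_apply, Int.cast_sub, mul_sub, Finset.sum_sub_distrib]
    linear_combination hl
  have h2 := eq_zero_of_sum_eq_int ht hsum (Finset.mem_Icc.2 (abs_le.1 hjN)) h0 h1
  have h3 := ha₀ j
  have h4 := ha₁ j
  rw [hL.logLower_add_sub_eq hk h0.symm hε hε1 hk0 hz₀'] at h3
  rw [hL.logLower_add_sub_eq hk h1.symm hε hε1 hk1 hz₁'] at h4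
  rw [sub_eq_zero.1 h2, ← h3, div_left_inj' Complex.two_pi_I_ne_zero] at h4
  have h5 := hL.symm_apply 0 j (by exact_mod_cast h0.symm)
  have h6 := hL.symm_apply 1 j (by exact_mod_cast h1.symm)
  rw [h5, h6]
  simpa using h4.symm

theorem IsPairLog.int_shift {k : ℂ → ℂ} {L : ℂ × ℂ → ℂ} (hL : IsPairLog k L) {κ : ℂ}
    (hs : ∀ i j : ℤ, i ≠ j → L ((i : ℂ) + 1, (j : ℂ) + 1) = L (i, j) + κ)
    (hz : ∀ j : ℤ, j ≠ 0 → j ≠ 1 → L (0, j) = L (1, j)) :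
    κ = 0 ∧ ∀ i j : ℤ, i ≠ j → L (i, j) = L (0, 1) := by
  let W : ℤ → ℂ := fun j => L (0, j)
  have hstep : ∀ j, j ≠ 0 → j ≠ 1 → W j = W (j - 1) + κ := by
    intro j h0 h1
    have h2 := hs 0 (j - 1) (by omega)
    have h3 := hz j h0 h1
    simp only [W, h3]
    rw [← Int.cast_zero, ← h2]
    congr 2
    · simp
    · push_cast
      ring
  have hmul : ∀ (n : ℕ) (i j : ℤ), i ≠ j → L (i + n, j + n) = L (i, j) + n * κ := by
    intro n
    induction n with
    | zero => simp
    | succ n ih =>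
      intro i j hij
      have := hs (i + n) (j + n) (by omega)
      push_cast at this
      rw [ih i j hij] at this
      push_cast
      rw [← add_assoc, ← add_assoc, this]
      ring
  have hneg : ∀ n : ℕ, 0 < n → W n = W (-n) + n * κ := by
    intro n hn
    have h1 := hmul n (-n) 0 (by omega)
    have h2 := hL.symm_apply (-(n : ℂ)) 0 (by simpa using hn.ne')
    simp only [W]
    push_cast at h1 ⊢
    rw [neg_add_cancel, zero_add] at h1
    rw [h1, h2]
  have e1 := hstep 2 (by norm_num) (by norm_num)
  have e2 := hstep (-1) (by norm_num) (by norm_num)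
  have e3 := hneg 1 (by norm_num)
  have e4 := hneg 2 (by norm_num)
  norm_num at e1 e2 e3 e4
  have hκ : κ = 0 := by linear_combination -e1 - e2 - e3 + e4
  subst hκ
  refine ⟨rfl, ?_⟩
  simp only [mul_zero, add_zero] at hstep hmul hneg
  have hpos : ∀ n : ℕ, W (n + 1) = W 1 := by
    intro n
    induction n with
    | zero => simp
    | succ n ih =>
      rw [hstep _ (by omega) (by omega), ← ih]
      congr 1
      push_cast
      ring
  have hall : ∀ j : ℤ, j ≠ 0 → W j = W 1 := by
    intro j hj
    rcases lt_or_gt_of_ne hj with h | h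
    · obtain ⟨n, rfl⟩ : ∃ n : ℕ, j = -((n + 1 : ℕ) : ℤ) := ⟨(-j - 1).toNat, by omega⟩
      rw [← hneg _ (by omega), Nat.cast_succ, hpos]
    · obtain ⟨n, rfl⟩ : ∃ n : ℕ, j = (n : ℤ) + 1 := ⟨(j - 1).toNat, by omega⟩
      rw [hpos]
  have hdiff : ∀ i j : ℤ, i ≠ j → L (i, j) = W (j - i) := by
    intro i j hij
    rcases le_total 0 i with h | h
    · obtain ⟨n, rfl⟩ := Int.eq_ofNat_of_zero_le h
      have h1 := hmul n 0 (j - n) (by omega)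
      simp only [W, Int.cast_sub, Int.cast_natCast, Int.cast_zero, zero_add, sub_add_cancel] at h1 ⊢
      exact h1
    · obtain ⟨n, hn⟩ := Int.eq_ofNat_of_zero_le (neg_nonneg.2 h)
      obtain rfl : i = -(n : ℤ) := by omega
      have h1 := hmul n (-n) j hij
      simp only [W, Int.cast_add, Int.cast_natCast, Int.cast_neg, neg_add_cancel, sub_neg_eq_add]
        at h1 ⊢
      exact h1.symm
  intro i j hij
  rw [hdiff i j hij, hall _ (sub_ne_zero.2 hij.symm)]
  simp [W]

theorem IsPairLog.exists_int_eq_of_line {g : ℂ → ℂ} {M : ℂ × ℂ → ℂ} (hM : IsPairLog g M) {c d : ℂ}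
    (h : ∀ x : ℝ, g (x + c) = x + d) :
    ∃ n : ℤ, ∀ x y : ℝ, x ≠ y → M (x + c, y + c) = n * (2 * Real.pi * Complex.I) := by
  have hne : ∀ {x y : ℝ}, x ≠ y → (x : ℂ) + c ≠ y + c := fun hxy h =>
    hxy (by exact_mod_cast add_right_cancel h)
  have hconv : Convex ℝ {p : ℝ × ℝ | p.1 < p.2} := by
    have : {p : ℝ × ℝ | p.1 < p.2} = (fun p : ℝ × ℝ => p.2 - p.1) ⁻¹' Ioi 0 := by
      ext p
      simp
    rw [this]
    exact (convex_Ioi 0).is_linear_preimage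
      ((LinearMap.snd ℝ ℝ ℝ - LinearMap.fst ℝ ℝ ℝ).isLinear)
  obtain ⟨n, hn⟩ := exists_int_sub_eq_on hconv.isPreconnected
    (u := fun p : ℝ × ℝ => M (p.1 + c, p.2 + c)) (v := fun _ => 0)
    (hM.1.comp (by fun_prop) fun p hp => hne (ne_of_lt hp)) continuousOn_const (by
      rintro ⟨x, y⟩ hxy
      have hxy' : x < y := hxy
      rw [hM.exp_eq (hne hxy'.ne), h, h, Complex.exp_zero, add_sub_add_right_eq_sub,
        add_sub_add_right_eq_sub, div_self (sub_ne_zero.2 (by exact_mod_cast hxy'.ne'))])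
  refine ⟨n, fun x y hxy => ?_⟩
  rcases lt_or_gt_of_ne hxy with h1 | h1
  · simpa using hn (x, y) h1
  · rw [hM.symm_apply _ _ (hne hxy)]
    simpa using hn (y, x) h1

theorem IsPairLog.im_pos_of_pos {g : ℂ → ℂ} {M : ℂ × ℂ → ℂ} (hM : IsPairLog g M) (hg : Continuous g)
    {d : ℂ} (hd : d.im = 0) (h : ∀ x : ℝ, g x = x + d) {z : ℂ} (hz : 0 < z.im) : 0 < (g z).im := by
  have hne : ∀ w : ℂ, 0 < w.im → (g w).im ≠ 0 := by
    intro w hw h0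
    have h1 : g w = (((g w).re - d.re : ℝ) : ℂ) + d := Complex.ext (by simp) (by simp [h0, hd])
    rw [← h, hM.injective.eq_iff] at h1
    rw [h1] at hw
    simp at hw
  by_contra! hcon
  have hneg : ∀ w : ℂ, 0 < w.im → (g w).im < 0 := by
    intro w hw
    by_contra! hw'
    obtain ⟨v, hv, hv'⟩ := (convex_halfSpace_im_gt 0).isPreconnected.intermediate_value
      (f := fun w => (g w).im) hz hw (by fun_prop) ⟨hcon, hw'⟩
    exact hne v hv hv'
  obtain ⟨m, hm⟩ := hM.exists_int_eq_of_line (c := 0) (d := d) (fun x => by rw [add_zero, h])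
  let b : ℝ → ℂ := fun s => ⟨Real.cos s, Real.sin s⟩
  have hb : Continuous b := by
    have : b = fun s => (Real.cos s : ℂ) + Real.sin s * Complex.I := by
      ext s
      apply Complex.ext <;> simp [b, -Complex.ofReal_cos, -Complex.ofReal_sin]
    rw [this]
    fun_prop
  have hb0 : ∀ s, b s ≠ 0 := by
    intro s hs
    have h1 := congrArg Complex.re hs
    have h2 := congrArg Complex.im hs
    have := Real.sin_sq_add_cos_sq s
    simp only [b, Complex.zero_re, Complex.zero_im] at h1 h2
    simp [h1, h2] at this
  have hg0 : (g 0).im = 0 := by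
    have := h 0
    simp only [Complex.ofReal_zero] at this
    simp [this, hd]
  have hslit : ∀ s ∈ Icc 0 Real.pi, (g (b s) - g 0).im < 0 ∨ (g (b s) - g 0).re ≠ 0 := by
    intro s hs
    rcases hs.1.eq_or_lt with rfl | h1
    · right
      have e1 : b 0 = ((1 : ℝ) : ℂ) := by apply Complex.ext <;> simp [b]
      have e2 := h 0
      simp only [Complex.ofReal_zero] at e2
      rw [e1, h, e2]
      simp
    rcases hs.2.eq_or_lt with rfl | h2
    · right
      have e1 : b Real.pi = ((-1 : ℝ) : ℂ) := by apply Complex.ext <;> simp [b]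
      have e2 := h 0
      simp only [Complex.ofReal_zero] at e2
      rw [e1, h, e2]
      simp
    · left
      rw [Complex.sub_im, hg0, sub_zero]
      exact hneg _ (Real.sin_pos_of_pos_of_lt_pi h1 h2)
  obtain ⟨n, hn⟩ := exists_int_sub_eq_on (isPreconnected_Icc (a := (0 : ℝ)) (b := Real.pi))
    (u := fun s => M (0, b s) + logUpper (b s)) (v := fun s => logLower (g (b s) - g 0))
    (by
      refine ContinuousOn.add (hM.1.comp (by fun_prop) fun s _ => (hb0 s).symm) fun s hs =>
        ((continuousAt_logUpper ?_).comp hb.continuousAt).continuousWithinAt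
      by_cases h1 : (b s).re = 0
      · left
        have h2 := Real.sin_sq_add_cos_sq s
        have h3 : Real.cos s = 0 := h1
        have h4 : 0 ≤ Real.sin s := Real.sin_nonneg_of_mem_Icc hs
        rw [h3] at h2
        have h5 : Real.sin s ≠ 0 := by
          intro h
          simp [h] at h2
        exact lt_of_le_of_ne h4 h5.symm
      · exact Or.inr h1)
    (fun s hs => ((continuousAt_logLower (hslit s hs)).comp (f := fun s => g (b s) - g 0)
      (by fun_prop)).continuousWithinAt) (by
      intro s hs
      have h1 := hM.2 0 (b s) (hb0 s).symm
      rw [sub_zero] at h1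
      rw [Complex.exp_add, exp_logUpper (hb0 s), h1, exp_logLower]
      exact sub_ne_zero.2 (hM.injective.ne (hb0 s)))
  have h1 := hn 0 ⟨le_rfl, Real.pi_pos.le⟩
  have h2 := hn Real.pi ⟨Real.pi_pos.le, le_rfl⟩
  have e1 : b 0 = 1 := by apply Complex.ext <;> simp [b]
  have e2 : b Real.pi = -1 := by apply Complex.ext <;> simp [b]
  have e3 : g 1 - g 0 = 1 := by
    have h3 := h 1
    have h4 := h 0
    push_cast at h3 h4
    rw [h3, h4]
    ring
  have e4 : g (-1) - g 0 = -1 := by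
    have h3 := h (-1)
    have h4 := h 0
    push_cast at h3 h4
    rw [h3, h4]
    ring
  have e5 := hm 0 1 zero_ne_one
  have e6 := hm 0 (-1) (by norm_num)
  push_cast at e5 e6
  simp only [add_zero] at e5 e6
  simp only [e1, e2, e3, e4, e5, e6] at h1 h2
  rw [logUpper_of_re_pos (by simp)] at h1
  rw [logUpper_of_re_neg (by simp)] at h2
  exact Complex.two_pi_I_ne_zero (by linear_combination h2 - h1)

theorem IsPairLog.im_mul_im_pos {g : ℂ → ℂ} {M : ℂ × ℂ → ℂ} (hM : IsPairLog g M)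
    (hg : Continuous g) {d : ℂ} (hd : d.im = 0) (h : ∀ x : ℝ, g x = x + d) {z : ℂ}
    (hz : z.im ≠ 0) : 0 < z.im * (g z).im := by
  rcases lt_or_gt_of_ne hz with h1 | h1
  · have hM' : IsPairLog (fun z => -g (-z)) (fun p => M (-p.1, -p.2)) :=
      ⟨hM.1.comp (by fun_prop) fun p hp => neg_injective.ne hp, fun a b hab => by
        have := hM.2 (-a) (-b) (neg_injective.ne hab)
        linear_combination -this⟩
    have := hM'.im_pos_of_pos (by fun_prop) (d := -d) (by simp [hd]) (fun x => by
      have := h (-x)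
      push_cast at this
      rw [this]
      ring) (z := -z) (by simpa using h1)
    simp only [neg_neg, Complex.neg_im] at this
    exact mul_pos_of_neg_of_neg h1 (by linarith)
  · exact mul_pos h1 (hM.im_pos_of_pos hg hd h h1)

/-- The maps which act on the integers as the unit translation and preserve their complement. -/
def ShiftsInt (φ : C(ℂ, ℂ)) : Prop :=
  (∀ n : ℤ, φ n = n + 1) ∧ MapsTo φ intCompl intCompl

theorem ShiftsInt.of_injective {φ : C(ℂ, ℂ)} (h : ∀ n : ℤ, φ n = n + 1)
    (hi : Function.Injective φ) : ShiftsInt φ := by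
  refine ⟨h, fun z hz n hn => hz (n - 1) (hi ?_)⟩
  have := h (n - 1)
  push_cast at this ⊢
  rw [this, hn]
  ring

/-- `f` is isotopic, relative to the integers, to an injective map which acts on the real line
as the unit translation. -/
def IsLineShift (f : ℂ → ℂ) : Prop :=
  ∃ F : unitInterval × ℂ → ℂ, Continuous F ∧ (∀ t, Function.Injective fun z => F (t, z)) ∧
    (∀ z, F (0, z) = f z) ∧ (∀ t (n : ℤ), F (t, n) = n + 1) ∧ ∀ x : ℝ, F (1, x) = x + 1

theorem IsLineShift.homotopicWith {f : C(ℂ, ℂ)} (h : IsLineShift f) {L : ℂ × ℂ → ℂ}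
    (hL : IsPairLog f L) :
    ContinuousMap.HomotopicWith f (ContinuousMap.id ℂ + 1) ShiftsInt := by
  obtain ⟨F, hF, hi, h0, hn, h1⟩ := h
  have hFt : ∀ t, Continuous fun z => F (t, z) := fun t => hF.comp (by fun_prop)
  let g : C(ℂ, ℂ) := ⟨fun z => F (1, z), hFt 1⟩
  obtain ⟨M, hM, -⟩ := hL.of_isotopy F hF hi h0 (g := g) (fun z => rfl) ∅ (by simp)
  have hH1 : ContinuousMap.HomotopicWith f g ShiftsInt :=
    ⟨{ toContinuousMap := ⟨F, hF⟩
       map_zero_left := h0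
       map_one_left := fun z => rfl
       prop' := fun t => ShiftsInt.of_injective (hn t) (hi t) }⟩
  have hgx : ∀ x : ℝ, g x = x + 1 := h1
  refine hH1.trans ⟨{
    toContinuousMap := ⟨fun p => ((1 - p.1 : ℝ) : ℂ) * g p.2 + ((p.1 : ℝ) : ℂ) * (p.2 + 1), by fun_prop⟩
    map_zero_left := fun z => by simp
    map_one_left := fun z => by simp
    prop' := fun t => ⟨fun n => ?_, fun z hz n hzn => ?_⟩ }⟩
  · have := hgx n
    simp only [Complex.ofReal_intCast] at this
    simp only [ContinuousMap.coe_mk, this]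
    push_cast
    ring
  · simp only [ContinuousMap.coe_mk] at hzn
    by_cases hz0 : z.im = 0
    · have hzr : z = (z.re : ℂ) := Complex.ext (by simp) (by simp [hz0])
      rw [hzr, hgx, ← hzr] at hzn
      refine hz (n - 1) ?_
      push_cast at hzn ⊢
      linear_combination hzn
    · have h2 := hM.im_mul_im_pos g.continuous (d := 1) (by simp) hgx hz0
      have h3 := congrArg Complex.im hzn
      simp only [Complex.add_im, Complex.im_ofReal_mul, Complex.one_im, add_zero,
        Complex.intCast_im] at h3
      have h4 := t.2.1
      have h5 := t.2.2
      have h6 : (1 - (t : ℝ)) * (z.im * (g z).im) + t * z.im ^ 2 = 0 := by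
        linear_combination z.im * h3
      have h7 : 0 < z.im ^ 2 := by positivity
      rcases h4.eq_or_lt with h8 | h8
      · rw [← h8] at h6
        linarith
      · nlinarith [mul_pos h8 h7, mul_nonneg (sub_nonneg.2 h5) h2.le]

theorem exists_isShiftIsotopy {k : ℂ ≃ₜ ℂ} (hk : ∀ n : ℤ, k n = n) {f f' : C(ℂ, ℂ)}
    (hf : IsLineShift f) (hf' : IsLineShift f') {L L' : ℂ × ℂ → ℂ} (hL : IsPairLog f L)
    (hL' : IsPairLog f' L') (hkf : ∀ z, k (f z) = f' (k z)) :
    ∃ G, IsShiftIsotopy k G := by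
  obtain ⟨H⟩ := (hf.homotopicWith hL).symm
  obtain ⟨H'⟩ := hf'.homotopicWith hL'
  have hkm : MapsTo k intCompl intCompl := fun z => map_mem_intCompl k.injective hk
  have h1 : ContinuousMap.HomotopicWith ((k : C(ℂ, ℂ)).comp (ContinuousMap.id ℂ + 1))
      ((k : C(ℂ, ℂ)).comp f) ShiftsInt :=
    ⟨{ toContinuousMap := (k : C(ℂ, ℂ)).comp H.toContinuousMap
       map_zero_left := fun z => by simp
       map_one_left := fun z => by simp
       prop' := fun t => ⟨fun n => by
         have h2 := (H.prop t).1 n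
         have h3 := hk (n + 1)
         push_cast at h3
         exact (congrArg k h2).trans h3, fun z hz => hkm ((H.prop t).2 hz)⟩ }⟩
  have h2 : ContinuousMap.HomotopicWith (f'.comp (k : C(ℂ, ℂ)))
      ((ContinuousMap.id ℂ + 1 : C(ℂ, ℂ)).comp (k : C(ℂ, ℂ))) ShiftsInt :=
    ⟨{ toContinuousMap := H'.toContinuousMap.comp
         ((ContinuousMap.id unitInterval).prodMap (k : C(ℂ, ℂ)))
       map_zero_left := fun z => by simp
       map_one_left := fun z => by simp
       prop' := fun t => ⟨fun n => by
         have h2 := (H'.prop t).1 n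
         exact (congrArg (fun w => H' (t, w)) (hk n)).trans h2,
         fun z hz => (H'.prop t).2 (hkm hz)⟩ }⟩
  have he : (k : C(ℂ, ℂ)).comp f = f'.comp (k : C(ℂ, ℂ)) := by
    ext z
    exact hkf z
  rw [he] at h1
  obtain ⟨G⟩ := h1.trans h2
  exact ⟨G, G.continuous, fun t z hz => (G.prop t).2 hz, fun t n => (G.prop t).1 n,
    fun z => G.map_zero_left z, fun z => G.map_one_left z⟩

theorem Int.units_coe_mul_self_complex (ε : ℤˣ) : ((ε : ℤ) : ℂ) * ((ε : ℤ) : ℂ) = 1 := by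
  have := congrArg (fun u : ℤˣ => ((u : ℤ) : ℂ)) (Int.units_mul_self ε)
  simpa only [Units.val_mul, Int.cast_mul, Units.val_one, Int.cast_one] using this

/-- The parametrisation `z ↦ ε z + c`, where `ε` is a sign. -/
noncomputable def lineParam (ε : ℤˣ) (c : ℂ) : ℂ ≃ₜ ℂ where
  toFun z := (ε : ℤ) * z + c
  invFun z := (ε : ℤ) * (z - c)
  left_inv z := by linear_combination z * Int.units_coe_mul_self_complex ε
  right_inv z := by linear_combination (z - c) * Int.units_coe_mul_self_complex ε
  continuous_toFun := by fun_prop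
  continuous_invFun := by fun_prop

theorem lineParam_apply (ε : ℤˣ) (c z : ℂ) : lineParam ε c z = (ε : ℤ) * z + c := rfl

theorem lineParam_symm_apply (ε : ℤˣ) (c z : ℂ) : (lineParam ε c).symm z = (ε : ℤ) * (z - c) := rfl

theorem IsPairLog.conj_lineParam {k : ℂ → ℂ} {K : ℂ × ℂ → ℂ} (hK : IsPairLog k K) (ε ε' : ℤˣ) (c c' : ℂ)
    {l : ℂ} (hl : Complex.exp l = ((ε : ℤ) : ℂ) * ((ε' : ℤ) : ℂ)) :
    IsPairLog (fun z => (lineParam ε' c').symm (k (lineParam ε c z)))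
      (fun p => K (lineParam ε c p.1, lineParam ε c p.2) + l) := by
  refine ⟨(hK.1.comp (by fun_prop) fun p hp => (lineParam ε c).injective.ne hp).add
    continuousOn_const, fun a b hab => ?_⟩
  have h1 := hK.2 _ _ ((lineParam ε c).injective.ne hab)
  rw [Complex.exp_add, hl]
  simp only [lineParam_symm_apply, lineParam_apply] at h1 ⊢
  linear_combination ((ε' : ℤ) : ℂ) * h1

theorem exists_exp_eq_units (ε : ℤˣ) : ∃ l : ℂ, Complex.exp l = ((ε : ℤ) : ℂ) :=
  ⟨Complex.log ((ε : ℤ) : ℂ), Complex.exp_log (by exact_mod_cast ε.ne_zero)⟩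

/-- The conjugacy equation between pair logarithms forces those of `k` to be constant on an
orbit on which the dynamics is that of a translation. -/
theorem IsPairLog.eq_on_line {k f f' : ℂ ≃ₜ ℂ} {K L L' : ℂ × ℂ → ℂ} (hK : IsPairLog k K)
    (hL : IsPairLog f L) (hL' : IsPairLog f' L') (hkf : ∀ z, k (f z) = f' (k z))
    {ε ε' : ℤˣ} {c c' : ℂ}
    (hf : IsLineShift fun z => (lineParam ε c).symm (f (lineParam ε c z)))
    (hf' : IsLineShift fun z => (lineParam ε' c').symm (f' (lineParam ε' c' z)))
    (hk : ∀ n : ℤ, k (lineParam ε c n) = lineParam ε' c' n)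
    (hfc : ∀ n : ℤ, f (lineParam ε c n) = lineParam ε c (n + 1))
    (hL0 : ∀ i j : ℤ, i ≠ j → L (lineParam ε c i, lineParam ε c j) = 0)
    (hL0' : ∀ i j : ℤ, i ≠ j → L' (lineParam ε' c' i, lineParam ε' c' j) = 0) {κ : ℂ}
    (hκ : ∀ x y, x ≠ y → K (f x, f y) + L (x, y) = L' (k x, k y) + K (x, y) + κ) :
    κ = 0 ∧ ∀ i j : ℤ, i ≠ j →
      K (lineParam ε c i, lineParam ε c j) = K (lineParam ε c 0, lineParam ε c 1) := by
  set A := lineParam ε c with hA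
  set B := lineParam ε' c' with hB
  obtain ⟨l, hl⟩ := exists_exp_eq_units (ε * ε')
  push_cast at hl
  let k' : ℂ ≃ₜ ℂ := (A.trans k).trans B.symm
  have hk' : ∀ n : ℤ, k' n = n := fun n => (B.symm_apply_eq).2 (hk n)
  have hK' : IsPairLog k' _ := hK.conj_lineParam ε ε' c c' hl
  have h0 : ∀ ε : ℤˣ, Complex.exp 0 = ((ε : ℤ) : ℂ) * ((ε : ℤ) : ℂ) := fun ε => by
    rw [Complex.exp_zero, Int.units_coe_mul_self_complex]
  obtain ⟨G, hG⟩ := exists_isShiftIsotopy hk'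
    (f := ⟨fun z => A.symm (f (A z)), by fun_prop⟩)
    (f' := ⟨fun z => B.symm (f' (B z)), by fun_prop⟩) hf hf'
    (hL.conj_lineParam ε ε c c (h0 ε)) (hL'.conj_lineParam ε' ε' c' c' (h0 ε'))
    (fun z => by simp [k', hkf])
  have hne : ∀ {i j : ℤ}, i ≠ j → A i ≠ A j := fun h => A.injective.ne (by exact_mod_cast h)
  have h1 := hK'.int_shift (κ := κ) (fun i j hij => by
    have h2 := hκ (A i) (A j) (hne hij)
    rw [hfc, hfc, hL0 i j hij, hk, hk, hL0' i j hij] at h2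
    simp only
    linear_combination h2)
    (fun j h0 h1 => by
      exact_mod_cast hK'.apply_zero_eq_apply_one hk' hG h0 h1)
  refine ⟨h1.1, fun i j hij => ?_⟩
  have h2 := h1.2 i j hij
  simpa using h2

theorem tendsto_arg_add_I_atTop :
    Filter.Tendsto (fun x : ℝ => (x + Complex.I).arg) Filter.atTop (nhds 0) := by
  have h1 : Filter.Tendsto (fun x : ℝ => ((1 : ℂ) + (x⁻¹ : ℝ) * Complex.I).arg) Filter.atTop
      (nhds 0) := by
    have h2 : ContinuousAt (fun r : ℝ => ((1 : ℂ) + (r : ℝ) * Complex.I).arg) 0 := by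
      refine (Complex.continuousAt_arg ?_).comp (f := fun r : ℝ => (1 : ℂ) + (r : ℝ) * Complex.I)
        (by fun_prop)
      simp
    have h3 := h2.tendsto.comp tendsto_inv_atTop_zero
    simp only [Complex.ofReal_zero, zero_mul, add_zero, Complex.arg_one] at h3
    exact h3
  refine h1.congr' ?_
  filter_upwards [Filter.eventually_gt_atTop 0] with x hx
  rw [← Complex.arg_real_mul _ hx]
  congr 1
  have : (x : ℂ) ≠ 0 := by exact_mod_cast hx.ne'
  push_cast
  field_simp

theorem tendsto_arg_add_I_atBot :
    Filter.Tendsto (fun x : ℝ => (x + Complex.I).arg) Filter.atBot (nhds Real.pi) := by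
  have h1 := (tendsto_arg_add_I_atTop.comp Filter.tendsto_neg_atBot_atTop).const_sub Real.pi
  rw [sub_zero] at h1
  refine h1.congr fun x => ?_
  have h2 : (((-x : ℝ) : ℂ) + Complex.I) = -(starRingEnd ℂ) (x + Complex.I) := by
    apply Complex.ext <;> simp
  have h3 : ((x : ℂ) + Complex.I).arg ≠ Real.pi := fun h => by
    have := (Complex.arg_eq_pi_iff.1 h).2
    simp at this
  have h4 := Complex.arg_conj (x + Complex.I)
  rw [if_neg h3] at h4
  rw [Function.comp_apply, h2, Complex.arg_neg_eq_arg_add_pi_of_im_neg (by simp), h4]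
  ring

theorem tendsto_arg_add_arg (τ : ℤˣ) (e e' : ℝ) :
    Filter.Tendsto (fun j : ℕ => ((((τ : ℤ) : ℝ) * j + e : ℝ) + Complex.I).arg +
      ((-((τ : ℤ) : ℝ) * j + e' : ℝ) + Complex.I).arg) Filter.atTop (nhds Real.pi) := by
  have key : ∀ e e' : ℝ, Filter.Tendsto (fun j : ℕ => ((j + e : ℝ) + Complex.I).arg +
      ((-j + e' : ℝ) + Complex.I).arg) Filter.atTop (nhds Real.pi) := by
    intro e e'
    have h1 : Filter.Tendsto (fun j : ℕ => (j + e : ℝ)) Filter.atTop Filter.atTop :=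
      Filter.tendsto_atTop_add_const_right _ _ tendsto_natCast_atTop_atTop
    have h2 : Filter.Tendsto (fun j : ℕ => (-j + e' : ℝ)) Filter.atTop Filter.atBot :=
      Filter.tendsto_atBot_add_const_right _ _
        (Filter.tendsto_neg_atTop_atBot.comp tendsto_natCast_atTop_atTop)
    have := (tendsto_arg_add_I_atTop.comp h1).add (tendsto_arg_add_I_atBot.comp h2)
    rwa [zero_add] at this
  rcases Int.units_eq_one_or τ with rfl | rfl
  · simpa using key e e'
  · refine (key e' e).congr fun j => ?_
    rw [add_comm]
    simp

/-- `f` is isotopic, relative to the integer points of the lines `ℝ + i` and `ℝ + 2i`, to a map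
translating these lines by the signs `ε` and `δ`. -/
def IsStraightened (f : ℂ → ℂ) (ε δ : ℤˣ) : Prop :=
  ∃ F : unitInterval × ℂ → ℂ, Continuous F ∧ (∀ t, Function.Injective fun z => F (t, z)) ∧
    (∀ z, F (0, z) = f z) ∧
    (∀ t (n : ℤ), F (t, n + Complex.I) = n + ((ε : ℤ) + Complex.I)) ∧
    (∀ t (n : ℤ), F (t, n + 2 * Complex.I) = n + ((δ : ℤ) + 2 * Complex.I)) ∧
    (∀ x : ℝ, F (1, x + Complex.I) = x + ((ε : ℤ) + Complex.I)) ∧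
    ∀ x : ℝ, F (1, x + 2 * Complex.I) = x + ((δ : ℤ) + 2 * Complex.I)

theorem isLineShift_lineParam {f : ℂ → ℂ} {F : unitInterval × ℂ → ℂ} (hF : Continuous F)
    (hi : ∀ t, Function.Injective fun z => F (t, z)) (h0 : ∀ z, F (0, z) = f z) {ε : ℤˣ} {c : ℂ}
    (hn : ∀ t (n : ℤ), F (t, n + c) = n + ((ε : ℤ) + c))
    (h1 : ∀ x : ℝ, F (1, x + c) = x + ((ε : ℤ) + c)) (m : ℤ) :
    IsLineShift fun z => (lineParam ε (m + c)).symm (f (lineParam ε (m + c) z)) := by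
  refine ⟨fun p => (lineParam ε (m + c)).symm (F (p.1, lineParam ε (m + c) p.2)), by fun_prop,
    fun t => (lineParam ε (m + c)).symm.injective.comp
      ((hi t).comp (lineParam ε (m + c)).injective), fun z => by simp [h0], fun t n => ?_,
    fun x => ?_⟩
  · have := hn t ((ε : ℤ) * n + m)
    push_cast at this
    simp only [lineParam_apply, lineParam_symm_apply]
    rw [← add_assoc, this]
    linear_combination (n + 1 : ℂ) * Int.units_coe_mul_self_complex ε
  · have := h1 ((ε : ℤ) * x + m)
    push_cast at this
    simp only [lineParam_apply, lineParam_symm_apply]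
    rw [← add_assoc, this]
    linear_combination (x + 1 : ℂ) * Int.units_coe_mul_self_complex ε

namespace IsStraightened

variable {f : ℂ ≃ₜ ℂ} {ε δ : ℤˣ}

theorem apply_one (h : IsStraightened f ε δ) (n : ℤ) :
    f (n + Complex.I) = n + ((ε : ℤ) + Complex.I) := by
  obtain ⟨F, -, -, h0, h1, -⟩ := h
  rw [← h0, h1]

theorem apply_two (h : IsStraightened f ε δ) (n : ℤ) :
    f (n + 2 * Complex.I) = n + ((δ : ℤ) + 2 * Complex.I) := by
  obtain ⟨F, -, -, h0, -, h1, -⟩ := h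
  rw [← h0, h1]

theorem isLineShift_one (h : IsStraightened f ε δ) (m : ℤ) :
    IsLineShift fun z => (lineParam ε (m + Complex.I)).symm (f (lineParam ε (m + Complex.I) z)) := by
  obtain ⟨F, hF, hi, h0, h1, -, h2, -⟩ := h
  exact isLineShift_lineParam hF hi h0 h1 h2 m

theorem isLineShift_two (h : IsStraightened f ε δ) (m : ℤ) :
    IsLineShift fun z =>
      (lineParam δ (m + 2 * Complex.I)).symm (f (lineParam δ (m + 2 * Complex.I) z)) := by
  obtain ⟨F, hF, hi, h0, -, h1, -, h2⟩ := h
  exact isLineShift_lineParam hF hi h0 h1 h2 m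

end IsStraightened

theorem ofReal_add_I_ne_zero (x : ℝ) : (x : ℂ) + Complex.I ≠ 0 := fun h => by
  simpa using congrArg Complex.im h

theorem tendsto_natCast_add_cocompact (c : ℂ) :
    Filter.Tendsto (fun j : ℕ => (j : ℂ) + c) Filter.atTop (Filter.cocompact ℂ) := by
  have h1 : Filter.Tendsto (fun j : ℕ => (j : ℂ)) Filter.atTop (Filter.cocompact ℂ) := by
    rw [← Metric.cobounded_eq_cocompact, ← tendsto_norm_atTop_iff_cobounded]
    simpa using tendsto_natCast_atTop_atTop (R := ℝ)
  exact (Homeomorph.addRight c).isClosedEmbedding.tendsto_cocompact.comp h1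

theorem tendsto_im_log_sub_log (e : ℝ) :
    Filter.Tendsto (fun j : ℕ => (Complex.log ((j + e : ℝ) + Complex.I) -
      Complex.log ((j : ℝ) + Complex.I)).im) Filter.atTop (nhds 0) := by
  have h1 : Filter.Tendsto (fun j : ℕ => (j + e : ℝ)) Filter.atTop Filter.atTop :=
    Filter.tendsto_atTop_add_const_right _ _ tendsto_natCast_atTop_atTop
  have := (tendsto_arg_add_I_atTop.comp h1).sub
    (tendsto_arg_add_I_atTop.comp tendsto_natCast_atTop_atTop)
  simpa [Complex.sub_im, Complex.log_im] using this

/-- A straightened map has a pair logarithm whose values on the integer points of the two lines are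
those of the linear model. -/
theorem IsStraightened.exists_isPairLog {f : ℂ ≃ₜ ℂ} {ε δ : ℤˣ} (h : IsStraightened f ε δ)
    (hL : ∃ L, IsPairLog f L) :
    ∃ L, IsPairLog f L ∧
      (∀ i j : ℤ, i ≠ j → L (i + Complex.I, j + Complex.I) = 0) ∧
      (∀ i j : ℤ, i ≠ j → L (i + 2 * Complex.I, j + 2 * Complex.I) = 0) ∧
      ∀ i j : ℤ, L (i + Complex.I, j + 2 * Complex.I) =
        Complex.log ((j - i + (δ : ℤ) - (ε : ℤ) : ℝ) + Complex.I) -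
          Complex.log ((j - i : ℝ) + Complex.I) := by
  obtain ⟨L, hL⟩ := hL
  obtain ⟨F, hF, hi, h0, hn1, hn2, hx1, hx2⟩ := h
  obtain ⟨M, hM, hML⟩ := hL.of_isotopy F hF hi h0 (fun x => rfl)
    ({z | ∃ n : ℤ, z = n + Complex.I} ∪ {z | ∃ n : ℤ, z = n + 2 * Complex.I}) (by
      rintro t _ (⟨n, rfl⟩ | ⟨n, rfl⟩)
      · rw [← h0, hn1, hn1]
      · rw [← h0, hn2, hn2])
  obtain ⟨m₁, hm₁⟩ := hM.exists_int_eq_of_line hx1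
  obtain ⟨m₂, hm₂⟩ := hM.exists_int_eq_of_line hx2
  have hne : ∀ x y : ℝ, (x : ℂ) + Complex.I ≠ y + 2 * Complex.I := fun x y h => by
    simpa using congrArg Complex.im h
  obtain ⟨μ, hμ⟩ := exists_int_sub_eq_on (X := ℝ × ℝ) isPreconnected_univ
    (u := fun p => M (p.1 + Complex.I, p.2 + 2 * Complex.I))
    (v := fun p => Complex.log ((p.2 - p.1 + (δ : ℤ) - (ε : ℤ) : ℝ) + Complex.I) -
      Complex.log ((p.2 - p.1 : ℝ) + Complex.I))
    (hM.1.comp (by fun_prop) fun p _ => hne p.1 p.2)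
    (by
      refine ContinuousOn.sub ?_ ?_ <;>
      exact ContinuousOn.clog (by fun_prop) fun p _ => by simp [Complex.mem_slitPlane_iff])
    (by
      rintro ⟨x, y⟩ -
      rw [hM.exp_eq (hne x y), hx1, hx2, Complex.exp_sub, Complex.exp_log (ofReal_add_I_ne_zero _),
        Complex.exp_log (ofReal_add_I_ne_zero _)]
      push_cast
      congr 1 <;> ring)
  have hmem1 : ∀ n : ℤ, (n : ℂ) + Complex.I ∈
      ({z | ∃ n : ℤ, z = n + Complex.I} ∪ {z | ∃ n : ℤ, z = n + 2 * Complex.I} : Set ℂ) :=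
    fun n => Or.inl ⟨n, rfl⟩
  have hmem2 : ∀ n : ℤ, (n : ℂ) + 2 * Complex.I ∈
      ({z | ∃ n : ℤ, z = n + Complex.I} ∪ {z | ∃ n : ℤ, z = n + 2 * Complex.I} : Set ℂ) :=
    fun n => Or.inr ⟨n, rfl⟩
  have e1 : ∀ i j : ℤ, i ≠ j → L (i + Complex.I, j + Complex.I) =
      m₁ * (2 * Real.pi * Complex.I) := fun i j hij => by
    rw [← hML _ (hmem1 i) _ (hmem1 j) (by simpa using hij)]
    exact_mod_cast hm₁ i j (by exact_mod_cast hij)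
  have e2 : ∀ i j : ℤ, i ≠ j → L (i + 2 * Complex.I, j + 2 * Complex.I) =
      m₂ * (2 * Real.pi * Complex.I) := fun i j hij => by
    rw [← hML _ (hmem2 i) _ (hmem2 j) (by simpa using hij)]
    exact_mod_cast hm₂ i j (by exact_mod_cast hij)
  have e3 : ∀ i j : ℤ, L (i + Complex.I, j + 2 * Complex.I) =
      Complex.log ((j - i + (δ : ℤ) - (ε : ℤ) : ℝ) + Complex.I) -
          Complex.log ((j - i : ℝ) + Complex.I) + μ * (2 * Real.pi * Complex.I) := fun i j => by
    rw [← hML _ (hmem1 i) _ (hmem2 j) (by exact_mod_cast hne i j)]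
    have := hμ (i, j) trivial
    simp only [Complex.ofReal_intCast] at this
    exact this
  have hmμ : ∀ {m : ℤ} {u v : ℕ → ℂ}, Filter.Tendsto (fun j => (u j).im - (v j).im) Filter.atTop
      (nhds 0) → (∀ᶠ j in Filter.atTop, u j = m * (2 * Real.pi * Complex.I)) →
      (∀ j : ℕ, v j = Complex.log ((j + ((δ : ℤ) - (ε : ℤ) : ℝ) : ℝ) + Complex.I) -
          Complex.log ((j : ℝ) + Complex.I) + μ * (2 * Real.pi * Complex.I)) → m = μ := by
    intro m u v h1 h2 h3
    have h4 := h1.add (tendsto_im_log_sub_log ((δ : ℤ) - (ε : ℤ) : ℝ))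
    have h5 : Filter.Tendsto (fun _ : ℕ => (m - μ : ℝ) * (2 * Real.pi)) Filter.atTop
        (nhds (0 + 0)) := by
      refine h4.congr' ?_
      filter_upwards [h2] with j hj
      rw [hj, h3]
      simp
      ring
    have h6 := tendsto_nhds_unique h5 tendsto_const_nhds
    have h7 : (m - μ : ℝ) = 0 := by
      have := Real.pi_pos
      rcases mul_eq_zero.1 (h6.symm.trans (add_zero 0)) with h | h
      · exact h
      · linarith
    exact_mod_cast sub_eq_zero.1 h7
  have hm2 : m₂ = μ := by
    refine hmμ (hL.tendsto_im_sub (0 + Complex.I) (0 + 2 * Complex.I)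
      (tendsto_natCast_add_cocompact (2 * Complex.I))) ?_ fun j => ?_
    · filter_upwards [Filter.eventually_gt_atTop 0] with j hj
      have := e2 0 j (by exact_mod_cast hj.ne)
      push_cast at this
      exact this
    · have := e3 0 j
      push_cast at this
      rw [this]
      push_cast
      congr 3 <;> ring
  have hm1 : m₁ = μ := by
    have hb : Filter.Tendsto (fun j : ℕ => -((j : ℂ) + -Complex.I)) Filter.atTop
        (Filter.cocompact ℂ) :=
      (Homeomorph.neg ℂ).isClosedEmbedding.tendsto_cocompact.comp (tendsto_natCast_add_cocompact _)
    refine hmμ (hL.tendsto_im_sub (0 + 2 * Complex.I) (0 + Complex.I) hb) ?_ fun j => ?_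
    · filter_upwards [Filter.eventually_gt_atTop 0] with j hj
      have := e1 0 (-j) (by simpa using hj.ne')
      push_cast at this
      rw [← this]
      congr 2
      ring
    · have := e3 (-j) 0
      have h1 : -((j : ℂ) + -Complex.I) = ((-j : ℤ) : ℂ) + Complex.I := by
        push_cast
        ring
      rw [h1, hL.symm_apply _ _ (by have := hne (-j) 0; push_cast at this ⊢; exact this.symm)]
      push_cast at this
      push_cast
      rw [this]
      congr 3 <;> ring
  refine ⟨_, hL.add_int (-μ), fun i j hij => ?_, fun i j hij => ?_, fun i j => ?_⟩
  · rw [e1 i j hij, hm1]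
    push_cast
    ring
  · rw [e2 i j hij, hm2]
    push_cast
    ring
  · rw [e3 i j]
    push_cast
    ring

theorem lineParam_units_mul (ε : ℤˣ) (c : ℂ) (n : ℤ) :
    lineParam ε c ((ε : ℤ) * n : ℤ) = n + c := by
  rw [lineParam_apply]
  push_cast
  linear_combination (n : ℂ) * Int.units_coe_mul_self_complex ε

theorem semiconj_orbit {k f f' : ℂ ≃ₜ ℂ} (hkf : ∀ z, k (f z) = f' (k z)) {a b : ℤ → ℂ}
    (ha : ∀ n, f (a n) = a (n + 1)) (hb : ∀ n, f' (b n) = b (n + 1)) (h0 : k (a 0) = b 0) (n : ℤ) :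
    k (a n) = b n := by
  have key : ∀ n, k (a (n + 1)) = b (n + 1) ↔ k (a n) = b n := fun n => by
    rw [← ha, ← hb, hkf, f'.injective.eq_iff]
  induction n with
  | zero => exact h0
  | succ n ih => exact (key n).2 ih
  | pred n ih =>
    rw [← key]
    simpa using ih

theorem log_displacement_lineParam_eq {f : ℂ ≃ₜ ℂ} {L : ℂ × ℂ → ℂ} (hL : IsPairLog f L)
    (hfix : ∀ x, f x ≠ x) {ε : ℤˣ} {c : ℂ}
    (hf : ∀ n : ℤ, f (lineParam ε c n) = lineParam ε c (n + 1))
    (hL0 : ∀ i j : ℤ, i ≠ j → L (lineParam ε c i, lineParam ε c j) = 0) {Θ : ℂ → ℂ}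
    (hΘ : Continuous Θ) (hΘ' : ∀ x, Complex.exp (Θ x) = f x - x) (m n : ℤ) :
    Θ (lineParam ε c m) = Θ (lineParam ε c n) := by
  obtain ⟨l, hl⟩ := exists_exp_eq_units ε
  have h1 := Int.units_coe_mul_self_complex ε
  have h2 := log_displacement_orbit_eq
    (f := ((lineParam ε c).trans f).trans (lineParam ε c).symm)
    (hL.conj_lineParam ε ε c c (l := 0) (by rw [h1, Complex.exp_zero]))
    (fun x hx => hfix (lineParam ε c x) ((lineParam ε c).symm_apply_eq.1 hx))
    (fun n => (lineParam ε c).symm_apply_eq.2 (hf n))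
    (fun i j hij => by rw [hL0 i j hij, add_zero])
    (Θ := fun z => Θ (lineParam ε c z) + l) (by fun_prop)
    (fun z => by
      rw [Complex.exp_add, hΘ', hl]
      simp only [Homeomorph.trans_apply, lineParam_symm_apply, lineParam_apply]
      linear_combination -z * h1) m n
  exact add_right_cancel h2

theorem tendsto_lineParam_cocompact (ε τ : ℤˣ) (c : ℂ) :
    Filter.Tendsto (fun j : ℕ => lineParam ε c ((τ : ℤ) * j : ℤ)) Filter.atTop
      (Filter.cocompact ℂ) := by
  have h1 := (lineParam (ε * τ) c).isClosedEmbedding.tendsto_cocompact.comp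
    (tendsto_natCast_add_cocompact 0)
  refine h1.congr fun j => ?_
  simp only [Function.comp_apply, lineParam_apply, add_zero]
  push_cast
  ring

theorem IsPairLog.tendsto_im_lineParam {k : ℂ ≃ₜ ℂ} {K : ℂ × ℂ → ℂ} (hK : IsPairLog k K) {ε : ℤˣ}
    {c u : ℂ} (hu : ∀ i j : ℤ, i ≠ j → K (lineParam ε c i, lineParam ε c j) = u) (b : ℂ) (τ : ℤˣ) :
    Filter.Tendsto (fun j : ℕ => (K (b, lineParam ε c ((τ : ℤ) * j : ℤ))).im) Filter.atTop
      (nhds u.im) := by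
  have h1 := (hK.tendsto_im_sub (lineParam ε c (0 : ℤ)) b
    (tendsto_lineParam_cocompact ε τ c)).add_const u.im
  rw [zero_add] at h1
  refine h1.congr' ?_
  filter_upwards [Filter.eventually_gt_atTop 0] with j hj
  rw [hu _ _ (mul_ne_zero τ.ne_zero (by exact_mod_cast hj.ne')).symm]
  ring

theorem IsPairLog.im_eq_im_of_shift {k : ℂ ≃ₜ ℂ} {K : ℂ × ℂ → ℂ} (hK : IsPairLog k K)
    {ε δ ε' δ' : ℤˣ} {u v : ℂ} (m : ℝ)
    (hu : ∀ i j : ℤ, i ≠ j → K (lineParam ε Complex.I i, lineParam ε Complex.I j) = u)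
    (hv : ∀ i j : ℤ, i ≠ j → K (lineParam δ (2 * Complex.I) i, lineParam δ (2 * Complex.I) j) = v)
    {X : ℤ → ℤ → ℂ}
    (hX : ∀ i j : ℤ, X i j = K (lineParam ε Complex.I i, lineParam δ (2 * Complex.I) j) -
      Complex.log (((δ' : ℤ) * j - (ε' : ℤ) * i + m : ℝ) + Complex.I) +
      Complex.log (((δ : ℤ) * j - (ε : ℤ) * i : ℝ) + Complex.I))
    (hshift : ∀ i j : ℤ, X (i + 1) (j + 1) = X i j) : u.im = v.im := by
  have hX0 : ∀ n i : ℤ, X (n + i) n = X i 0 := by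
    intro n i
    induction n with
    | zero => rw [zero_add]
    | succ n ih =>
      rw [← ih, ← hshift (n + i) n]
      congr 1
      ring
    | pred n ih =>
      rw [← ih, ← hshift]
      congr 1 <;> ring
  have hne : ∀ i j : ℤ, lineParam ε Complex.I i ≠ lineParam δ (2 * Complex.I) j := fun i j h => by
    have := congrArg Complex.im h
    simp [lineParam_apply] at this
  have h1 : Filter.Tendsto (fun j : ℕ => (X 0 ((1 : ℤˣ) * j)).im + (X 0 ((-1 : ℤˣ) * j)).im)
      Filter.atTop (nhds (v.im + v.im - Real.pi + Real.pi)) := by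
    refine (((hK.tendsto_im_lineParam hv (lineParam ε Complex.I (0 : ℤ)) 1).add
      (hK.tendsto_im_lineParam hv (lineParam ε Complex.I (0 : ℤ)) (-1))).sub
      (tendsto_arg_add_arg δ' m m)).add (tendsto_arg_add_arg δ 0 0) |>.congr fun j => ?_
    rw [hX, hX]
    simp only [Complex.add_im, Complex.sub_im, Complex.log_im]
    push_cast
    simp only [mul_zero, sub_zero, one_mul, neg_mul, mul_neg, add_zero]
    ring
  have h2 : Filter.Tendsto (fun j : ℕ => (X ((1 : ℤˣ) * j) 0).im + (X ((-1 : ℤˣ) * j) 0).im)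
      Filter.atTop (nhds (u.im + u.im - Real.pi + Real.pi)) := by
    refine (((hK.tendsto_im_lineParam hu (lineParam δ (2 * Complex.I) (0 : ℤ)) 1).add
      (hK.tendsto_im_lineParam hu (lineParam δ (2 * Complex.I) (0 : ℤ)) (-1))).sub
      (tendsto_arg_add_arg ε' m m)).add (tendsto_arg_add_arg ε 0 0) |>.congr fun j => ?_
    rw [hX, hX, hK.symm_apply _ _ (hne _ _).symm, hK.symm_apply _ _ (hne _ _).symm]
    simp only [Complex.add_im, Complex.sub_im, Complex.log_im]
    push_cast
    simp only [mul_zero, zero_sub, one_mul, neg_mul, mul_neg, add_zero, neg_neg]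
    ring
  have h3 := tendsto_nhds_unique (h2.congr fun j => ?_) h1
  · linarith
  · rw [← hX0 ((-1 : ℤˣ) * j), ← hX0 ((1 : ℤˣ) * j) ((-1 : ℤˣ) * j), add_comm]
    push_cast
    simp

namespace IsStraightened

variable {k f f' : ℂ ≃ₜ ℂ} {ε δ ε' δ' : ℤˣ}

theorem apply_lineParam_one (h : IsStraightened f ε δ) (m n : ℤ) :
    f (lineParam ε (m + Complex.I) n) = lineParam ε (m + Complex.I) (n + 1) := by
  have := h.apply_one ((ε : ℤ) * n + m)
  simp only [lineParam_apply]
  push_cast at this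
  rw [← add_assoc, this]
  ring

theorem apply_lineParam_two (h : IsStraightened f ε δ) (m n : ℤ) :
    f (lineParam δ (m + 2 * Complex.I) n) = lineParam δ (m + 2 * Complex.I) (n + 1) := by
  have := h.apply_two ((δ : ℤ) * n + m)
  simp only [lineParam_apply]
  push_cast at this
  rw [← add_assoc, this]
  ring

/-- A conjugacy between straightened fixed point free maps preserves the variation of the argument
of the displacement between the two lines. -/
theorem im_log_displacement_sub_eq (hK : ∃ K, IsPairLog k K) (hL : ∃ L, IsPairLog f L)
    (hL' : ∃ L, IsPairLog f' L) (hkf : ∀ z, k (f z) = f' (k z)) (hf : IsStraightened f ε δ)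
    (hf' : IsStraightened f' ε' δ') (hfix : ∀ x, f x ≠ x) {m₁ m₂ : ℤ}
    (hk1 : k Complex.I = m₁ + Complex.I) (hk2 : k (2 * Complex.I) = m₂ + 2 * Complex.I)
    {Θ Θ' : ℂ → ℂ} (hΘ : Continuous Θ) (hΘe : ∀ x, Complex.exp (Θ x) = f x - x)
    (hΘ' : Continuous Θ') (hΘe' : ∀ x, Complex.exp (Θ' x) = f' x - x) (p q p' q' : ℤ) :
    (Θ (q + 2 * Complex.I)).im - (Θ (p + Complex.I)).im =
      (Θ' (q' + 2 * Complex.I)).im - (Θ' (p' + Complex.I)).im := by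
  obtain ⟨K, hK⟩ := hK
  obtain ⟨L, hL, hL1, hL2, hL12⟩ := hf.exists_isPairLog hL
  obtain ⟨L', hL', hL1', hL2', hL12'⟩ := hf'.exists_isPairLog hL'
  have hfix' : ∀ x, f' x ≠ x := fun x hx => hfix (k.symm x) (k.injective (by simp [hkf, hx]))
  set A : ℂ ≃ₜ ℂ := lineParam ε Complex.I with hA
  set C : ℂ ≃ₜ ℂ := lineParam δ (2 * Complex.I) with hC
  set A' : ℂ ≃ₜ ℂ := lineParam ε' (m₁ + Complex.I) with hA'
  set C' : ℂ ≃ₜ ℂ := lineParam δ' (m₂ + 2 * Complex.I) with hC'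
  have hfA : ∀ n : ℤ, f (A n) = A (n + 1) := fun n => by simpa using hf.apply_lineParam_one 0 n
  have hfC : ∀ n : ℤ, f (C n) = C (n + 1) := fun n => by simpa using hf.apply_lineParam_two 0 n
  have hfA' : ∀ n : ℤ, f' (A' n) = A' (n + 1) := hf'.apply_lineParam_one m₁
  have hfC' : ∀ n : ℤ, f' (C' n) = C' (n + 1) := hf'.apply_lineParam_two m₂
  have hAz : ∀ n : ℤ, A n = ((ε : ℤ) * n : ℤ) + Complex.I := fun n => by
    simp [hA, lineParam_apply]
  have hCz : ∀ n : ℤ, C n = ((δ : ℤ) * n : ℤ) + 2 * Complex.I := fun n => by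
    simp [hC, lineParam_apply]
  have hAz' : ∀ n : ℤ, A' n = ((ε' : ℤ) * n + m₁ : ℤ) + Complex.I := fun n => by
    simp [hA', lineParam_apply, add_assoc]
  have hCz' : ∀ n : ℤ, C' n = ((δ' : ℤ) * n + m₂ : ℤ) + 2 * Complex.I := fun n => by
    simp [hC', lineParam_apply, add_assoc]
  have hkA : ∀ n : ℤ, k (A n) = A' n :=
    semiconj_orbit hkf (a := fun n => A n) (b := fun n => A' n) (by simpa using hfA)
      (by simpa using hfA') (by
      show k (A (0 : ℤ)) = A' (0 : ℤ)
      rw [hAz, hAz']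
      simpa using hk1)
  have hkC : ∀ n : ℤ, k (C n) = C' n :=
    semiconj_orbit hkf (a := fun n => C n) (b := fun n => C' n) (by simpa using hfC)
      (by simpa using hfC') (by
      show k (C (0 : ℤ)) = C' (0 : ℤ)
      rw [hCz, hCz']
      simpa using hk2)
  have hinj : ∀ (τ : ℤˣ) (m : ℤ) {i j : ℤ}, i ≠ j → (τ : ℤ) * i + m ≠ τ * j + m :=
    fun τ m i j hij h => hij (mul_left_cancel₀ τ.ne_zero (add_right_cancel h))
  have hLA : ∀ i j : ℤ, i ≠ j → L (A i, A j) = 0 := fun i j hij => by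
    rw [hAz, hAz]
    exact hL1 _ _ (by simpa using hinj ε 0 hij)
  have hLC : ∀ i j : ℤ, i ≠ j → L (C i, C j) = 0 := fun i j hij => by
    rw [hCz, hCz]
    exact hL2 _ _ (by simpa using hinj δ 0 hij)
  have hLA' : ∀ i j : ℤ, i ≠ j → L' (A' i, A' j) = 0 := fun i j hij => by
    rw [hAz', hAz']
    exact hL1' _ _ (hinj ε' m₁ hij)
  have hLC' : ∀ i j : ℤ, i ≠ j → L' (C' i, C' j) = 0 := fun i j hij => by
    rw [hCz', hCz']
    exact hL2' _ _ (hinj δ' m₂ hij)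
  obtain ⟨κ, hκ⟩ : ∃ κ : ℂ, ∀ x y, x ≠ y → K (f x, f y) + L (x, y) = L' (k x, k y) + K (x, y) + κ := by
    have h1 := hK.comp hL f.continuous
    have h2 := hL'.comp hK k.continuous
    rw [show k ∘ f = f' ∘ k from funext hkf] at h1
    obtain ⟨n, hn⟩ := h1.unique h2
    exact ⟨_, hn⟩
  obtain ⟨hκ0, hu⟩ := hK.eq_on_line hL hL' hkf (by simpa using hf.isLineShift_one 0)
    (hf'.isLineShift_one m₁) hkA hfA hLA hLA' hκ
  obtain ⟨-, hv⟩ := hK.eq_on_line hL hL' hkf (by simpa using hf.isLineShift_two 0)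
    (hf'.isLineShift_two m₂) hkC hfC hLC hLC' hκ
  have hAC : ∀ i j : ℤ, A i ≠ C j := fun i j h => by
    have := congrArg Complex.im h
    simp [hA, hC, lineParam_apply] at this
  have huv := hK.im_eq_im_of_shift (ε' := ε') (δ' := δ') (m₂ - m₁ : ℝ) hu hv (X := fun i j => _)
    (fun i j => rfl) (by
      intro i j
      have h1 := hκ _ _ (hAC i j)
      rw [hfA, hfC, hkA, hkC, hAz', hCz', hL12', hκ0] at h1
      rw [show L (A i, C j) = _ by rw [hAz, hCz, hL12]] at h1
      have e1 : ((δ' : ℤ) * (j + 1 : ℤ) - (ε' : ℤ) * (i + 1 : ℤ) + (m₂ - m₁) : ℝ) =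
          (((δ' : ℤ) * j + m₂ : ℤ) - ((ε' : ℤ) * i + m₁ : ℤ) + (δ' : ℤ) - (ε' : ℤ) : ℝ) := by
        push_cast
        ring
      have e2 : ((δ' : ℤ) * j - (ε' : ℤ) * i + (m₂ - m₁) : ℝ) =
          (((δ' : ℤ) * j + m₂ : ℤ) - ((ε' : ℤ) * i + m₁ : ℤ) : ℝ) := by
        push_cast
        ring
      have e3 : ((δ : ℤ) * (j + 1 : ℤ) - (ε : ℤ) * (i + 1 : ℤ) : ℝ) =
          (((δ : ℤ) * j : ℤ) - ((ε : ℤ) * i : ℤ) + (δ : ℤ) - (ε : ℤ) : ℝ) := by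
        push_cast
        ring
      have e4 : ((δ : ℤ) * j - (ε : ℤ) * i : ℝ) =
          (((δ : ℤ) * j : ℤ) - ((ε : ℤ) * i : ℤ) : ℝ) := by
        push_cast
        ring
      rw [e1, e2, e3, e4]
      rw [Int.cast_add i 1, Int.cast_add j 1, Int.cast_one]
      linear_combination h1)
  obtain ⟨n, hn⟩ := exists_int_sub_eq_on (X := ℂ) isPreconnected_univ
    (u := fun x => Θ' (k x)) (v := fun x => Θ x + K (x, f x)) (by fun_prop)
    (hΘ.continuousOn.add (hK.1.comp (by fun_prop) fun x _ => (hfix x).symm)) (by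
      intro x _
      rw [Complex.exp_add, hΘe, hΘe', mul_comm, hK.2 _ _ (hfix x).symm, hkf])
  have hn1 := hn (A (0 : ℤ)) trivial
  have hn2 := hn (C (0 : ℤ)) trivial
  have h01 : (0 : ℤ) ≠ 1 := zero_ne_one
  have hv' := hv 0 1 h01
  have hu' := hu 0 1 h01
  rw [hkA, hfA, ← Int.cast_one, ← Int.cast_add, zero_add, hu'] at hn1
  rw [hkC, hfC, ← Int.cast_one, ← Int.cast_add, zero_add, hv'] at hn2
  have hp : Θ (p + Complex.I) = Θ (A (0 : ℤ)) := by
    rw [← lineParam_units_mul ε]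
    exact log_displacement_lineParam_eq hL hfix hfA hLA hΘ hΘe _ _
  have hq : Θ (q + 2 * Complex.I) = Θ (C (0 : ℤ)) := by
    rw [← lineParam_units_mul δ]
    exact log_displacement_lineParam_eq hL hfix hfC hLC hΘ hΘe _ _
  have hp' : Θ' (p' + Complex.I) = Θ' (A' (0 : ℤ)) := by
    rw [show (p' : ℂ) + Complex.I = (p' - m₁ : ℤ) + (m₁ + Complex.I) by push_cast; ring,
      ← lineParam_units_mul ε']
    exact log_displacement_lineParam_eq hL' hfix' hfA' hLA' hΘ' hΘe' _ _
  have hq' : Θ' (q' + 2 * Complex.I) = Θ' (C' (0 : ℤ)) := by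
    rw [show (q' : ℂ) + 2 * Complex.I = (q' - m₂ : ℤ) + (m₂ + 2 * Complex.I) by push_cast; ring,
      ← lineParam_units_mul δ']
    exact log_displacement_lineParam_eq hL' hfix' hfC' hLC' hΘ' hΘe' _ _
  rw [hp, hq, hp', hq', hn1, hn2]
  simp only [Complex.add_im]
  linarith
end IsStraightened

/-- The identification of the plane with the complex numbers. -/
noncomputable def planeComplex : Plane ≃ₜ ℂ := Complex.equivRealProdCLM.symm.toHomeomorph

theorem planeComplex_apply (p : Plane) : planeComplex p = p.1 + p.2 * Complex.I :=
  Complex.equivRealProd_symm_apply p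

theorem planeComplex_sub (p q : Plane) : planeComplex (p - q) = planeComplex p - planeComplex q := by
  simp only [planeComplex_apply, Prod.fst_sub, Prod.snd_sub]
  push_cast
  ring

theorem norm_planeComplex (p : Plane) : ‖planeComplex p‖ = planeNorm p := by
  rw [planeComplex_apply, Complex.norm_add_mul_I, planeNorm]

theorem planeComplex_line_one (x : ℝ) : planeComplex (x, 1) = x + Complex.I := by
  simp [planeComplex_apply]

theorem planeComplex_line_two (x : ℝ) : planeComplex (x, 2) = x + 2 * Complex.I := by
  simp [planeComplex_apply]

/-- A homeomorphism of the plane, viewed in the complex coordinate. -/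
noncomputable def complexConj (h : Plane ≃ₜ Plane) : ℂ ≃ₜ ℂ :=
  (planeComplex.symm.trans h).trans planeComplex

theorem complexConj_planeComplex (h : Plane ≃ₜ Plane) (p : Plane) :
    complexConj h (planeComplex p) = planeComplex (h p) := by
  simp [complexConj]

theorem IsotopicRel.exists_complex {g g' : Plane ≃ₜ Plane} {O : Set Plane}
    (h : IsotopicRel g g' O) :
    ∃ F : unitInterval × ℂ → ℂ, Continuous F ∧ (∀ t, Function.Injective fun z => F (t, z)) ∧
      (∀ z, F (0, z) = complexConj g z) ∧ (∀ z, F (1, z) = complexConj g' z) ∧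
      ∀ t, ∀ p ∈ O, F (t, planeComplex p) = planeComplex (g p) := by
  obtain ⟨F, hF, hi, h0, h1, hO⟩ := h
  refine ⟨fun q => planeComplex (F (q.1, planeComplex.symm q.2)), by fun_prop, fun t => ?_,
    fun z => by simp [h0, complexConj], fun z => by simp [h1, complexConj], fun t p hp => ?_⟩
  · obtain ⟨e, he⟩ := hi t t.2
    exact planeComplex.injective.comp fun z w hzw => planeComplex.symm.injective
      (e.injective (by rw [he, he]; exact hzw))
  · simp [hO t t.2 p hp]

theorem OrientationPreserving.exists_isPairLog {h : Plane ≃ₜ Plane} (hh : OrientationPreserving h) :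
    ∃ L, IsPairLog (complexConj h) L := by
  obtain ⟨F, hF, hi, h0, h1, -⟩ := IsotopicRel.exists_complex (g := Homeomorph.refl Plane) hh
  obtain ⟨M, hM, -⟩ := IsPairLog.id.of_isotopy F hF hi (fun z => by simp [h0, complexConj]) h1 ∅
    (by simp)
  exact ⟨M, hM⟩

theorem OrientationPreserving.conjH {h : Plane ≃ₜ Plane} (hh : OrientationPreserving h)
    (Φ : Plane ≃ₜ Plane) : OrientationPreserving (conjH Φ h) := by
  obtain ⟨F, hF, hi, h0, h1, -⟩ := hh
  refine ⟨fun q => Φ (F (q.1, Φ.symm q.2)), by fun_prop, fun t ht => ?_, fun x => by simp [h0],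
    fun x => by simp [h1, _root_.conjH], by simp⟩
  obtain ⟨e, he⟩ := hi t ht
  exact ⟨(Φ.symm.trans e).trans Φ, fun x => by simp [he]⟩

theorem IsBrouwer.conjH {h : Plane ≃ₜ Plane} (hh : IsBrouwer h) (Φ : Plane ≃ₜ Plane) :
    IsBrouwer (conjH Φ h) :=
  ⟨hh.1.conjH Φ, fun x hx => hh.2 (Φ.symm x) (Φ.injective (by simpa [_root_.conjH] using hx))⟩

theorem image_horbit (Φ h : Plane ≃ₜ Plane) (x : Plane) :
    Φ '' horbit h x = horbit (conjH Φ h) (Φ x) := by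
  have key : ∀ n : ℤ, ((conjH Φ h).toEquiv ^ n) (Φ x) = Φ ((h.toEquiv ^ n) x) := fun n => by
    have h1 : (conjH Φ h).toEquiv = Φ.toEquiv.permCongrHom h.toEquiv := rfl
    rw [h1, ← map_zpow]
    simp [Equiv.permCongrHom]
  ext y
  constructor
  · rintro ⟨_, ⟨n, rfl⟩, rfl⟩
    exact ⟨n, (key n).symm⟩
  · rintro ⟨n, rfl⟩
    exact ⟨_, ⟨n, rfl⟩, (key n).symm⟩

theorem exists_units_cast_eq {ε : ℝ} (h : ε = 1 ∨ ε = -1) : ∃ u : ℤˣ, ((u : ℤ) : ℝ) = ε := by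
  rcases h with rfl | rfl
  · exact ⟨1, by simp⟩
  · exact ⟨-1, by simp⟩

theorem AdmissibleStraightening.isStraightened {h Φ : Plane ≃ₜ Plane} {O₁ O₂ : Set Plane}
    (hΦ : AdmissibleStraightening h O₁ O₂ Φ) :
    ∃ ε δ : ℤˣ, IsStraightened (complexConj (conjH Φ h)) ε δ := by
  obtain ⟨-, -, -, ε₁, ε₂, h1, h2, g, hg1, hg2, hiso⟩ := hΦ
  obtain ⟨ε, rfl⟩ := exists_units_cast_eq h1
  obtain ⟨δ, rfl⟩ := exists_units_cast_eq h2
  obtain ⟨F, hF, hi, hF0, hF1, hO⟩ := hiso.exists_complex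
  have hl1 : ∀ x : ℝ, F (1, x + Complex.I) = x + ((ε : ℤ) + Complex.I) := fun x => by
    rw [hF1, ← planeComplex_line_one, complexConj_planeComplex, hg1, planeComplex_line_one]
    push_cast
    ring
  have hl2 : ∀ x : ℝ, F (1, x + 2 * Complex.I) = x + ((δ : ℤ) + 2 * Complex.I) := fun x => by
    rw [hF1, ← planeComplex_line_two, complexConj_planeComplex, hg2, planeComplex_line_two]
    push_cast
    ring
  refine ⟨ε, δ, F, hF, hi, hF0, fun t n => ?_, fun t n => ?_, hl1, hl2⟩
  · have h3 : ((n : ℝ), (1 : ℝ)) ∈ Z1 ∪ Z2 := Or.inl ⟨n, rfl⟩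
    have h4 := hl1 n
    rw [← planeComplex_line_one, hO 1 _ h3, ← hO t _ h3, planeComplex_line_one] at h4
    exact_mod_cast h4
  · have h3 : ((n : ℝ), (2 : ℝ)) ∈ Z1 ∪ Z2 := Or.inr ⟨n, rfl⟩
    have h4 := hl2 n
    rw [← planeComplex_line_two, hO 1 _ h3, ← hO t _ h3, planeComplex_line_two] at h4
    exact_mod_cast h4

theorem IsAngleFunction.sub_eq {h : Plane ≃ₜ Plane} {γ : ℝ → Plane} {θ : ℝ → ℝ}
    (hθ : IsAngleFunction h γ θ) (hγ : ContinuousOn γ (Icc 0 1)) {Θ : ℂ → ℂ} (hΘ : Continuous Θ)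
    (hΘe : ∀ x, Complex.exp (Θ x) = complexConj h x - x) :
    θ 1 - θ 0 = (Θ (planeComplex (γ 1))).im - (Θ (planeComplex (γ 0))).im := by
  obtain ⟨n, hn⟩ := exists_int_sub_eq_on (isPreconnected_Icc (a := (0 : ℝ)) (b := 1))
    (u := fun t => (θ t : ℂ) * Complex.I)
    (v := fun t => ((Θ (planeComplex (γ t))).im : ℂ) * Complex.I)
    (ContinuousOn.mul (Complex.continuous_ofReal.comp_continuousOn hθ.1) continuousOn_const)
    (ContinuousOn.mul ((Complex.continuous_ofReal.comp (Complex.continuous_im.comp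
      (hΘ.comp planeComplex.continuous))).comp_continuousOn hγ) continuousOn_const) (by
      intro t ht
      set z := Θ (planeComplex (γ t)) with hz
      have h1 : planeComplex (h (γ t) - γ t) = Complex.exp z := by
        rw [planeComplex_sub, ← complexConj_planeComplex, hΘe]
      have h2 : planeNorm (h (γ t) - γ t) = Real.exp z.re := by
        rw [← norm_planeComplex, h1, Complex.norm_exp]
      have h3 := congrArg planeComplex (hθ.2 t ht)
      rw [h1, h2, planeComplex_apply] at h3
      simp only [Prod.smul_fst, Prod.smul_snd, smul_eq_mul] at h3
      push_cast at h3
      have h4 : Complex.exp z = Complex.exp z.re * Complex.exp (z.im * Complex.I) := by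
        rw [← Complex.exp_add, Complex.re_add_im]
      rw [h4] at h3
      have h5 : Complex.exp z.re * (Complex.exp (θ t * Complex.I) -
          Complex.exp (z.im * Complex.I)) = 0 := by
        rw [Complex.exp_mul_I (θ t)]
        linear_combination -h3
      exact sub_eq_zero.1 ((mul_eq_zero.1 h5).resolve_left (Complex.exp_ne_zero _)))
  have h0 := congrArg Complex.im (hn 0 ⟨le_rfl, zero_le_one⟩)
  have h1 := congrArg Complex.im (hn 1 ⟨zero_le_one, le_rfl⟩)
  simp only [Complex.add_im, Complex.mul_I_im, Complex.ofReal_re] at h0 h1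
  linarith

/-- Conjugacy invariance of the Poincaré index:
`I(Ψ∘h∘Ψ⁻¹, Ψ(O₁), Ψ(O₂)) = I(h, O₁, O₂)`. -/
theorem index_conjugacy_invariance
    (h : Plane ≃ₜ Plane) (hB : IsBrouwer h)
    (x₁ x₂ : Plane) (O₁ O₂ : Set Plane)
    (hO₁ : O₁ = horbit h x₁) (hO₂ : O₂ = horbit h x₂) (hne : O₁ ≠ O₂)
    (Ψ : Plane ≃ₜ Plane) (hOPΨ : OrientationPreserving Ψ) :
    IsBrouwer (conjH Ψ h) ∧
    Ψ '' O₁ = horbit (conjH Ψ h) (Ψ x₁) ∧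
    Ψ '' O₂ = horbit (conjH Ψ h) (Ψ x₂) ∧
    Ψ '' O₁ ≠ Ψ '' O₂ ∧
    ∀ Φ Φ' : Plane ≃ₜ Plane,
      AdmissibleStraightening h O₁ O₂ Φ →
      AdmissibleStraightening (conjH Ψ h) (Ψ '' O₁) (Ψ '' O₂) Φ' →
      ∀ γ γ' : ℝ → Plane,
        ContinuousOn γ (Icc 0 1) → ContinuousOn γ' (Icc 0 1) →
        γ 0 ∈ Z1 → γ 1 ∈ Z2 → γ' 0 ∈ Z1 → γ' 1 ∈ Z2 →
        ∀ θ θ' : ℝ → ℝ,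
          IsAngleFunction (⇑(conjH Φ h)) γ θ →
          IsAngleFunction (⇑(conjH Φ' (conjH Ψ h))) γ' θ' →
          θ 1 - θ 0 = θ' 1 - θ' 0 := by
  subst hO₁ hO₂
  refine ⟨hB.conjH Ψ, image_horbit Ψ h x₁, image_horbit Ψ h x₂,
    fun he => hne (Ψ.injective.image_injective he), ?_⟩
  intro Φ Φ' hΦ hΦ' γ γ' hγ hγ' hγ0 hγ1 hγ0' hγ1' θ θ' hθ hθ'
  obtain ⟨ε, δ, hf⟩ := hΦ.isStraightened
  obtain ⟨ε', δ', hf'⟩ := hΦ'.isStraightened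
  have hBf := hB.conjH Φ
  have hBf' := (hB.conjH Ψ).conjH Φ'
  have hfix : ∀ {g : Plane ≃ₜ Plane}, IsBrouwer g → ∀ x, complexConj g x ≠ x := fun hg x hx =>
    hg.2 (planeComplex.symm x) (planeComplex.injective (by simpa [complexConj] using hx))
  obtain ⟨Θ, hΘ, hΘe⟩ := exists_log_displacement (complexConj (conjH Φ h)).continuous (hfix hBf)
  obtain ⟨Θ', hΘ', hΘe'⟩ :=
    exists_log_displacement (complexConj (conjH Φ' (conjH Ψ h))).continuous (hfix hBf')
  have hK : ∃ K, IsPairLog (complexConj ((Φ.symm.trans Ψ).trans Φ')) K := by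
    obtain ⟨K₁, hK₁⟩ := hΦ.1.exists_isPairLog
    obtain ⟨K₂, hK₂⟩ := hOPΨ.exists_isPairLog
    obtain ⟨K₃, hK₃⟩ := hΦ'.1.exists_isPairLog
    have h1 := (hK₃.comp hK₂ (complexConj Ψ).continuous).comp hK₁.symm
      (complexConj Φ).symm.continuous
    have h2 : complexConj ((Φ.symm.trans Ψ).trans Φ') =
        (complexConj Φ' ∘ complexConj Ψ) ∘ (complexConj Φ).symm := by
      ext1 z
      obtain ⟨w, rfl⟩ := (complexConj Φ).surjective z
      simp [complexConj]
    rw [← h2] at h1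
    exact ⟨_, h1⟩
  obtain ⟨p, hp⟩ := hγ0
  obtain ⟨q, hq⟩ := hγ1
  obtain ⟨p', hp'⟩ := hγ0'
  obtain ⟨q', hq'⟩ := hγ1'
  have himage : ∀ {O S : Set Plane} {Φ₁ Φ₂ : Plane ≃ₜ Plane}, Φ₁ '' O = S → Φ₂ '' (Ψ '' O) = S →
      ∀ x ∈ S, ((Φ₁.symm.trans Ψ).trans Φ₂) x ∈ S := by
    rintro O _ Φ₁ Φ₂ rfl h2 _ ⟨x, hx, rfl⟩
    rw [← h2]
    exact ⟨_, ⟨x, hx, rfl⟩, by simp⟩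
  obtain ⟨m₁, hm₁⟩ := himage hΦ.2.1 hΦ'.2.1 ((0 : ℤ), 1) ⟨0, rfl⟩
  obtain ⟨m₂, hm₂⟩ := himage hΦ.2.2.1 hΦ'.2.2.1 ((0 : ℤ), 2) ⟨0, rfl⟩
  rw [hθ.sub_eq hγ hΘ hΘe, hθ'.sub_eq hγ' hΘ' hΘe', hp, hq, hp', hq', planeComplex_line_one,
    planeComplex_line_two, planeComplex_line_one, planeComplex_line_two]
  have h1 := congrArg planeComplex hm₁
  have h2 := congrArg planeComplex hm₂
  rw [← complexConj_planeComplex, planeComplex_line_one, planeComplex_line_one] at h1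
  rw [← complexConj_planeComplex, planeComplex_line_two, planeComplex_line_two] at h2
  exact_mod_cast IsStraightened.im_log_displacement_sub_eq hK hBf.1.exists_isPairLog
    hBf'.1.exists_isPairLog (fun z => by simp [complexConj, conjH]) hf hf' (hfix hBf)
    (m₁ := m₁) (m₂ := m₂) (by simpa using h1) (by simpa using h2) hΘ hΘe hΘ' hΘe' p q p' q'
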